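/- Let G be a finitely generated group with infinitely many ends, let H be a group, and let phi : H -> Aut(G) be a homomorphism. Then the semidirect product G ⋊_phi H is acylindrically hyperbolic if and only if the kernel of the composition H -> Aut(G) -> Out(G) is a finite subgroup of H. -/

import Mathlib

noncomputable section

open Metric Set

universe u v

/-- A geodesic metric space: any two points are joined by an isometrically
parametrized segment. -/
def GeodesicSpace (Y : Type*) [MetricSpace Y] : Prop :=
  ∀ x y : Y, ∃ f : ℝ → Y, f 0 = x ∧ f (dist x y) = y ∧
    ∀ s ∈ Set.Icc (0:ℝ) (dist x y), ∀ t ∈ Set.Icc (0:ℝ) (dist x y),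
      dist (f s) (f t) = |s - t|

/-- Gromov hyperbolicity (four-point condition) with constant `δ`. -/
def GromovHyperbolic (Y : Type*) [MetricSpace Y] (δ : ℝ) : Prop :=
  ∀ x y z w : Y, dist x y + dist z w ≤ max (dist x z + dist y w) (dist x w + dist y z) + 2 * δ

/-- A Gromov hyperbolic geodesic metric space. -/
def HyperbolicGeodesicSpace (Y : Type*) [MetricSpace Y] : Prop :=
  GeodesicSpace Y ∧ ∃ δ : ℝ, 0 ≤ δ ∧ GromovHyperbolic Y δ

/-- An isometric action `ρ` of `G` on `Y` is acylindrical if for every `R > 0` there are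
`L > 0` and `N` such that for any two points at distance `> L`, at most `N` elements of `G`
move both points by less than `R`. -/
def IsAcylindrical {G : Type*} [Group G] {Y : Type*} [MetricSpace Y] (ρ : G →* (Y ≃ᵢ Y)) : Prop :=
  ∀ R : ℝ, 0 < R → ∃ L : ℝ, 0 < L ∧ ∃ N : ℕ, ∀ x y : Y, L < dist x y →
    ∃ s : Finset G, s.card ≤ N ∧
      ∀ g : G, dist x (ρ g x) < R → dist y (ρ g y) < R → g ∈ s

/-- A group is virtually cyclic if it has a cyclic subgroup of finite index. -/
def VirtuallyCyclic (G : Type*) [Group G] : Prop :=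
  ∃ H : Subgroup G, H.FiniteIndex ∧ IsCyclic ↥H

/-- A group is acylindrically hyperbolic if it is not virtually cyclic and admits an
acylindrical isometric action with unbounded orbits on a Gromov hyperbolic geodesic space
(this is equivalent to admitting a nonelementary acylindrical action on such a space). -/
def AcylindricallyHyperbolic (G : Type u) [Group G] : Prop :=
  ¬ VirtuallyCyclic G ∧
    ∃ (Y : Type u) (_ : MetricSpace Y) (ρ : G →* (Y ≃ᵢ Y)),
      HyperbolicGeodesicSpace Y ∧ IsAcylindrical ρ ∧
      ∃ y : Y, ¬ Bornology.IsBounded (Set.range fun g : G => ρ g y)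

/-- The Cayley graph of a group with respect to a generating set `S`. -/
def cayleyGraph {G : Type*} [Group G] (S : Set G) : SimpleGraph G :=
  SimpleGraph.fromRel (fun x y => x⁻¹ * y ∈ S)

/-- A finitely generated group has infinitely many ends: the Cayley graph with respect
to any finite generating set has infinitely many ends. -/
def InfinitelyManyEnds (G : Type*) [Group G] : Prop :=
  ∀ S : Finset G, Subgroup.closure (S : Set G) = ⊤ →
    ((cayleyGraph (S : Set G)).end).Infinite

section
universe w

namespace TSpan

variable {X : Type u}

/-- pseudo-metric as a function -/
structure PM (d : X → X → ℝ) : Prop where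
  zero : ∀ x, d x x = 0
  symm : ∀ x y, d x y = d y x
  tri : ∀ x y z, d x z ≤ d x y + d y z

/-- tight span -/
abbrev TS (d : X → X → ℝ) : Type u :=
  {f : X → ℝ // (∀ x y, d x y ≤ f x + f y) ∧ ∀ x, ∀ ε > 0, ∃ y, f x + f y < d x y + ε}

variable {d : X → X → ℝ}

/-- star -/
def st (d : X → X → ℝ) (f : X → ℝ) (x : X) : ℝ := ⨆ y, (d x y - f y)

def qq (d : X → X → ℝ) (f : X → ℝ) (x : X) : ℝ := (f x + st d f x) / 2

lemma st_bdd {f : X → ℝ} (hf : ∀ x y, d x y ≤ f x + f y) (x : X) :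
    BddAbove (range fun y => d x y - f y) := by
  refine ⟨f x, ?_⟩
  rintro _ ⟨y, rfl⟩
  have := hf x y
  simp only; linarith

lemma le_st {f : X → ℝ} (hf : ∀ x y, d x y ≤ f x + f y) (x y : X) : d x y ≤ st d f x + f y := by
  have := le_ciSup (st_bdd hf x) y
  unfold st; linarith

lemma st_le {f : X → ℝ} {x : X} {c : ℝ} (h : ∀ y, d x y ≤ c + f y) : st d f x ≤ c := by
  haveI : Nonempty X := ⟨x⟩
  apply ciSup_le
  intro y; have := h y; linarith

lemma qq_le {f : X → ℝ} (hf : ∀ x y, d x y ≤ f x + f y) (x : X) : qq d f x ≤ f x := by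
  have : st d f x ≤ f x := st_le (hf x)
  unfold qq; linarith

lemma qq_mem (hd : PM d) {f : X → ℝ} (hf : ∀ x y, d x y ≤ f x + f y) (x y : X) :
    d x y ≤ qq d f x + qq d f y := by
  have h1 := le_st hf x y
  have h2 := le_st hf y x
  have := hd.symm x y
  unfold qq; linarith

lemma qq_gap {f : X → ℝ} (hd : PM d) (hf : ∀ x y, d x y ≤ f x + f y) (x : X) :
    qq d f x - st d (qq d f) x ≤ (f x - st d f x) / 2 := by
  have : st d f x ≤ st d (qq d f) x := by
    apply st_le
    intro y
    have h1 := le_st (qq_mem hd hf) x y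
    have h2 := qq_le hf y
    linarith
  have e : qq d f x = (f x + st d f x) / 2 := rfl
  linarith

lemma qq_lip {f g : X → ℝ} (hg : ∀ x y, d x y ≤ g x + g y) {c : ℝ}
    (h : ∀ x, |f x - g x| ≤ c) (x : X) : qq d f x ≤ qq d g x + c := by
  have h1 : st d f x ≤ st d g x + c := by
    apply st_le
    intro y
    have h1 := le_st hg x y
    have h2 := abs_le.1 (h y)
    linarith
  have h2 := abs_le.1 (h x)
  unfold qq; linarith

lemma it_mem (hd : PM d) {f : X → ℝ} (hf : ∀ x y, d x y ≤ f x + f y) (n : ℕ) :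
    ∀ x y, d x y ≤ ((qq d)^[n] f) x + ((qq d)^[n] f) y := by
  induction n with
  | zero => simpa using hf
  | succ n ih =>
    rw [Function.iterate_succ_apply']
    exact qq_mem hd ih

lemma nonneg_of (hd : PM d) {f : X → ℝ} (hf : ∀ x y, d x y ≤ f x + f y) (x : X) : 0 ≤ f x := by
  have := hf x x
  rw [hd.zero] at this; linarith

lemma it_anti (hd : PM d) {f : X → ℝ} (hf : ∀ x y, d x y ≤ f x + f y) (x : X) :
    Antitone (fun n => ((qq d)^[n] f) x) := by
  apply antitone_nat_of_succ_le
  intro n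
  rw [Function.iterate_succ_apply']
  exact qq_le (it_mem hd hf n) x

def pp (d : X → X → ℝ) (f : X → ℝ) (x : X) : ℝ := ⨅ n : ℕ, ((qq d)^[n] f) x

lemma it_bdd (hd : PM d) {f : X → ℝ} (hf : ∀ x y, d x y ≤ f x + f y) (x : X) :
    BddBelow (range fun n => ((qq d)^[n] f) x) := by
  refine ⟨0, ?_⟩
  rintro _ ⟨n, rfl⟩
  exact nonneg_of hd (it_mem hd hf n) x

lemma pp_le (hd : PM d) {f : X → ℝ} (hf : ∀ x y, d x y ≤ f x + f y) (x : X) (n : ℕ) :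
    pp d f x ≤ ((qq d)^[n] f) x := ciInf_le (it_bdd hd hf x) n

lemma pp_mem (hd : PM d) {f : X → ℝ} (hf : ∀ x y, d x y ≤ f x + f y) (x y : X) :
    d x y ≤ pp d f x + pp d f y := by
  apply le_of_forall_pos_le_add
  intro ε hε
  obtain ⟨n, hn⟩ := exists_lt_of_ciInf_lt (show pp d f x < pp d f x + ε/2 by linarith)
  obtain ⟨m, hm⟩ := exists_lt_of_ciInf_lt (show pp d f y < pp d f y + ε/2 by linarith)
  have h1 := it_anti hd hf x (le_max_left n m)
  have h2 := it_anti hd hf y (le_max_right n m)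
  have h3 := it_mem hd hf (max n m) x y
  simp only at h1 h2
  linarith

lemma it_gap (hd : PM d) {f : X → ℝ} (hf : ∀ x y, d x y ≤ f x + f y) (x : X) (n : ℕ) :
    ((qq d)^[n] f) x - st d ((qq d)^[n] f) x ≤ (f x - st d f x) / 2 ^ n := by
  induction n with
  | zero => simp
  | succ n ih =>
    rw [Function.iterate_succ_apply']
    have := qq_gap hd (it_mem hd hf n) x
    rw [pow_succ]
    have e : (f x - st d f x) / (2 ^ n * 2) = (f x - st d f x) / 2 ^ n / 2 := by field_simp
    rw [e]; linarith

lemma pp_ext (hd : PM d) {f : X → ℝ} (hf : ∀ x y, d x y ≤ f x + f y) (x : X) (ε : ℝ) (hε : 0 < ε) :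
    ∃ y, pp d f x + pp d f y < d x y + ε := by
  have hlim : Filter.Tendsto (fun n : ℕ => (f x - st d f x) / (2:ℝ) ^ n) Filter.atTop (nhds 0) :=
    tendsto_const_nhds.div_atTop (tendsto_pow_atTop_atTop_of_one_lt (by norm_num))
  obtain ⟨n, hn⟩ := (hlim.eventually (gt_mem_nhds (show (0:ℝ) < ε/2 by linarith))).exists
  have h1 := it_gap hd hf x n
  haveI : Nonempty X := ⟨x⟩
  obtain ⟨y, hy⟩ := exists_lt_of_lt_ciSup
    (show st d ((qq d)^[n] f) x - ε/2 < ⨆ y, (d x y - ((qq d)^[n] f) y) by unfold st; linarith)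
  refine ⟨y, ?_⟩
  have := pp_le hd hf x n
  have := pp_le hd hf y n
  linarith

def proj (hd : PM d) (f : X → ℝ) (hf : ∀ x y, d x y ≤ f x + f y) : TS d :=
  ⟨pp d f, pp_mem hd hf, fun x ε h => pp_ext hd hf x ε h⟩

lemma proj_lip (hd : PM d) {f g : X → ℝ} (hf : ∀ x y, d x y ≤ f x + f y)
    (hg : ∀ x y, d x y ≤ g x + g y) {c : ℝ}
    (h : ∀ x, |f x - g x| ≤ c) (x : X) : |pp d f x - pp d g x| ≤ c := by
  have key : ∀ n, ∀ x, |((qq d)^[n] f) x - ((qq d)^[n] g) x| ≤ c := by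
    intro n
    induction n with
    | zero => simpa using h
    | succ n ih =>
      intro x
      rw [Function.iterate_succ_apply', Function.iterate_succ_apply']
      rw [abs_le]
      have h1 := qq_lip (it_mem hd hg n) ih x
      have h2 := qq_lip (it_mem hd hf n) (fun x => by rw [abs_sub_comm]; exact ih x) x
      constructor <;> linarith
  rw [abs_le]
  have h1 : pp d f x - c ≤ pp d g x := le_ciInf fun n => by
    have := pp_le hd hf x n
    have := abs_le.1 (key n x)
    linarith
  have h2 : pp d g x - c ≤ pp d f x := le_ciInf fun n => by
    have := pp_le hd hg x n
    have := abs_le.1 (key n x)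
    linarith
  constructor <;> linarith

lemma pp_fix (f : TS d) : pp d f.1 = f.1 := by
  have h : qq d f.1 = f.1 := by
    funext x
    have h1 : st d f.1 x ≤ f.1 x := st_le (f.2.1 x)
    have h2 : f.1 x ≤ st d f.1 x := by
      apply le_of_forall_pos_le_add
      intro ε hε
      obtain ⟨y, hy⟩ := f.2.2 x ε hε
      have := le_st f.2.1 x y
      linarith
    unfold qq; linarith
  funext x
  have : ∀ n, (qq d)^[n] f.1 = f.1 := fun n => Function.iterate_fixed h n
  unfold pp
  simp [this]

lemma ts_bdd (hd : PM d) (f g : TS d) (o x : X) : |f.1 x - g.1 x| ≤ f.1 o + g.1 o := by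
  have key : ∀ f g : TS d, f.1 x - g.1 x ≤ f.1 o + g.1 o := by
    intro f g
    apply le_of_forall_pos_le_add
    intro ε hε
    obtain ⟨y, hy⟩ := f.2.2 x ε hε
    have h1 := hd.tri x o y
    have h2 := f.2.1 o y
    have h3 := g.2.1 x o
    linarith
  rw [abs_le]
  have := key f g
  have := key g f
  constructor <;> linarith

def metricTS [Nonempty X] (hd : PM d) : MetricSpace (TS d) where
  dist f g := ⨆ x, |f.1 x - g.1 x|
  dist_self f := by simp
  dist_comm f g := by simp_rw [abs_sub_comm]
  dist_triangle f g h := by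
    have bd : ∀ f g : TS d, BddAbove (range fun x => |f.1 x - g.1 x|) := fun f g =>
      ⟨f.1 (Classical.arbitrary X) + g.1 (Classical.arbitrary X), by
        rintro _ ⟨x, rfl⟩; exact ts_bdd hd f g _ x⟩
    apply ciSup_le
    intro x
    have h1 := le_ciSup (bd f g) x
    have h2 := le_ciSup (bd g h) x
    have h3 := abs_sub_le (f.1 x) (g.1 x) (h.1 x)
    try simp only at h1 h2
    linarith
  eq_of_dist_eq_zero := by
    intro f g h
    have bd : BddAbove (range fun x => |f.1 x - g.1 x|) :=
      ⟨f.1 (Classical.arbitrary X) + g.1 (Classical.arbitrary X), by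
        rintro _ ⟨x, rfl⟩; exact ts_bdd hd f g _ x⟩
    apply Subtype.ext
    funext x
    have h1 := le_ciSup bd x
    have h2 : |f.1 x - g.1 x| ≤ 0 := h1.trans (le_of_eq h)
    have := abs_nonpos_iff.1 h2
    linarith

theorem exists_span {Γ : Type u} [Group Γ] (d : Γ → Γ → ℝ) (hd : PM d)
    (hinv : ∀ γ x y, d (γ * x) (γ * y) = d x y) (δ : ℝ)
    (h4 : ∀ x y z w, d x y + d z w ≤ max (d x z + d y w) (d x w + d y z) + 2 * δ) :
    ∃ (Y : Type u) (_ : MetricSpace Y) (ρ : Γ →* (Y ≃ᵢ Y)) (ι : Γ → Y),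
      GeodesicSpace Y ∧ GromovHyperbolic Y δ ∧ (∀ x y, dist (ι x) (ι y) = d x y) ∧
      (∀ γ x, ρ γ (ι x) = ι (γ * x)) ∧
      ∀ f g : Y, ∀ ε > 0, ∃ x y, dist (ι x) f + dist f g + dist g (ι y) - ε ≤ d x y := by
  letI M : MetricSpace (TS d) := metricTS hd
  have dist_def : ∀ f g : TS d, dist f g = ⨆ x, |f.1 x - g.1 x| := fun _ _ => rfl
  have le_dist : ∀ (f g : TS d) x, |f.1 x - g.1 x| ≤ dist f g := fun f g x =>
    le_ciSup (f := fun x => |f.1 x - g.1 x|) ⟨f.1 1 + g.1 1, by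
        rintro _ ⟨x, rfl⟩; exact ts_bdd hd f g _ x⟩ x
  have dist_le : ∀ (f g : TS d) c, (∀ x, |f.1 x - g.1 x| ≤ c) → dist f g ≤ c := fun f g c h =>
    ciSup_le h
  let ι : Γ → TS d := fun x => ⟨fun y => d x y, fun y z => by
    have := hd.tri y x z; have := hd.symm y x; linarith, fun y ε hε => ⟨x, by
      have := hd.symm x y; have := hd.zero x; simp only; linarith⟩⟩
  have dι : ∀ x (f : TS d), dist (ι x) f = f.1 x := by
    intro x f
    apply le_antisymm
    · apply dist_le
      intro y
      have h1 := ts_bdd hd (ι x) f x y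
      have e : (ι x).1 x = 0 := hd.zero x
      rw [e] at h1; linarith
    · have := le_dist (ι x) f x
      have e : (ι x).1 x = 0 := hd.zero x
      rw [e] at this
      have h2 := neg_abs_le (0 - f.1 x)
      linarith
  have act_mem : ∀ (γ : Γ) (f : TS d), (∀ x y, d x y ≤ f.1 (γ⁻¹ * x) + f.1 (γ⁻¹ * y)) ∧
      ∀ x, ∀ ε > 0, ∃ y, f.1 (γ⁻¹ * x) + f.1 (γ⁻¹ * y) < d x y + ε := by
    intro γ f
    refine ⟨fun x y => ?_, fun x ε hε => ?_⟩
    · rw [← hinv γ⁻¹ x y]; exact f.2.1 _ _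
    · obtain ⟨y, hy⟩ := f.2.2 (γ⁻¹ * x) ε hε
      refine ⟨γ * y, ?_⟩
      rw [← hinv γ⁻¹ x]
      simpa using hy
  let act : Γ → TS d → TS d := fun γ f => ⟨fun x => f.1 (γ⁻¹ * x), act_mem γ f⟩
  have act_mul : ∀ a b f, act (a * b) f = act a (act b f) := by
    intro a b f
    apply Subtype.ext; funext x
    simp [act, mul_assoc]
  have act_one : ∀ f, act 1 f = f := by
    intro f; apply Subtype.ext; funext x; simp [act]
  have act_isom : ∀ γ, Isometry (act γ) := by
    intro γ
    apply Isometry.of_dist_eq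
    have key : ∀ γ f g, dist (act γ f) (act γ g) ≤ dist f g := by
      intro γ f g
      exact dist_le _ _ _ fun x => le_dist f g (γ⁻¹ * x)
    intro f g
    apply le_antisymm (key γ f g)
    have := key γ⁻¹ (act γ f) (act γ g)
    rwa [← act_mul, ← act_mul, inv_mul_cancel, act_one, act_one] at this
  let ρ : Γ →* (TS d ≃ᵢ TS d) :=
    { toFun := fun γ => ⟨⟨act γ, act γ⁻¹, fun f => by rw [← act_mul, inv_mul_cancel, act_one],
        fun f => by rw [← act_mul, mul_inv_cancel, act_one]⟩, act_isom γ⟩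
      map_one' := IsometryEquiv.ext fun f => act_one f
      map_mul' := fun a b => IsometryEquiv.ext fun f => act_mul a b f }
  have app : ∀ f g : TS d, ∀ ε > 0, ∃ x y, dist (ι x) f + dist f g + dist g (ι y) - ε ≤ d x y := by
    intro f g ε hε
    obtain ⟨x, hx⟩ := exists_lt_of_lt_ciSup
      (show dist f g - ε/2 < ⨆ x, |f.1 x - g.1 x| by rw [← dist_def]; linarith)
    rcases abs_cases (f.1 x - g.1 x) with ⟨h, _⟩ | ⟨h, _⟩
    · obtain ⟨y, hy⟩ := f.2.2 x (ε/2) (by linarith)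
      refine ⟨y, x, ?_⟩
      rw [dist_comm g, dι, dι, hd.symm y x]
      linarith
    · obtain ⟨y, hy⟩ := g.2.2 x (ε/2) (by linarith)
      refine ⟨x, y, ?_⟩
      rw [dist_comm g, dι, dι]
      linarith
  refine ⟨TS d, M, ρ, ι, ?_, ?_, ?_, ?_, app⟩
  · intro f g
    rcases eq_or_lt_of_le (dist_nonneg (x := f) (y := g)) with h0 | hpos
    · have e := eq_of_dist_eq_zero h0.symm
      subst e
      refine ⟨fun _ => f, rfl, rfl, ?_⟩
      intro s hs t ht
      rw [dist_self] at *
      have : s = 0 := le_antisymm hs.2 hs.1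
      have : t = 0 := le_antisymm ht.2 ht.1
      simp [*]
    set D := dist f g with hD
    let F : ℝ → Γ → ℝ := fun s x => f.1 x + (s / D) * (g.1 x - f.1 x)
    have hF : ∀ s ∈ Icc 0 D, ∀ x y, d x y ≤ F s x + F s y := by
      intro s hs x y
      have h1 := f.2.1 x y
      have h2 := g.2.1 x y
      have h3 : 0 ≤ s / D := div_nonneg hs.1 hpos.le
      have h4 : s / D ≤ 1 := (div_le_one hpos).2 hs.2
      simp only [F]
      nlinarith
    classical
    let c : ℝ → TS d := fun s => if h : s ∈ Icc 0 D then proj hd (F s) (hF s h) else f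
    have c0 : c 0 = f := by
      have : (0:ℝ) ∈ Icc 0 D := ⟨le_rfl, hpos.le⟩
      simp only [c, dif_pos this]
      apply Subtype.ext
      have e : F 0 = f.1 := by funext x; simp [F]
      simp only [proj, e, pp_fix]
    have cD : c D = g := by
      have : D ∈ Icc 0 D := ⟨hpos.le, le_rfl⟩
      simp only [c, dif_pos this]
      apply Subtype.ext
      have e : F D = g.1 := by funext x; simp only [F]; rw [div_self hpos.ne']; ring
      simp only [proj, e, pp_fix]
    have clip : ∀ s ∈ Icc 0 D, ∀ t ∈ Icc 0 D, dist (c s) (c t) ≤ |s - t| := by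
      intro s hs t ht
      simp only [c, dif_pos hs, dif_pos ht]
      apply dist_le
      apply proj_lip hd (hF s hs) (hF t ht)
      intro x
      have e : F s x - F t x = (s - t) / D * (g.1 x - f.1 x) := by simp only [F]; ring
      rw [e, abs_mul, abs_div, abs_of_pos hpos]
      have := le_dist f g x
      rw [abs_sub_comm] at this
      rw [div_mul_eq_mul_div, div_le_iff₀ hpos]
      exact mul_le_mul_of_nonneg_left this (abs_nonneg _)
    refine ⟨c, c0, cD, ?_⟩
    have mono : ∀ s ∈ Icc 0 D, ∀ t ∈ Icc 0 D, s ≤ t → dist (c s) (c t) = |s - t| := by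
      intro s hs t ht hst
      apply le_antisymm (clip s hs t ht)
      have h1 := clip 0 ⟨le_rfl, hpos.le⟩ s hs
      have h2 := clip t ht D ⟨hpos.le, le_rfl⟩
      rw [c0] at h1; rw [cD] at h2
      have h3 := dist_triangle4 f (c s) (c t) g
      have e1 : |0 - s| = s := by rw [zero_sub, abs_neg, abs_of_nonneg hs.1]
      have e2 : |t - D| = D - t := by rw [abs_sub_comm, abs_of_nonneg (by linarith [ht.2])]
      have e3 : |s - t| = t - s := by rw [abs_sub_comm, abs_of_nonneg (by linarith)]
      rw [e1] at h1; rw [e2] at h2; rw [e3]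
      linarith
    intro s hs t ht
    rcases le_total s t with h | h
    · exact mono s hs t ht h
    · rw [dist_comm, abs_sub_comm]; exact mono t ht s hs h
  · intro f g h k
    apply le_of_forall_pos_le_add
    intro ε hε
    obtain ⟨x, y, h1⟩ := app f g (ε/2) (by linarith)
    obtain ⟨z, w, h2⟩ := app h k (ε/2) (by linarith)
    have dd : ∀ x y f g, d x y ≤ dist (ι x) f + dist f g + dist g (ι y) := by
      intro x y f g
      have e : dist (ι x) (ι y) = d x y := by rw [dι]; exact hd.symm y x
      rw [← e]; exact dist_triangle4 _ _ _ _
    have a1 := dd x z f h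
    have a2 := dd y w g k
    have a3 := dd x w f k
    have a4 := dd y z g h
    have a5 := h4 x y z w
    rw [dist_comm g (ι y)] at h1
    rw [dist_comm k (ι w)] at h2 a2 a3
    rw [dist_comm h (ι z)] at a1 a4
    have : max (d x z + d y w) (d x w + d y z) ≤ max (dist f h + dist g k) (dist f k + dist g h)
        + (dist (ι x) f + dist (ι y) g + dist (ι z) h + dist (ι w) k) := by
      apply max_le
      · have := le_max_left (dist f h + dist g k) (dist f k + dist g h)
        linarith
      · have := le_max_right (dist f h + dist g k) (dist f k + dist g h)
        linarith
    linarith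
  · intro x y; rw [dι]; exact hd.symm y x
  · intro γ x
    apply Subtype.ext; funext y
    change d x (γ⁻¹ * y) = d (γ * x) y
    rw [← hinv γ x]; simp

end TSpan

end

section
universe w
open scoped Pointwise

/-- crossing of sets -/
def Cross {E : Type*} (A B : Set E) : Prop :=
  (A ∩ B).Nonempty ∧ (A \ B).Nonempty ∧ (B \ A).Nonempty ∧ (A ∪ B)ᶜ.Nonempty

structure CutData (Γ : Type u) [Group Γ] (E : Type w) [MulAction Γ E] where
  G : Subgroup Γ
  nrm : G.Normal
  U : Set E
  g : Γ
  hgG : g ∈ G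
  maj : Set E → Prop
  maj_mono : ∀ A B, A ⊆ B → maj A → maj B
  maj_compl : ∀ A, maj Aᶜ ↔ ¬ maj A
  cross_fin : {h : Γ | h ∈ G ∧ Cross (h • U) U}.Finite
  hgU : U ⊂ g • U
  univ : ∀ V : Set E, (∃ γ : Γ, V = γ • U ∨ V = (γ • U)ᶜ) →
    ∃ h ∈ G, h • U ⊆ V ∧ V ⊆ (h * g) • U
  hfin : ∀ x y : Γ, {h : Γ | h ∈ G ∧ maj (x⁻¹ • h • U) ∧ ¬ maj (y⁻¹ • h • U)}.Finite
  hp : ∃ p : Γ, maj (p⁻¹ • U)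
  hq : ∃ q : Γ, ¬ maj (q⁻¹ • U)

namespace CutData

variable {Γ : Type u} [Group Γ] {E : Type w} [MulAction Γ E] (D : CutData Γ E)

def c0 : ℕ := {h : Γ | h ∈ D.G ∧ Cross (h • D.U) D.U}.ncard

def Cut (V : Set E) : Prop := ∃ γ : Γ, V = γ • D.U ∨ V = (γ • D.U)ᶜ

def sg (x : Γ) (A : Set E) : Prop := D.maj (x⁻¹ • A)

def Ann (e : Γ) (a : Set E × Set E) : Prop :=
  ∃ γ : Γ, a = (γ • D.U, (γ * e) • D.U) ∨ a = (((γ * e) • D.U)ᶜ, (γ • D.U)ᶜ)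

def Lt (a b : Set E × Set E) : Prop := a.2 ⊂ b.1

def Chain (e : Γ) (l : List (Set E × Set E)) : Prop := (∀ a ∈ l, D.Ann e a) ∧ l.Pairwise Lt

def Sep (x y : Γ) (a : Set E × Set E) : Prop := D.sg x a.1 ∧ ¬ D.sg y a.2

def OK (e : Γ) : Prop := D.g • D.U ⊆ e • D.U

variable {D}

lemma sg_mono {x : Γ} {A B : Set E} (h : A ⊆ B) (hA : D.sg x A) : D.sg x B :=
  D.maj_mono _ _ (Set.smul_set_mono h) hA

lemma sg_compl {x : Γ} {A : Set E} : D.sg x Aᶜ ↔ ¬ D.sg x A := by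
  unfold sg; rw [Set.smul_set_compl, D.maj_compl]

lemma sg_smul {γ x : Γ} {A : Set E} : D.sg (γ * x) (γ • A) ↔ D.sg x A := by
  unfold sg; rw [mul_inv_rev, mul_smul, inv_smul_smul]

lemma sg_inter {x : Γ} {A B : Set E} (hA : D.sg x A) (hB : D.sg x B) : (A ∩ B).Nonempty := by
  by_contra h
  rw [Set.not_nonempty_iff_eq_empty] at h
  have : B ⊆ Aᶜ := fun y hy hy' => by
    have : y ∈ A ∩ B := ⟨hy', hy⟩
    rw [h] at this; exact this
  exact sg_compl.1 (sg_mono this hB) hA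

lemma sg_diff {x : Γ} {A B : Set E} (hA : D.sg x A) (hB : ¬ D.sg x B) : (A \ B).Nonempty :=
  sg_inter hA (sg_compl.2 hB)

lemma Cut.smul {V : Set E} (h : D.Cut V) (γ : Γ) : D.Cut (γ • V) := by
  obtain ⟨β, rfl | rfl⟩ := h
  · exact ⟨γ * β, Or.inl (by rw [mul_smul])⟩
  · exact ⟨γ * β, Or.inr (by rw [Set.smul_set_compl, mul_smul])⟩

lemma Cut.compl {V : Set E} (h : D.Cut V) : D.Cut Vᶜ := by
  obtain ⟨β, rfl | rfl⟩ := h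
  · exact ⟨β, Or.inr rfl⟩
  · exact ⟨β, Or.inl (compl_compl _)⟩

lemma Ann.cut {e : Γ} {a : Set E × Set E} (h : D.Ann e a) : D.Cut a.1 ∧ D.Cut a.2 := by
  obtain ⟨β, rfl | rfl⟩ := h
  · exact ⟨⟨β, Or.inl rfl⟩, ⟨β * e, Or.inl rfl⟩⟩
  · exact ⟨⟨β * e, Or.inr rfl⟩, ⟨β, Or.inr rfl⟩⟩

lemma OK.lt {e : Γ} (h : D.OK e) : D.U ⊂ e • D.U := D.hgU.trans_subset h

lemma Ann.sub {e : Γ} (he : D.OK e) {a : Set E × Set E} (h : D.Ann e a) : a.1 ⊆ a.2 := by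
  obtain ⟨β, rfl | rfl⟩ := h
  · simp only [mul_smul]; exact Set.smul_set_mono he.lt.subset
  · simp only [mul_smul]; exact Set.compl_subset_compl.2 (Set.smul_set_mono he.lt.subset)

/-- reversal -/
def swp (a : Set E × Set E) : Set E × Set E := (a.2ᶜ, a.1ᶜ)

lemma Ann.swp {e : Γ} {a : Set E × Set E} (h : D.Ann e a) : D.Ann e (swp a) := by
  obtain ⟨β, rfl | rfl⟩ := h
  · exact ⟨β, Or.inr rfl⟩
  · exact ⟨β, Or.inl (by simp [CutData.swp])⟩

lemma Lt.swp {a b : Set E × Set E} (h : Lt a b) : Lt (swp b) (swp a) := by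
  unfold Lt CutData.swp
  exact compl_lt_compl_iff_lt.2 h

lemma Sep.swp {x y : Γ} {a : Set E × Set E} (h : D.Sep x y a) : D.Sep y x (swp a) := by
  refine ⟨sg_compl.2 h.2, ?_⟩
  intro h'
  exact (sg_compl.1 h') h.1

/-- translate -/
def tr (γ : Γ) (a : Set E × Set E) : Set E × Set E := (γ • a.1, γ • a.2)

lemma Ann.tr {e : Γ} {a : Set E × Set E} (h : D.Ann e a) (γ : Γ) : D.Ann e (tr γ a) := by
  obtain ⟨β, rfl | rfl⟩ := h
  · exact ⟨γ * β, Or.inl (by simp [CutData.tr, mul_smul])⟩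
  · exact ⟨γ * β, Or.inr (by simp [CutData.tr, mul_smul, Set.smul_set_compl])⟩

lemma smul_ssub {γ : Γ} {A B : Set E} : γ • A ⊂ γ • B ↔ A ⊂ B := by
  rw [Set.ssubset_def, Set.ssubset_def, Set.smul_set_subset_smul_set_iff,
    Set.smul_set_subset_smul_set_iff]

lemma Lt.tr {a b : Set E × Set E} (h : Lt a b) (γ : Γ) : Lt (tr γ a) (tr γ b) :=
  smul_ssub.2 h

lemma Sep.tr {x y : Γ} {a : Set E × Set E} (h : D.Sep x y a) (γ : Γ) :
    D.Sep (γ * x) (γ * y) (tr γ a) := ⟨sg_smul.2 h.1, fun h' => h.2 (sg_smul.1 h')⟩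

lemma Chain.tr {e : Γ} {l : List (Set E × Set E)} (h : D.Chain e l) (γ : Γ) :
    D.Chain e (l.map (tr γ)) := by
  refine ⟨?_, ?_⟩
  · intro a ha
    obtain ⟨b, hb, rfl⟩ := List.mem_map.1 ha
    exact (h.1 b hb).tr γ
  · rw [List.pairwise_map]
    exact h.2.imp fun h => h.tr γ

lemma Chain.swp {e : Γ} {l : List (Set E × Set E)} (h : D.Chain e l) :
    D.Chain e (l.reverse.map swp) := by
  refine ⟨?_, ?_⟩
  · intro a ha
    obtain ⟨b, hb, rfl⟩ := List.mem_map.1 ha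
    exact (h.1 b (List.mem_reverse.1 hb)).swp
  · rw [List.pairwise_map, List.pairwise_reverse]
    exact h.2.imp fun h => h.swp

lemma sep_swp {x y : Γ} {l : List (Set E × Set E)} (h : ∀ a ∈ l, D.Sep x y a) :
    ∀ a ∈ l.reverse.map swp, D.Sep y x a := by
  intro a ha
  obtain ⟨b, hb, rfl⟩ := List.mem_map.1 ha
  exact (h b (List.mem_reverse.1 hb)).swp

lemma sep_tr {x y : Γ} (γ : Γ) {l : List (Set E × Set E)} (h : ∀ a ∈ l, D.Sep x y a) :
    ∀ a ∈ l.map (tr γ), D.Sep (γ * x) (γ * y) a := by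
  intro a ha
  obtain ⟨b, hb, rfl⟩ := List.mem_map.1 ha
  exact (h b hb).tr γ

lemma Chain.sublist {e : Γ} {l l' : List (Set E × Set E)} (h : D.Chain e l) (hs : l'.Sublist l) :
    D.Chain e l' := ⟨fun a ha => h.1 a (hs.subset ha), h.2.sublist hs⟩

/-- universality -/
lemma Ann.univ {e : Γ} (he : D.OK e) {a : Set E × Set E} (h : D.Ann e a) {B : Set E}
    (hB : D.Cut B) : ∃ h ∈ D.G, a.1 ⊆ h • B ∧ h • B ⊆ a.2 := by
  have key : ∀ (γ : Γ) (B : Set E), D.Cut B → ∃ h ∈ D.G, γ • D.U ⊆ h • B ∧ h • B ⊆ (γ * e) • D.U := by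
    intro γ B hB
    obtain ⟨h, hG, h1, h2⟩ := D.univ (γ⁻¹ • B) (hB.smul _)
    refine ⟨γ * h⁻¹ * γ⁻¹, D.nrm.conj_mem _ (D.G.inv_mem hG) γ, ?_, ?_⟩
    · have := Set.smul_set_mono (a := γ * h⁻¹) h1
      simpa [mul_smul] using this
    · have := Set.smul_set_mono (a := γ * h⁻¹) h2
      have h3 : (γ * h⁻¹ * γ⁻¹) • B ⊆ γ • D.g • D.U := by simpa [mul_smul] using this
      refine h3.trans ?_
      rw [mul_smul]
      exact Set.smul_set_mono he
  obtain ⟨γ, rfl | rfl⟩ := h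
  · exact key γ B hB
  · obtain ⟨h, hG, h1, h2⟩ := key γ Bᶜ hB.compl
    rw [Set.smul_set_compl] at h1 h2
    exact ⟨h, hG, Set.compl_subset_comm.1 h2, Set.subset_compl_comm.1 h1⟩

/-- counting lemma -/
lemma Chain.count {e : Γ} {l : List (Set E × Set E)} (h : D.Chain e l) (B : Set E) {F : Set Γ}
    (hF : F.Finite) (hl : ∀ a ∈ l, ∃ h ∈ F, a.1 ⊆ h • B ∧ h • B ⊆ a.2) :
    l.length ≤ F.ncard := by
  classical
  choose! f hfF hf1 hf2 using hl
  have nd : (l.map f).Nodup := by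
    rw [List.Nodup, List.pairwise_map]
    refine h.2.imp_of_mem ?_
    intro a b ha hb hab heq
    have h1 := hf2 a ha
    have h2 := hf1 b hb
    rw [← heq] at h2
    exact (hab.trans_subset (h2.trans h1)).ne rfl
  rw [← List.length_map f, ← List.toFinset_card_of_nodup nd, Set.ncard_eq_toFinset_card F hF]
  apply Finset.card_le_card
  intro x hx
  simp only [List.mem_toFinset, List.mem_map] at hx
  obtain ⟨a, ha, rfl⟩ := hx
  simpa using hfF a ha

lemma cross_smul {γ : Γ} {A B : Set E} : Cross (γ • A) (γ • B) ↔ Cross A B := by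
  unfold Cross
  rw [← Set.smul_set_inter, ← Set.smul_set_sdiff, ← Set.smul_set_sdiff, ← Set.smul_set_union,
    ← Set.smul_set_compl]
  simp only [Set.smul_set_nonempty]

lemma cross_compl {A B : Set E} (h : Cross Aᶜ Bᶜ) : Cross A B := by
  obtain ⟨h1, h2, h3, h4⟩ := h
  refine ⟨?_, ?_, ?_, ?_⟩
  · rwa [Set.compl_union, compl_compl, compl_compl] at h4
  · rwa [Set.diff_eq, compl_compl, Set.inter_comm, ← Set.diff_eq] at h3
  · rwa [Set.diff_eq, compl_compl, Set.inter_comm, ← Set.diff_eq] at h2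
  · rwa [Set.compl_union]

lemma Chain.cross_le {e : Γ} (he : D.OK e) {l : List (Set E × Set E)} (h : D.Chain e l) {B : Set E}
    (hB : D.Cut B) (hl : ∀ a ∈ l, (a.1 ∩ B).Nonempty ∧ (a.1 \ B).Nonempty ∧ (B \ a.2).Nonempty ∧
      (a.2 ∪ B)ᶜ.Nonempty) : l.length ≤ D.c0 := by
  have key : ∀ a ∈ l, ∃ h ∈ {h | h ∈ D.G ∧ Cross (h • B) B}, a.1 ⊆ h • B ∧ h • B ⊆ a.2 := by
    intro a ha
    obtain ⟨k, hk, h1, h2⟩ := (h.1 a ha).univ he hB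
    obtain ⟨c1, c2, c3, c4⟩ := hl a ha
    refine ⟨k, ⟨hk, ?_, ?_, ?_, ?_⟩, h1, h2⟩
    · exact c1.mono (Set.inter_subset_inter_left _ h1)
    · exact c2.mono (Set.diff_subset_diff_left h1)
    · exact c3.mono (Set.diff_subset_diff_right h2)
    · exact c4.mono (Set.compl_subset_compl.2 (Set.union_subset_union_left _ h2))
  obtain ⟨γ, hγ⟩ := hB
  have inj : Function.Injective (fun h : Γ => γ⁻¹ * h * γ) := by
    intro a b hab
    simpa using hab
  have sub : {h | h ∈ D.G ∧ Cross (h • B) B} ⊆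
      (fun h : Γ => γ⁻¹ * h * γ) ⁻¹' {h : Γ | h ∈ D.G ∧ Cross (h • D.U) D.U} := by
    rintro k ⟨hk, hc⟩
    refine ⟨by simpa using D.nrm.conj_mem _ hk γ⁻¹, ?_⟩
    have : Cross (k • γ • D.U) (γ • D.U) := by
      rcases hγ with rfl | rfl
      · exact hc
      · apply cross_compl
        rw [← Set.smul_set_compl]; exact hc
    rw [← cross_smul (γ := γ)]
    simpa [mul_smul] using this
  have fin := D.cross_fin.preimage (f := fun h : Γ => γ⁻¹ * h * γ) inj.injOn
  refine (h.count B (fin.subset sub) key).trans ?_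
  refine (Set.ncard_le_ncard sub fin).trans ?_
  rw [c0]
  apply Set.ncard_le_ncard_of_injOn (fun h : Γ => γ⁻¹ * h * γ) (fun _ h => h) inj.injOn D.cross_fin

lemma Sep.mono_l {e : Γ} (he : D.OK e) {x : Γ} {a b : Set E × Set E} (ha : D.Ann e a) (h : Lt a b)
    (hx : D.sg x a.1) : D.sg x b.1 := sg_mono ((ha.sub he).trans h.subset) hx

/-- splitting -/
lemma Chain.split {e : Γ} (he : D.OK e) {l : List (Set E × Set E)} (h : D.Chain e l) (z : Γ) :
    ∃ l1 m l2, l = l1 ++ m ++ l2 ∧ m.length ≤ 1 ∧ (∀ a ∈ l1, ¬ D.sg z a.2) ∧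
      (∀ a ∈ l2, D.sg z a.1) := by
  induction l with
  | nil => exact ⟨[], [], [], rfl, by simp, by simp, by simp⟩
  | cons a l ih =>
    have h' : D.Chain e l := h.sublist (List.sublist_cons_self a l)
    have hp := (List.pairwise_cons.1 h.2).1
    by_cases hz : D.sg z a.2
    · refine ⟨[], [a], l, rfl, by simp, by simp, ?_⟩
      intro b hb
      exact sg_mono (hp b hb).subset hz
    · obtain ⟨l1, m, l2, rfl, hm, h1, h2⟩ := ih h'
      refine ⟨a :: l1, m, l2, rfl, hm, ?_, h2⟩
      intro b hb
      rcases List.mem_cons.1 hb with rfl | hb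
      · exact hz
      · exact h1 b hb

/-- concatenation -/
lemma Chain.concat {e : Γ} (he : D.OK e) {s u v : Γ} {l1 l2 : List (Set E × Set E)}
    (h1 : D.Chain e l1) (h2 : D.Chain e l2)
    (hs1 : ∀ a ∈ l1, D.sg s a.1 ∧ ¬ D.sg u a.2 ∧ ¬ D.sg v a.2)
    (hs2 : ∀ a ∈ l2, D.sg s a.1 ∧ D.sg u a.1 ∧ ¬ D.sg v a.2) :
    ∃ l, D.Chain e l ∧ (∀ a ∈ l, a ∈ l1 ∨ a ∈ l2) ∧
      l1.length + l2.length ≤ l.length + D.c0 + 2 := by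
  rcases l2 with _ | ⟨b, l2⟩
  · exact ⟨l1, h1, fun a ha => Or.inl ha, by simp; omega⟩
  by_cases hlen : l1.length ≤ D.c0 + 1
  · exact ⟨b :: l2, h2, fun a ha => Or.inr ha, by simp; omega⟩
  set k := l1.length - D.c0 - 1 with hk
  have hkl : k < l1.length := by omega
  have e1 : l1 = l1.take k ++ l1.drop k := (List.take_append_drop k l1).symm
  have hchd : D.Chain e (l1.drop k) := h1.sublist (List.drop_sublist k l1)
  have e2 : l1.drop k = l1[k] :: l1.drop (k+1) := List.drop_eq_getElem_cons hkl
  set a := l1[k] with ha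
  have ha1 : a ∈ l1 := List.getElem_mem _
  have hb := h2.1 b (by simp)
  have hsb := hs2 b (by simp)
  have hb12 := hb.sub he
  have hab : a.1 ⊆ b.2 := by
    by_contra hn
    have hne : (a.1 \ b.2).Nonempty := Set.diff_nonempty.2 hn
    have : (l1.drop k).length ≤ D.c0 := by
      refine hchd.cross_le he hb.cut.2 ?_
      intro c hc
      have hc1 : c ∈ l1 := List.mem_of_mem_drop hc
      obtain ⟨s1, s2, s3⟩ := hs1 c hc1
      refine ⟨sg_inter s1 (sg_mono hb12 hsb.1), ?_, sg_diff (sg_mono hb12 hsb.2.1) s2, ?_⟩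
      · apply hne.mono
        apply Set.diff_subset_diff_left
        rw [e2] at hc
        rcases List.mem_cons.1 hc with rfl | hc
        · exact le_rfl
        · have hp := hchd.2
          rw [e2] at hp
          exact ((h1.1 a ha1).sub he).trans ((List.pairwise_cons.1 hp).1 c hc).subset
      · rw [Set.compl_union]
        exact sg_inter (sg_compl.2 s3) (sg_compl.2 hsb.2.2)
    rw [List.length_drop] at this
    omega
  refine ⟨l1.take k ++ l2, ⟨?_, ?_⟩, ?_, ?_⟩
  · intro c hc
    rcases List.mem_append.1 hc with hc | hc
    · exact h1.1 c (List.mem_of_mem_take hc)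
    · exact h2.1 c (by simp [hc])
  · rw [List.pairwise_append]
    refine ⟨h1.2.sublist (List.take_sublist k l1), (List.pairwise_cons.1 h2.2).2, ?_⟩
    intro c hc c' hc'
    have p1 := h1.2
    rw [e1, List.pairwise_append] at p1
    have lt1 : Lt c a := p1.2.2 c hc a (by rw [e2]; simp)
    have lt2 : Lt b c' := (List.pairwise_cons.1 h2.2).1 c' hc'
    exact lt1.trans_subset (hab.trans lt2.subset)
  · intro c hc
    rcases List.mem_append.1 hc with hc | hc
    · exact Or.inl (List.mem_of_mem_take hc)
    · exact Or.inr (by simp [hc])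
  · rw [List.length_append, List.length_take]
    simp only [List.length_cons]
    omega

/-- chains have bounded length -/
lemma Chain.bound {e : Γ} (he : D.OK e) {x y : Γ} {l : List (Set E × Set E)} (h : D.Chain e l)
    (hs : ∀ a ∈ l, D.Sep x y a) :
    l.length ≤ {h : Γ | h ∈ D.G ∧ D.maj (x⁻¹ • h • D.U) ∧ ¬ D.maj (y⁻¹ • h • D.U)}.ncard := by
  refine h.count D.U (D.hfin x y) ?_
  intro a ha
  obtain ⟨k, hk, h1, h2⟩ := (h.1 a ha).univ he ⟨1, Or.inl (one_smul _ _).symm⟩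
  exact ⟨k, ⟨hk, sg_mono h1 (hs a ha).1, fun h' => (hs a ha).2 (sg_mono h2 h')⟩, h1, h2⟩

variable (D) in
def NN (e x y : Γ) : ℕ :=
  sSup {n | ∃ l, D.Chain e l ∧ (∀ a ∈ l, D.Sep x y a) ∧ l.length = n}

lemma NN_bdd {e : Γ} (he : D.OK e) (x y : Γ) :
    BddAbove {n | ∃ l, D.Chain e l ∧ (∀ a ∈ l, D.Sep x y a) ∧ l.length = n} := by
  refine ⟨{h : Γ | h ∈ D.G ∧ D.maj (x⁻¹ • h • D.U) ∧ ¬ D.maj (y⁻¹ • h • D.U)}.ncard, ?_⟩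
  rintro n ⟨l, h1, h2, rfl⟩
  exact h1.bound he h2

lemma le_NN {e : Γ} (he : D.OK e) {x y : Γ} {l : List (Set E × Set E)} (h : D.Chain e l)
    (hs : ∀ a ∈ l, D.Sep x y a) : l.length ≤ D.NN e x y :=
  le_csSup (NN_bdd he x y) ⟨l, h, hs, rfl⟩

lemma chain_nil (e : Γ) : D.Chain e [] := ⟨by simp, by simp⟩

lemma NN_spec {e : Γ} (he : D.OK e) (x y : Γ) :
    ∃ l, D.Chain e l ∧ (∀ a ∈ l, D.Sep x y a) ∧ l.length = D.NN e x y :=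
  Nat.sSup_mem (s := {n | ∃ l, D.Chain e l ∧ (∀ a ∈ l, D.Sep x y a) ∧ l.length = n})
    ⟨0, [], chain_nil e, by simp, rfl⟩ (NN_bdd he x y)

lemma NN_symm {e : Γ} (he : D.OK e) (x y : Γ) : D.NN e x y = D.NN e y x := by
  have key : ∀ x y, D.NN e x y ≤ D.NN e y x := by
    intro x y
    obtain ⟨l, h1, h2, h3⟩ := NN_spec he x y
    rw [← h3]
    have := le_NN he h1.swp (sep_swp h2)
    simpa using this
  exact le_antisymm (key x y) (key y x)

lemma NN_inv {e : Γ} (he : D.OK e) (γ x y : Γ) : D.NN e (γ * x) (γ * y) = D.NN e x y := by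
  have key : ∀ γ x y, D.NN e x y ≤ D.NN e (γ * x) (γ * y) := by
    intro γ x y
    obtain ⟨l, h1, h2, h3⟩ := NN_spec he x y
    rw [← h3]
    have := le_NN he (h1.tr γ) (sep_tr γ h2)
    simpa using this
  apply le_antisymm _ (key γ x y)
  have := key γ⁻¹ (γ * x) (γ * y)
  simpa using this

lemma NN_self {e : Γ} (he : D.OK e) (x : Γ) : D.NN e x x = 0 := by
  obtain ⟨l, h1, h2, h3⟩ := NN_spec he x x
  rw [← h3]
  rcases l with _ | ⟨a, l⟩
  · rfl
  · exact absurd (sg_mono ((h1.1 a (by simp)).sub he) (h2 a (by simp)).1) (h2 a (by simp)).2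

lemma NN_tri {e : Γ} (he : D.OK e) (x y z : Γ) : D.NN e x z ≤ D.NN e x y + D.NN e y z + 1 := by
  obtain ⟨l, h1, h2, h3⟩ := NN_spec he x z
  rw [← h3]
  obtain ⟨l1, m, l2, rfl, hm, a1, a2⟩ := h1.split he y
  have b1 := le_NN he (x := x) (y := y) (h1.sublist (l' := l1) (by simp))
    (fun a ha => ⟨(h2 a (by simp [ha])).1, a1 a ha⟩)
  have b2 := le_NN he (x := y) (y := z) (h1.sublist (l' := l2) (by simp))
    (fun a ha => ⟨a2 a ha, (h2 a (by simp [ha])).2⟩)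
  simp only [List.length_append]
  omega

/-- Lemma G -/
lemma NN_G {e : Γ} (he : D.OK e) {x y z : Γ} {l : List (Set E × Set E)} (h : D.Chain e l)
    (hs : ∀ a ∈ l, D.sg x a.1 ∧ ¬ D.sg z a.2 ∧ ¬ D.sg y a.2) :
    D.NN e z y + 2 * l.length ≤ D.NN e z x + D.NN e x y + 2 * D.c0 + 5 := by
  obtain ⟨m, h1, h2, h3⟩ := NN_spec he z y
  obtain ⟨m1, k, m2, rfl, hm, a1, a2⟩ := h1.split he x
  obtain ⟨p, p1, p2, p3⟩ := (h1.sublist (l' := m1) (by simp)).concat he (s := z) (u := y) (v := x)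
    h.swp (fun a ha => ⟨(h2 a (by simp [ha])).1, (h2 a (by simp [ha])).2, a1 a ha⟩) (by
      intro a ha
      have b1 := sep_swp (D := D) (x := x) (y := z) (fun a ha => ⟨(hs a ha).1, (hs a ha).2.1⟩) a ha
      have b2 := sep_swp (D := D) (x := x) (y := y) (fun a ha => ⟨(hs a ha).1, (hs a ha).2.2⟩) a ha
      exact ⟨b1.1, b2.1, b1.2⟩)
  obtain ⟨q, q1, q2, q3⟩ := h.concat he (s := x) (u := z) (v := y)
    (h1.sublist (l' := m2) (by simp)) hs
    (fun a ha => ⟨a2 a ha, (h2 a (by simp [ha])).1, (h2 a (by simp [ha])).2⟩)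
  have r1 := le_NN he (x := z) (y := x) p1 (by
    intro a ha
    rcases p2 a ha with ha | ha
    · exact ⟨(h2 a (by simp [ha])).1, a1 a ha⟩
    · exact sep_swp (D := D) (x := x) (y := z) (fun a ha => ⟨(hs a ha).1, (hs a ha).2.1⟩) a ha)
  have r2 := le_NN he (x := x) (y := y) q1 (by
    intro a ha
    rcases q2 a ha with ha | ha
    · exact ⟨(hs a ha).1, (hs a ha).2.2⟩
    · exact ⟨a2 a ha, (h2 a (by simp [ha])).2⟩)
  simp only [List.length_append, List.length_map, List.length_reverse] at *
  omega

end CutData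

end

section
universe w
open scoped Pointwise

namespace CutData

variable {Γ : Type u} [Group Γ] {E : Type w} [MulAction Γ E] {D : CutData Γ E}

lemma Chain.split2 {e : Γ} (he : D.OK e) {l : List (Set E × Set E)} (h : D.Chain e l) (u v : Γ) :
    ∃ l1 l2 l3 : List (Set E × Set E), (l1 ++ l2 ++ l3).Sublist l ∧ l.length ≤ l1.length + l2.length + l3.length + 3 ∧
      (∀ a ∈ l1, ¬ D.sg u a.2 ∧ ¬ D.sg v a.2) ∧ (∀ a ∈ l3, D.sg u a.1 ∧ D.sg v a.1) ∧
      ((∀ a ∈ l2, D.sg u a.1 ∧ ¬ D.sg v a.2) ∨ (∀ a ∈ l2, D.sg v a.1 ∧ ¬ D.sg u a.2)) := by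
  obtain ⟨p1, m, p2, rfl, hm, h1, h2⟩ := h.split he u
  have c1 : D.Chain e p1 := h.sublist (by simp)
  have c2 : D.Chain e p2 := h.sublist (by simp)
  obtain ⟨p11, m', p12, hp1, hm', h11, h12⟩ := c1.split he v
  obtain ⟨p21, m'', p22, hp2, hm'', h21, h22⟩ := c2.split he v
  rcases p21 with _ | ⟨b, p21⟩
  · refine ⟨p11, p12, p22, ?_, ?_, ?_, ?_, Or.inr ?_⟩
    · refine List.Sublist.append ?_ ?_
      · refine List.Sublist.trans ?_ (List.sublist_append_left _ _)
        rw [hp1]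
        refine List.Sublist.append ?_ (List.Sublist.refl _)
        exact List.sublist_append_left _ _
      · rw [hp2]; simp
    · subst hp1 hp2
      simp only [List.length_append, List.length_nil] at *
      omega
    · exact fun a ha => ⟨h1 a (by rw [hp1]; simp [ha]), h11 a ha⟩
    · exact fun a ha => ⟨h2 a (by rw [hp2]; simp [ha]), h22 a ha⟩
    · exact fun a ha => ⟨h12 a ha, h1 a (by rw [hp1]; simp [ha])⟩
  · have hb : b ∈ p2 := by rw [hp2]; simp
    refine ⟨p1, b :: p21, p22, ?_, ?_, ?_, ?_, Or.inl ?_⟩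
    · rw [List.append_assoc, List.append_assoc]
      refine List.Sublist.append (List.Sublist.refl _) ?_
      refine List.Sublist.trans ?_ (List.sublist_append_right _ _)
      rw [hp2, List.append_assoc]
      exact List.Sublist.append (List.Sublist.refl _) (List.sublist_append_right _ _)
    · subst hp1 hp2
      simp only [List.length_append, List.length_cons] at *
      omega
    · intro a ha
      refine ⟨h1 a ha, fun hs => h21 b (by simp) ?_⟩
      have hp := h.2
      rw [List.pairwise_append] at hp
      have lt : Lt a b := hp.2.2 a (by simp [ha]) b hb
      exact sg_mono (lt.subset.trans ((c2.1 b hb).sub he)) hs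
    · exact fun a ha => ⟨h2 a (by rw [hp2]; simp [ha]), h22 a ha⟩
    · exact fun a ha => ⟨h2 a (by rw [hp2]; exact List.mem_append_left _ (List.mem_append_left _ ha)),
        h21 a ha⟩

lemma four_aux {e : Γ} (he : D.OK e) {s t u v : Γ} {α1 α2 α3 β1 β3 : List (Set E × Set E)}
    (hα : D.Chain e (α1 ++ α2 ++ α3)) (hβ1 : D.Chain e β1) (hβ3 : D.Chain e β3)
    (h1 : ∀ a ∈ α1 ++ α2, D.sg s a.1 ∧ ¬ D.sg t a.2 ∧ ¬ D.sg v a.2)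
    (h2 : ∀ a ∈ α2 ++ α3, D.sg u a.1 ∧ D.sg s a.1 ∧ ¬ D.sg t a.2)
    (h3 : ∀ a ∈ β1, D.sg u a.1 ∧ ¬ D.sg s a.2 ∧ ¬ D.sg t a.2)
    (h4 : ∀ a ∈ β3, D.sg s a.1 ∧ D.sg t a.1 ∧ ¬ D.sg v a.2) :
    α1.length + 2 * α2.length + α3.length + β1.length + β3.length ≤
      D.NN e s v + D.NN e t u + 2 * D.c0 + 4 := by
  obtain ⟨p, p1, p2, p3⟩ := (hα.sublist (l' := α1 ++ α2) (by simp)).concat he hβ3 h1 h4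
  obtain ⟨q, q1, q2, q3⟩ := hβ1.concat he (hα.sublist (l' := α2 ++ α3) (by simp)) h3 h2
  have r1 := le_NN he (x := s) (y := v) p1 (by
    intro a ha
    rcases p2 a ha with ha | ha
    · exact ⟨(h1 a ha).1, (h1 a ha).2.2⟩
    · exact ⟨(h4 a ha).1, (h4 a ha).2.2⟩)
  have r2 := le_NN he (x := u) (y := t) q1 (by
    intro a ha
    rcases q2 a ha with ha | ha
    · exact ⟨(h3 a ha).1, (h3 a ha).2.2⟩
    · exact ⟨(h2 a ha).1, (h2 a ha).2.2⟩)
  rw [NN_symm he u t] at r2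
  simp only [List.length_append] at *
  omega

lemma NN_four {e : Γ} (he : D.OK e) (s t u v : Γ) :
    D.NN e s t + D.NN e u v ≤ max (D.NN e s u + D.NN e t v) (D.NN e s v + D.NN e t u)
      + (2 * D.c0 + 10) := by
  have half : ∀ s t u v : Γ, ∀ α1 α2 α3 β1 β3 : List (Set E × Set E), ∀ m,
      D.Chain e (α1 ++ α2 ++ α3) → D.Chain e β1 → D.Chain e β3 → m ≤ α2.length →
      (∀ a ∈ α1 ++ α2 ++ α3, D.Sep s t a) → (∀ a ∈ α1, ¬ D.sg u a.2 ∧ ¬ D.sg v a.2) →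
      (∀ a ∈ α3, D.sg u a.1 ∧ D.sg v a.1) →
      ((∀ a ∈ α2, D.sg u a.1 ∧ ¬ D.sg v a.2) ∨ (∀ a ∈ α2, D.sg v a.1 ∧ ¬ D.sg u a.2)) →
      (∀ a ∈ β1, D.Sep u v a) → (∀ a ∈ β3, D.Sep u v a) →
      (∀ a ∈ β1, ¬ D.sg s a.2 ∧ ¬ D.sg t a.2) → (∀ a ∈ β3, D.sg s a.1 ∧ D.sg t a.1) →
      α1.length + α2.length + α3.length + β1.length + β3.length + m ≤
        max (D.NN e s u + D.NN e t v) (D.NN e s v + D.NN e t u) + (2 * D.c0 + 4) := by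
    intro s t u v α1 α2 α3 β1 β3 m hα hβ1 hβ3 hm hs h1 h3 h2 k1 k3 j1 j3
    rcases h2 with h2 | h2
    · have := four_aux he (s := s) (t := t) (u := u) (v := v) hα hβ1 hβ3 (by
          intro a ha
          have hst := hs a (List.mem_append_left _ ha)
          rcases List.mem_append.1 ha with ha | ha
          · exact ⟨hst.1, hst.2, (h1 a ha).2⟩
          · exact ⟨hst.1, hst.2, (h2 a ha).2⟩) (by
          intro a ha
          have hst := hs a (by rw [List.append_assoc]; exact List.mem_append_right _ ha)
          rcases List.mem_append.1 ha with ha | ha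
          · exact ⟨(h2 a ha).1, hst.1, hst.2⟩
          · exact ⟨(h3 a ha).1, hst.1, hst.2⟩)
          (fun a ha => ⟨(k1 a ha).1, j1 a ha⟩)
          (fun a ha => ⟨(j3 a ha).1, (j3 a ha).2, (k3 a ha).2⟩)
      have := le_max_right (D.NN e s u + D.NN e t v) (D.NN e s v + D.NN e t u)
      omega
    · have := four_aux he (s := s) (t := t) (u := v) (v := u) hα hβ3.swp hβ1.swp (by
          intro a ha
          have hst := hs a (List.mem_append_left _ ha)
          rcases List.mem_append.1 ha with ha | ha
          · exact ⟨hst.1, hst.2, (h1 a ha).1⟩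
          · exact ⟨hst.1, hst.2, (h2 a ha).2⟩) (by
          intro a ha
          have hst := hs a (by rw [List.append_assoc]; exact List.mem_append_right _ ha)
          rcases List.mem_append.1 ha with ha | ha
          · exact ⟨(h2 a ha).1, hst.1, hst.2⟩
          · exact ⟨(h3 a ha).2, hst.1, hst.2⟩)
          (by
            intro a ha
            have i1 := sep_swp (D := D) (x := s) (y := v) (l := β3)
              (fun a ha => ⟨(j3 a ha).1, (k3 a ha).2⟩) a ha
            have i2 := sep_swp (D := D) (x := t) (y := v) (l := β3)
              (fun a ha => ⟨(j3 a ha).2, (k3 a ha).2⟩) a ha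
            exact ⟨i1.1, i1.2, i2.2⟩)
          (by
            intro a ha
            have i1 := sep_swp (D := D) (x := u) (y := s) (l := β1)
              (fun a ha => ⟨(k1 a ha).1, (j1 a ha).1⟩) a ha
            have i2 := sep_swp (D := D) (x := u) (y := t) (l := β1)
              (fun a ha => ⟨(k1 a ha).1, (j1 a ha).2⟩) a ha
            exact ⟨i1.1, i2.1, i1.2⟩)
      have := le_max_left (D.NN e s u + D.NN e t v) (D.NN e s v + D.NN e t u)
      simp only [List.length_map, List.length_reverse] at *
      omega
  obtain ⟨l, hl, hls, hln⟩ := NN_spec he s t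
  obtain ⟨k, hk, hks, hkn⟩ := NN_spec he u v
  obtain ⟨α1, α2, α3, as, al, a1, a3, a2⟩ := hl.split2 he u v
  obtain ⟨β1, β2, β3, bs, bl, b1, b3, b2⟩ := hk.split2 he s t
  have ca := hl.sublist as
  have cb := hk.sublist bs
  have sa : ∀ a ∈ α1 ++ α2 ++ α3, D.Sep s t a := fun a ha => hls a (as.subset ha)
  have sb : ∀ a ∈ β1 ++ β2 ++ β3, D.Sep u v a := fun a ha => hks a (bs.subset ha)
  rcases le_total β2.length α2.length with h | h
  · have := half s t u v α1 α2 α3 β1 β3 β2.length ca (cb.sublist (by simp)) (cb.sublist (by simp)) h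
      sa a1 a3 a2 (fun a ha => sb a (by simp [ha])) (fun a ha => sb a (by simp [ha])) b1 b3
    omega
  · have := half u v s t β1 β2 β3 α1 α3 α2.length cb (ca.sublist (by simp)) (ca.sublist (by simp)) h
      sb b1 b3 b2 (fun a ha => sa a (by simp [ha])) (fun a ha => sa a (by simp [ha])) a1 a3
    rw [NN_symm he u s, NN_symm he v t, NN_symm he u t, NN_symm he v s,
      add_comm (D.NN e t u)] at this
    omega

open Classical in
variable (D) in
def dd (e x y : Γ) : ℝ := if x = y then 0 else (D.NN e x y : ℝ) + 1

lemma dd_le (e x y : Γ) : D.dd e x y ≤ D.NN e x y + 1 := by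
  unfold dd; split_ifs
  · positivity
  · exact le_rfl

lemma le_dd {e : Γ} (he : D.OK e) (x y : Γ) : (D.NN e x y : ℝ) ≤ D.dd e x y := by
  unfold dd; split_ifs with h
  · subst h; rw [NN_self he]; simp
  · linarith

lemma dd_PM {e : Γ} (he : D.OK e) : TSpan.PM (D.dd e) where
  zero x := by simp [dd]
  symm x y := by
    by_cases h : x = y
    · subst h; rfl
    · unfold dd; rw [NN_symm he x y, if_neg h, if_neg (Ne.symm h)]
  tri x y z := by
    by_cases h1 : x = y
    · subst h1; simp [dd]
    by_cases h2 : y = z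
    · subst h2; simp [dd]
    have e1 : D.dd e x y = (D.NN e x y : ℝ) + 1 := by simp [dd, h1]
    have e2 : D.dd e y z = (D.NN e y z : ℝ) + 1 := by simp [dd, h2]
    have := dd_le (D := D) e x z
    have : (D.NN e x z : ℝ) ≤ D.NN e x y + D.NN e y z + 1 := by exact_mod_cast NN_tri he x y z
    linarith

lemma dd_inv {e : Γ} (he : D.OK e) (γ x y : Γ) : D.dd e (γ * x) (γ * y) = D.dd e x y := by
  by_cases h : x = y
  · subst h; simp [dd]
  · unfold dd; rw [NN_inv he, if_neg h, if_neg (by simpa using h)]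

lemma dd_four {e : Γ} (he : D.OK e) (x y z w : Γ) : D.dd e x y + D.dd e z w ≤
    max (D.dd e x z + D.dd e y w) (D.dd e x w + D.dd e y z) + 2 * (D.c0 + 6 : ℝ) := by
  have h := NN_four he x y z w
  have h' : (D.NN e x y : ℝ) + D.NN e z w ≤
      max ((D.NN e x z : ℝ) + D.NN e y w) ((D.NN e x w : ℝ) + D.NN e y z) + (2 * D.c0 + 10) := by
    exact_mod_cast h
  have h2 : max ((D.NN e x z : ℝ) + D.NN e y w) ((D.NN e x w : ℝ) + D.NN e y z) ≤
      max (D.dd e x z + D.dd e y w) (D.dd e x w + D.dd e y z) :=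
    max_le_max (add_le_add (le_dd he _ _) (le_dd he _ _)) (add_le_add (le_dd he _ _) (le_dd he _ _))
  have := dd_le (D := D) e x y
  have := dd_le (D := D) e z w
  linarith

/-! ### the counting function tau -/

open Classical in
/-- counting -/
def tau (f : List (Set E × Set E)) (V : Set E) : ℕ := f.countP fun a => decide (a.1 ⊆ V)

lemma tau_mono (f : List (Set E × Set E)) {V W : Set E} (h : V ⊆ W) : tau f V ≤ tau f W := by
  unfold tau
  apply List.countP_mono_left
  intro a _ ha
  simp only [decide_eq_true_eq] at *
  exact ha.trans h

lemma tau_split {e : Γ} (he : D.OK e) {f : List (Set E × Set E)} (h : D.Chain e f) (V : Set E) :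
    (∀ t (ht : t < f.length), (t < tau f V ↔ (f[t]).1 ⊆ V)) := by
  induction f with
  | nil => intro t ht; simp at ht
  | cons a f ih =>
    intro t ht
    have h' : D.Chain e f := h.sublist (List.sublist_cons_self a f)
    have hp := (List.pairwise_cons.1 h.2).1
    by_cases ha : a.1 ⊆ V
    · have e1 : tau (a :: f) V = tau f V + 1 := by simp [tau, ha]
      rcases t with _ | t
      · simp [e1, ha]
      · rw [e1]
        have := ih h' t (by simpa using ht)
        simpa using this
    · have nn : ∀ b ∈ f, ¬ b.1 ⊆ V := fun b hb hbV =>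
        ha ((((h.1 a (by simp)).sub he).trans (hp b hb).subset).trans hbV)
      have e1 : tau (a :: f) V = 0 := by
        unfold tau
        rw [List.countP_eq_zero]
        intro b hb
        rcases List.mem_cons.1 hb with rfl | hb
        · simpa using ha
        · simpa using nn b hb
      rw [e1]
      rcases t with _ | t
      · simp [ha]
      · simp only [not_lt_zero, List.getElem_cons_succ, false_iff]
        exact nn _ (List.getElem_mem _)

lemma tau_le (f : List (Set E × Set E)) (V : Set E) : tau f V ≤ f.length := List.countP_le_length

lemma Chain.getElem_lt {e : Γ} {f : List (Set E × Set E)} (h : D.Chain e f) {i j : ℕ} (hij : i < j)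
    (hj : j < f.length) : Lt (f[i]) (f[j]) :=
  List.pairwise_iff_getElem.1 h.2 i j _ hj hij

/-- tau2 -/
lemma tau_sub {e : Γ} (he : D.OK e) {f : List (Set E × Set E)} (h : D.Chain e f) {x y : Γ}
    (hs : ∀ a ∈ f, D.Sep x y a) {V : Set E} (hV : D.Cut V) (hx : D.sg x V) (hy : ¬ D.sg y V)
    {t : ℕ} (ht : t < f.length) (htV : tau f V + D.c0 ≤ t) : V ⊆ (f[t]).2 := by
  by_contra hn
  have hne : (V \ (f[t]).2).Nonempty := Set.sdiff_nonempty.2 hn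
  set l := (f.take (t+1)).drop (tau f V) with hl
  have cl : D.Chain e l := h.sublist ((List.drop_sublist _ _).trans (List.take_sublist _ _))
  have := cl.cross_le he hV (by
    intro a ha
    obtain ⟨i, hi, rfl⟩ := List.getElem_of_mem ha
    simp only [hl, List.length_drop, List.length_take] at hi
    have ea : l[i] = f[tau f V + i] := by simp [hl]
    rw [ea]
    have sa := hs _ (List.getElem_mem (l := f) (n := tau f V + i) (by omega))
    refine ⟨sg_inter sa.1 hx, ?_, ?_, ?_⟩
    · apply Set.sdiff_nonempty.2
      intro hc
      have := (tau_split he h V (tau f V + i) (by omega)).2 hc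
      omega
    · apply hne.mono
      apply Set.sdiff_subset_sdiff_right
      rcases Nat.lt_or_ge (tau f V + i) t with hlt | hge
      · have h1 := h.getElem_lt hlt ht
        exact h1.subset.trans ((h.1 _ (List.getElem_mem _)).sub he)
      · have : tau f V + i = t := by omega
        simp [this]
    · rw [Set.compl_union]
      exact sg_inter (sg_compl.2 sa.2) (sg_compl.2 hy))
  simp only [hl, List.length_drop, List.length_take] at this
  omega

/-- tau3 -/
lemma tau_ssub {e : Γ} (he : D.OK e) {f : List (Set E × Set E)} (h : D.Chain e f) {x y : Γ}
    (hs : ∀ a ∈ f, D.Sep x y a) {V W : Set E} (hV : D.Cut V) (hx : D.sg x V) (hy : ¬ D.sg y V)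
    (ht : tau f V + D.c0 + 2 ≤ tau f W) : V ⊂ W := by
  have hl := tau_le f W
  have h1 := tau_sub he h hs hV hx hy (t := tau f V + D.c0) (by omega) le_rfl
  have h2 := h.getElem_lt (i := tau f V + D.c0) (j := tau f V + D.c0 + 1) (by omega) (by omega)
  have h3 := (tau_split he h W (tau f V + D.c0 + 1) (by omega)).1 (by omega)
  exact LE.le.trans_ssubset h1 (h2.trans_subset h3)

/-- tau4 -/
lemma tau_gap {e : Γ} (he : D.OK e) {f : List (Set E × Set E)} (h : D.Chain e f) {x y : Γ}
    (hs : ∀ a ∈ f, D.Sep x y a) (hmax : f.length = D.NN e x y) {V W : Set E}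
    (hW : D.Cut W) (hxV : D.sg x V) (hxW : D.sg x W) (hyW : ¬ D.sg y W)
    {b : List (Set E × Set E)} (hb : D.Chain e b)
    (hbV : ∀ a ∈ b, V ⊆ a.1 ∧ a.2 ⊆ W) (hVW : V ⊆ W) :
    tau f V + b.length ≤ tau f W + D.c0 + 2 := by
  have hc : D.Chain e (f.take (tau f V - 1) ++ (b ++ f.drop (tau f W + D.c0 + 1))) := by
    have c1 := h.sublist (List.take_sublist (tau f V - 1) f)
    have c2 := h.sublist (List.drop_sublist (tau f W + D.c0 + 1) f)
    have lt1 : ∀ a ∈ f.take (tau f V - 1), a.2 ⊂ V := by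
      intro a ha
      obtain ⟨i, hi, rfl⟩ := List.getElem_of_mem ha
      simp only [List.length_take] at hi
      rw [List.getElem_take]
      have hl := tau_le f V
      have h2 := h.getElem_lt (i := i) (j := i + 1) (by omega) (by omega)
      exact h2.trans_subset ((tau_split he h V (i + 1) (by omega)).1 (by omega))
    have lt2 : ∀ a ∈ f.drop (tau f W + D.c0 + 1), W ⊂ a.1 := by
      intro a ha
      obtain ⟨i, hi, rfl⟩ := List.getElem_of_mem ha
      simp only [List.length_drop] at hi
      rw [List.getElem_drop]
      have h1 := tau_sub he h hs hW hxW hyW (t := tau f W + D.c0) (by omega) le_rfl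
      have h2 := h.getElem_lt (i := tau f W + D.c0) (j := tau f W + D.c0 + 1 + i) (by omega) (by omega)
      exact LE.le.trans_ssubset h1 h2
    refine ⟨?_, ?_⟩
    · intro a ha
      simp only [List.mem_append] at ha
      rcases ha with ha | ha | ha
      · exact c1.1 a ha
      · exact hb.1 a ha
      · exact c2.1 a ha
    · rw [List.pairwise_append, List.pairwise_append]
      refine ⟨c1.2, ⟨hb.2, c2.2, ?_⟩, ?_⟩
      · intro a ha c hc
        exact LE.le.trans_ssubset (hbV a ha).2 (lt2 c hc)
      · intro a ha c hc
        rcases List.mem_append.1 hc with hc | hc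
        · exact (lt1 a ha).trans_subset (hbV c hc).1
        · exact (lt1 a ha).trans_subset (hVW.trans (lt2 c hc).subset)
  have := le_NN he hc (x := x) (y := y) (by
    intro a ha
    simp only [List.mem_append] at ha
    rcases ha with ha | ha | ha
    · exact hs a (List.mem_of_mem_take ha)
    · exact ⟨sg_mono (hbV a ha).1 hxV, fun h' => hyW (sg_mono (hbV a ha).2 h')⟩
    · exact hs a (List.mem_of_mem_drop ha))
  have hl := tau_le f V
  simp only [List.length_append, List.length_take, List.length_drop] at this
  omega

end CutData

end

section
universe w
open scoped Pointwise

namespace CutData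

variable {Γ : Type u} [Group Γ] {E : Type w} [MulAction Γ E] {D : CutData Γ E}

lemma sub_mul {s t : Γ} (hs : D.U ⊆ s • D.U) (ht : D.U ⊆ t • D.U) : D.U ⊆ (s * t) • D.U := by
  rw [mul_smul]; exact hs.trans (Set.smul_set_mono ht)

lemma sub_pow {s : Γ} (hs : D.U ⊆ s • D.U) (n : ℕ) : D.U ⊆ (s ^ n) • D.U := by
  induction n with
  | zero => simp
  | succ n ih => rw [pow_succ]; exact sub_mul ih hs

lemma sub_mul_r {a t : Γ} (ht : D.U ⊆ t • D.U) : a • D.U ⊆ (a * t) • D.U := by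
  rw [mul_smul]; exact Set.smul_set_mono ht

lemma pow_le {s : Γ} (hs : D.U ⊆ s • D.U) {m n : ℕ} (h : m ≤ n) : (s ^ m) • D.U ⊆ (s ^ n) • D.U := by
  obtain ⟨k, rfl⟩ := Nat.exists_eq_add_of_le h
  rw [pow_add]; exact sub_mul_r (sub_pow hs k)

lemma pow_lt {s : Γ} (hs : D.U ⊂ s • D.U) {m n : ℕ} (h : m < n) : (s ^ m) • D.U ⊂ (s ^ n) • D.U := by
  refine lt_of_lt_of_le ?_ (pow_le hs.subset (Nat.succ_le_of_lt h))
  rw [pow_succ, mul_smul]; exact smul_ssub.2 hs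

lemma exists_e (gg : Γ) (hggG : gg ∈ D.G) (hgg : D.U ⊆ gg • D.U) (hgg' : D.g • D.U ⊆ gg • D.U)
    (T : Finset Γ) (hT : ∀ t ∈ T, D.U ⊆ t • D.U) (hTG : Subgroup.closure (T : Set Γ) = D.G) :
    ∃ (Q : Finset Γ) (e : Γ), D.OK e ∧ 1 ∈ Q ∧ (∀ k ∈ Q, k ∈ D.G) ∧
      (∀ k ∈ Q, ∀ m ≤ 4, D.U ⊆ (k * gg ^ m) • D.U ∧ (k * gg ^ m) • D.U ⊆ e • D.U) ∧
      Subgroup.closure (Q : Set Γ) = D.G := by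
  classical
  have hTG' : ∀ t ∈ T, t ∈ D.G := fun t ht => by rw [← hTG]; exact Subgroup.subset_closure ht
  have key : ∀ L : Finset Γ, L ⊆ T → ∃ (Q : Finset Γ) (e : Γ), D.OK e ∧ 1 ∈ Q ∧ (∀ k ∈ Q, k ∈ D.G) ∧
      (∀ k ∈ Q, D.U ⊆ k • D.U ∧ (k * gg ^ 4) • D.U ⊆ e • D.U) ∧
      e ∈ Subgroup.closure (Q : Set Γ) ∧ gg ^ 4 ∈ Subgroup.closure (Q : Set Γ) ∧
      ∀ t ∈ L, t ∈ Subgroup.closure (Q : Set Γ) := by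
    intro L
    induction L using Finset.induction_on with
    | empty =>
      intro _
      refine ⟨{1, gg ^ 4}, gg ^ 8, ?_, by simp, ?_, ?_, ?_, ?_, by simp⟩
      · refine hgg'.trans ?_
        have := pow_le hgg (show 1 ≤ 8 by norm_num)
        rwa [pow_one] at this
      · intro k hk
        simp only [Finset.mem_insert, Finset.mem_singleton] at hk
        rcases hk with rfl | rfl
        · exact D.G.one_mem
        · exact D.G.pow_mem hggG 4
      · intro k hk
        simp only [Finset.mem_insert, Finset.mem_singleton] at hk
        rcases hk with rfl | rfl
        · simp only [one_smul, one_mul]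
          exact ⟨le_rfl, pow_le hgg (by norm_num)⟩
        · rw [← pow_add]
          exact ⟨sub_pow hgg 4, le_rfl⟩
      · rw [show 8 = 4 + 4 by norm_num, pow_add]
        exact Subgroup.mul_mem _ (Subgroup.subset_closure (by simp))
          (Subgroup.subset_closure (by simp))
      · exact Subgroup.subset_closure (by simp)
    | insert t L htL ih =>
      intro hL
      obtain ⟨Q, e, h1, h2, h3, h4, h5, h6, h7⟩ := ih ((Finset.subset_insert _ _).trans hL)
      have htT : t ∈ T := hL (Finset.mem_insert_self _ _)
      have ht := hT t htT
      have tm : D.U ⊆ (t * gg ^ 4) • D.U := sub_mul ht (sub_pow hgg 4)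
      have ee : e • D.U ⊆ (e * t * gg ^ 4) • D.U := by rw [mul_assoc]; exact sub_mul_r tm
      have eG : e ∈ D.G := (Subgroup.closure_le D.G).2 (fun k hk => h3 k hk) h5
      have mono : Subgroup.closure (Q : Set Γ) ≤ Subgroup.closure (insert (e * t) Q : Finset Γ) :=
        Subgroup.closure_mono (by simp)
      have tc : t ∈ Subgroup.closure ((insert (e * t) Q : Finset Γ) : Set Γ) := by
        have h8 : e * t ∈ Subgroup.closure ((insert (e * t) Q : Finset Γ) : Set Γ) :=
          Subgroup.subset_closure (by simp)
        have := Subgroup.mul_mem _ (Subgroup.inv_mem _ (mono h5)) h8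
        rwa [inv_mul_cancel_left] at this
      refine ⟨insert (e * t) Q, e * t * gg ^ 4, h1.trans ee, by simp [h2], ?_, ?_, ?_, mono h6, ?_⟩
      · intro k hk
        rcases Finset.mem_insert.1 hk with rfl | hk
        · exact D.G.mul_mem eG (hTG' t htT)
        · exact h3 k hk
      · intro k hk
        rcases Finset.mem_insert.1 hk with rfl | hk
        · exact ⟨sub_mul (h1.lt.subset) ht, le_rfl⟩
        · exact ⟨(h4 k hk).1, (h4 k hk).2.trans ee⟩
      · exact Subgroup.mul_mem _ (Subgroup.mul_mem _ (mono h5) tc) (mono h6)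
      · intro s hs
        rcases Finset.mem_insert.1 hs with rfl | hs
        · exact tc
        · exact mono (h7 s hs)
  obtain ⟨Q, e, h1, h2, h3, h4, h5, h6, h7⟩ := key T (le_refl _)
  refine ⟨Q, e, h1, h2, h3, ?_, ?_⟩
  · intro k hk m hm
    refine ⟨sub_mul (h4 k hk).1 (sub_pow hgg m), Set.Subset.trans ?_ (h4 k hk).2⟩
    rw [mul_smul, mul_smul]
    exact Set.smul_set_mono (pow_le hgg hm)
  · apply le_antisymm
    · exact (Subgroup.closure_le D.G).2 (fun k hk => h3 k hk)
    · rw [← hTG]; exact (Subgroup.closure_le _).2 (fun k hk => h7 k hk)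

/-- power chains -/
lemma pow_chain {e : Γ} (he : D.OK e) (γ : Γ) (J : ℕ) : ∃ l, D.Chain e l ∧ l.length = J ∧
    ∀ a ∈ l, γ • D.U ⊆ a.1 ∧ a.2 ⊆ (γ * e ^ (2 * J)) • D.U := by
  refine ⟨(List.range J).map fun i => ((γ * e ^ (2 * i)) • D.U, (γ * e ^ (2 * i) * e) • D.U),
    ⟨?_, ?_⟩, by simp, ?_⟩
  · intro a ha
    obtain ⟨i, -, rfl⟩ := List.mem_map.1 ha
    exact ⟨γ * e ^ (2 * i), Or.inl rfl⟩
  · rw [List.pairwise_map]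
    refine List.pairwise_lt_range.imp ?_
    intro i j hij
    change (γ * e ^ (2 * i) * e) • D.U ⊂ (γ * e ^ (2 * j)) • D.U
    rw [mul_assoc, ← pow_succ, mul_smul, mul_smul]
    exact smul_ssub.2 (pow_lt he.lt (by omega))
  · intro a ha
    obtain ⟨i, hi, rfl⟩ := List.mem_map.1 ha
    have hi := List.mem_range.1 hi
    refine ⟨sub_mul_r (sub_pow he.lt.subset _), ?_⟩
    change (γ * e ^ (2 * i) * e) • D.U ⊆ (γ * e ^ (2 * J)) • D.U
    rw [mul_assoc, ← pow_succ, mul_smul, mul_smul]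
    exact Set.smul_set_mono (a := γ) (pow_le he.lt.subset (show 2 * i + 1 ≤ 2 * J by omega))

lemma OKg : D.OK D.g := Set.Subset.refl _

lemma between_fin (e : Γ) : {h : Γ | h ∈ D.G ∧ D.U ⊆ h • D.U ∧ h • D.U ⊆ e • D.U}.Finite := by
  obtain ⟨p, hp⟩ := D.hp
  obtain ⟨q, hq⟩ := D.hq
  refine (D.hfin p (e * q)).subset ?_
  rintro h ⟨hG, h1, h2⟩
  refine ⟨hG, D.maj_mono _ _ (Set.smul_set_mono h1) hp, fun h' => hq ?_⟩
  have := D.maj_mono _ _ (Set.smul_set_mono (a := (e * q)⁻¹) h2) h'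
  rwa [mul_inv_rev, mul_smul, inv_smul_smul] at this

variable (D) in
def om (e : Γ) : ℕ := {h : Γ | h ∈ D.G ∧ D.U ⊆ h • D.U ∧ h • D.U ⊆ e • D.U}.ncard

/-- tau5 -/
lemma tau_width {e : Γ} (he : D.OK e) {f : List (Set E × Set E)} (h : D.Chain D.g f) {x y : Γ}
    (hs : ∀ a ∈ f, D.Sep x y a) {a : Set E × Set E} (ha : D.Ann e a) (hsa : D.Sep x y a) :
    tau f a.2 ≤ tau f a.1 + D.om e + D.c0 + 2 := by
  have hab := ha.sub he
  have hl2 := tau_le f a.2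
  by_contra hcon
  set b := (f.take (tau f a.2 - 1)).drop (tau f a.1 + D.c0 + 1) with hb
  have cb : D.Chain D.g b := h.sublist ((List.drop_sublist _ _).trans (List.take_sublist _ _))
  have hbt : ∀ c ∈ b, a.1 ⊆ c.1 ∧ c.2 ⊆ a.2 := by
    intro c hc
    obtain ⟨i, hi, rfl⟩ := List.getElem_of_mem hc
    simp only [hb, List.length_drop, List.length_take] at hi
    have ea : b[i] = f[tau f a.1 + D.c0 + 1 + i] := by simp [hb]
    rw [ea]
    constructor
    · have h1 := tau_sub OKg h hs ha.cut.1 hsa.1 (fun h' => hsa.2 (sg_mono hab h'))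
        (t := tau f a.1 + D.c0) (by omega) le_rfl
      have h2 := h.getElem_lt (i := tau f a.1 + D.c0) (j := tau f a.1 + D.c0 + 1 + i)
        (by omega) (by omega)
      exact h1.trans h2.subset
    · have h2 := h.getElem_lt (i := tau f a.1 + D.c0 + 1 + i) (j := tau f a.1 + D.c0 + 1 + i + 1)
        (by omega) (by omega)
      exact h2.subset.trans ((tau_split OKg h a.2 _ (by omega)).1 (by omega))
  obtain ⟨γ, hγ⟩ := ha
  have key : ∃ B, D.Cut B ∧ ∀ k : Γ, (a.1 ⊆ k • B ∧ k • B ⊆ a.2) →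
      (γ • D.U ⊆ k • γ • D.U ∧ k • γ • D.U ⊆ γ • e • D.U) := by
    rcases hγ with rfl | rfl
    · exact ⟨γ • D.U, ⟨γ, Or.inl rfl⟩, fun k hk => by simpa only [mul_smul] using hk⟩
    · refine ⟨(γ • D.U)ᶜ, ⟨γ, Or.inr rfl⟩, fun k hk => ?_⟩
      simp only [Set.smul_set_compl, Set.compl_subset_compl, mul_smul] at hk
      exact ⟨hk.2, hk.1⟩
  obtain ⟨B, hB, hk⟩ := key
  have inj : Function.Injective (fun h : Γ => γ⁻¹ * h * γ) := by
    intro a b hab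
    simpa using hab
  have fin := (between_fin (D := D) e).preimage (f := fun h : Γ => γ⁻¹ * h * γ) inj.injOn
  have := cb.count B fin (by
    intro c hc
    obtain ⟨k, hkG, h1, h2⟩ := (cb.1 c hc).univ OKg hB
    refine ⟨k, ⟨by simpa using D.nrm.conj_mem _ hkG γ⁻¹, ?_⟩, h1, h2⟩
    obtain ⟨h3, h4⟩ := hk k ⟨(hbt c hc).1.trans h1, h2.trans (hbt c hc).2⟩
    constructor
    · have := Set.smul_set_mono (a := γ⁻¹) h3
      simpa [mul_smul] using this
    · have := Set.smul_set_mono (a := γ⁻¹) h4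
      simpa [mul_smul] using this)
  have h5 : ((fun h : Γ => γ⁻¹ * h * γ) ⁻¹'
      {h : Γ | h ∈ D.G ∧ D.U ⊆ h • D.U ∧ h • D.U ⊆ e • D.U}).ncard ≤ D.om e :=
    Set.ncard_le_ncard_of_injOn (fun h : Γ => γ⁻¹ * h * γ) (fun _ h => h) inj.injOn
      (between_fin e)
  simp only [hb, List.length_drop, List.length_take] at this
  omega

variable (D) in
def gh : Γ := D.g ^ (2 * (2 * D.c0 + 4))

/-- nesting -/
lemma nest {f : List (Set E × Set E)} (h : D.Chain D.g f) {x y : Γ}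
    (hs : ∀ a ∈ f, D.Sep x y a) (hmax : f.length = D.NN D.g x y) (γ γ' β : Γ)
    (h1 : D.sg x (γ • β • D.U)) (h2 : ¬ D.sg y (γ • β • D.U))
    (h3 : D.sg x (γ' • β • D.U))
    (h5 : D.sg x (γ' • (β * D.gh) • D.U)) (h6 : ¬ D.sg y (γ' • (β * D.gh) • D.U))
    (ht : tau f (γ • β • D.U) = tau f (γ' • β • D.U)) :
    γ • β • D.U ⊆ γ' • (β * D.gh) • D.U := by
  obtain ⟨b, b1, b2, b3⟩ := pow_chain (D := D) OKg (γ' * β) (2 * D.c0 + 4)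
  have e1 : γ' • (β * D.gh) • D.U = (γ' * β * D.gh) • D.U := by simp only [mul_smul]
  have gap := tau_gap OKg h hs hmax (V := γ' • β • D.U) (W := γ' • (β * D.gh) • D.U)
    ⟨γ' * β * D.gh, Or.inl e1⟩ h3 h5 h6 b1 (by
      intro a ha
      have := b3 a ha
      rw [e1]
      rw [mul_smul] at this
      exact this) (by
      rw [mul_smul]
      exact Set.smul_set_mono (Set.smul_set_mono (sub_pow D.hgU.subset _)))
  have := tau_ssub OKg h hs (V := γ • β • D.U) (W := γ' • (β * D.gh) • D.U)
    ⟨γ * β, Or.inl (by rw [mul_smul])⟩ h1 h2 (by omega)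
  exact this.subset

variable (D) in
def Om (Q : Finset Γ) : Set Γ := {δ | ∀ k ∈ Q, k⁻¹ * δ * k * δ⁻¹ ∈ {h : Γ | h ∈ D.G ∧
  D.U ⊆ (h * D.gh ^ 2) • D.U ∧ (h * D.gh ^ 2) • D.U ⊆ D.gh ^ 4 • D.U}}

lemma gh_mem : D.gh ∈ D.G := D.G.pow_mem D.hgG _

lemma Om_fin (Q : Finset Γ) (hQ : Subgroup.closure (Q : Set Γ) = D.G)
    (hZ : {z : Γ | ∀ h ∈ D.G, z * h = h * z}.Finite) : (D.Om Q).Finite := by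
  have fF : {h : Γ | h ∈ D.G ∧ D.U ⊆ (h * D.gh ^ 2) • D.U ∧
      (h * D.gh ^ 2) • D.U ⊆ D.gh ^ 4 • D.U}.Finite := by
    have := (between_fin (D := D) (D.gh ^ 4)).preimage (f := fun h : Γ => h * D.gh ^ 2)
      (mul_left_injective _).injOn
    refine this.subset ?_
    rintro h ⟨hG, h1, h2⟩
    exact ⟨D.G.mul_mem hG (D.G.pow_mem gh_mem 2), h1, h2⟩
  let Φ : Γ → (Q → Γ) := fun δ k => (k : Γ)⁻¹ * δ * k * δ⁻¹
  refine Set.Finite.of_finite_fibers Φ ?_ ?_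
  · refine (Set.Finite.pi' (fun _ : Q => fF)).subset ?_
    rintro _ ⟨δ, hδ, rfl⟩ k
    exact hδ k k.2
  · rintro _ ⟨δ, hδ, rfl⟩
    have : D.Om Q ∩ Φ ⁻¹' {Φ δ} ⊆ (fun z => δ * z) '' {z : Γ | ∀ h ∈ D.G, z * h = h * z} := by
      rintro δ' ⟨-, hδ'⟩
      refine ⟨δ⁻¹ * δ', ?_, by simp⟩
      have hc : D.G ≤ Subgroup.centralizer {δ⁻¹ * δ'} := by
        rw [← hQ, Subgroup.closure_le]
        intro k hk
        have := congrFun hδ' ⟨k, hk⟩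
        simp only [Φ] at this
        have h2 : δ' * k * δ'⁻¹ = δ * k * δ⁻¹ := by
          simpa only [mul_assoc, mul_right_inj] using this
        rw [SetLike.mem_coe, Subgroup.mem_centralizer_singleton_iff]
        have h3 : δ' * k = δ * k * δ⁻¹ * δ' := by rw [← h2]; group
        rw [mul_assoc δ⁻¹, h3]; group
      intro h hh
      have := Subgroup.mem_centralizer_singleton_iff.1 (hc hh)
      exact this.symm
    exact (hZ.image _).subset this

lemma fiber {f : List (Set E × Set E)} (h : D.Chain D.g f) {x y : Γ}
    (hs : ∀ a ∈ f, D.Sep x y a) (hmax : f.length = D.NN D.g x y) (Q : Finset Γ) (h1Q : 1 ∈ Q)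
    (hQG : ∀ k ∈ Q, k ∈ D.G) (γ0 : Γ) (γ γ' : Γ)
    (h1 : ∀ k ∈ Q, ∀ m ≤ 4, D.sg x (γ • (γ0 * k * D.gh ^ m) • D.U) ∧
      ¬ D.sg y (γ • (γ0 * k * D.gh ^ m) • D.U))
    (h2 : ∀ k ∈ Q, ∀ m ≤ 4, D.sg x (γ' • (γ0 * k * D.gh ^ m) • D.U) ∧
      ¬ D.sg y (γ' • (γ0 * k * D.gh ^ m) • D.U))
    (ht : ∀ k ∈ Q, ∀ m ≤ 4, tau f (γ • (γ0 * k * D.gh ^ m) • D.U) =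
      tau f (γ' • (γ0 * k * D.gh ^ m) • D.U)) :
    γ0⁻¹ * γ'⁻¹ * γ * γ0 ∈ D.Om Q := by
  set δ := γ0⁻¹ * γ'⁻¹ * γ * γ0 with hδ
  have A : ∀ k ∈ Q, ∀ m ≤ 3, δ • (k * D.gh ^ m) • D.U ⊆ (k * D.gh ^ (m + 1)) • D.U := by
    intro k hk m hm
    have := nest h hs hmax γ γ' (γ0 * k * D.gh ^ m) (h1 k hk m (by omega)).1
      (h1 k hk m (by omega)).2 (h2 k hk m (by omega)).1
      (by rw [mul_assoc, ← pow_succ]; exact (h2 k hk (m+1) (by omega)).1)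
      (by rw [mul_assoc, ← pow_succ]; exact (h2 k hk (m+1) (by omega)).2) (ht k hk m (by omega))
    rw [mul_assoc _ _ D.gh, ← pow_succ] at this
    have := Set.smul_set_mono (a := γ0⁻¹ * γ'⁻¹) this
    simpa [mul_smul, hδ] using this
  have B : ∀ k ∈ Q, ∀ m ≤ 3, (k * D.gh ^ m) • D.U ⊆ δ • (k * D.gh ^ (m + 1)) • D.U := by
    intro k hk m hm
    have := nest h hs hmax γ' γ (γ0 * k * D.gh ^ m) (h2 k hk m (by omega)).1
      (h2 k hk m (by omega)).2 (h1 k hk m (by omega)).1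
      (by rw [mul_assoc, ← pow_succ]; exact (h1 k hk (m+1) (by omega)).1)
      (by rw [mul_assoc, ← pow_succ]; exact (h1 k hk (m+1) (by omega)).2) (ht k hk m (by omega)).symm
    rw [mul_assoc _ _ D.gh, ← pow_succ] at this
    have := Set.smul_set_mono (a := γ0⁻¹ * γ'⁻¹) this
    simpa [mul_smul, hδ] using this
  intro k hk
  have hkG := hQG k hk
  refine ⟨?_, ?_, ?_⟩
  · have : k⁻¹ * δ * k * δ⁻¹ = k⁻¹ * (δ * k * δ⁻¹) := by group
    rw [this]
    exact D.G.mul_mem (D.G.inv_mem hkG) (D.nrm.conj_mem _ hkG δ)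
  · have s1 : D.gh ^ 1 • D.U ⊆ δ⁻¹ • D.gh ^ 2 • D.U := by
      have := A 1 h1Q 1 (by omega)
      have := Set.smul_set_mono (a := δ⁻¹) this
      simpa using this
    have s2 : k • D.U ⊆ δ • (k * D.gh ^ 1) • D.U := by simpa using B k hk 0 (by omega)
    have s3 : k • D.U ⊆ δ • k • δ⁻¹ • D.gh ^ 2 • D.U := by
      refine s2.trans ?_
      rw [show (k * D.gh ^ 1) • D.U = k • D.gh ^ 1 • D.U from mul_smul _ _ _]
      exact Set.smul_set_mono (a := δ) (Set.smul_set_mono (a := k) s1)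
    have := Set.smul_set_mono (a := k⁻¹) s3
    simpa [mul_smul] using this
  · have s1 : δ⁻¹ • D.gh ^ 2 • D.U ⊆ D.gh ^ 3 • D.U := by
      have := B 1 h1Q 2 (by omega)
      have := Set.smul_set_mono (a := δ⁻¹) this
      simpa using this
    have s2 : δ • (k * D.gh ^ 3) • D.U ⊆ (k * D.gh ^ 4) • D.U := A k hk 3 (by omega)
    have s3 : δ • k • δ⁻¹ • D.gh ^ 2 • D.U ⊆ (k * D.gh ^ 4) • D.U := by
      refine Set.Subset.trans ?_ s2
      rw [show (k * D.gh ^ 3) • D.U = k • D.gh ^ 3 • D.U from mul_smul _ _ _]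
      exact Set.smul_set_mono (a := δ) (Set.smul_set_mono (a := k) s1)
    have := Set.smul_set_mono (a := k⁻¹) s3
    simpa [mul_smul] using this

end CutData

end

section
universe w
open scoped Pointwise

namespace CutData

variable {Γ : Type u} [Group Γ] {E : Type w} [MulAction Γ E] {D : CutData Γ E}

lemma tr_swp (γ : Γ) (a : Set E × Set E) : tr γ (swp a) = swp (tr γ a) := by
  simp [tr, swp, Set.smul_set_compl]

variable (D) in
def W0 (e : Γ) : ℕ := D.om e + D.c0 + 2

lemma swp_swp (a : Set E × Set E) : swp (swp a) = a := by simp [swp]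

lemma core_aux {e : Γ} (he : D.OK e) (Q : Finset Γ) (h1Q : 1 ∈ Q) (hQG : ∀ k ∈ Q, k ∈ D.G)
    (hQ : ∀ k ∈ Q, ∀ m ≤ 4, D.U ⊆ (k * D.gh ^ m) • D.U ∧ (k * D.gh ^ m) • D.U ⊆ e • D.U)
    (hOm : (D.Om Q).Finite)
    (x y γ0 : Γ) (I : Finset ℕ) (cs : ℕ → Set E × Set E)
    (hcs : ∀ i ∈ I, D.Ann e (cs i) ∧ D.Sep x y (cs i)) (s : Finset Γ)
    (hs1 : ∀ γ ∈ s, D.Sep x y (tr γ (γ0 • D.U, (γ0 * e) • D.U)))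
    (hs2 : ∀ γ ∈ s, ∃ i ∈ I, ¬ Lt (cs i) (tr γ (γ0 • D.U, (γ0 * e) • D.U)) ∧
      ¬ Lt (tr γ (γ0 • D.U, (γ0 * e) • D.U)) (cs i)) :
    s.card ≤ (D.Om Q).ncard * (I.card * (4 * (D.W0 e + D.c0 + 2) + 1)) ^ (Q.card * 5) := by
  classical
  obtain ⟨f, f1, f2, f3⟩ := NN_spec (D := D) OKg x y
  set W := 2 * (D.W0 e + D.c0 + 2) with hW
  let P : Finset ℕ := I.biUnion fun i => Finset.Icc (tau f (cs i).1 - W) (tau f (cs i).1 + W)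
  have hP : P.card ≤ I.card * (2 * W + 1) := by
    refine Finset.card_biUnion_le_card_mul _ _ _ ?_
    intro i _
    rw [Nat.card_Icc]; omega
  have hsub : ∀ γ : Γ, ∀ k ∈ Q, ∀ m ≤ 4, γ • γ0 • D.U ⊆ γ • (γ0 * k * D.gh ^ m) • D.U ∧
      γ • (γ0 * k * D.gh ^ m) • D.U ⊆ γ • (γ0 * e) • D.U := by
    intro γ k hk m hm
    rw [mul_assoc, mul_smul γ0, mul_smul γ0]
    exact ⟨Set.smul_set_mono (a := γ) (Set.smul_set_mono (a := γ0) (hQ k hk m hm).1),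
      Set.smul_set_mono (a := γ) (Set.smul_set_mono (a := γ0) (hQ k hk m hm).2)⟩
  have hsep : ∀ γ ∈ s, ∀ k ∈ Q, ∀ m ≤ 4, D.sg x (γ • (γ0 * k * D.gh ^ m) • D.U) ∧
      ¬ D.sg y (γ • (γ0 * k * D.gh ^ m) • D.U) := by
    intro γ hγ k hk m hm
    exact ⟨sg_mono (hsub γ k hk m hm).1 (hs1 γ hγ).1,
      fun h => (hs1 γ hγ).2 (sg_mono (hsub γ k hk m hm).2 h)⟩
  let Ψ : Γ → (Q × Fin 5 → ℕ) := fun γ p => tau f (γ • (γ0 * p.1 * D.gh ^ (p.2 : ℕ)) • D.U)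
  have hΨ : ∀ γ ∈ s, Ψ γ ∈ Fintype.piFinset (fun _ : Q × Fin 5 => P) := by
    intro γ hγ
    rw [Fintype.mem_piFinset]
    rintro ⟨⟨k, hk⟩, m⟩
    obtain ⟨i, hi, h1, h2⟩ := hs2 γ hγ
    obtain ⟨ca, cb⟩ := hcs i hi
    refine Finset.mem_biUnion.2 ⟨i, hi, ?_⟩
    set b := tr γ (γ0 • D.U, (γ0 * e) • D.U) with hb
    have ba : D.Ann e b := Ann.tr ⟨γ0, Or.inl rfl⟩ γ
    have bs := hs1 γ hγ
    have w1 := tau_width he f1 f2 ba bs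
    have w2 := tau_width he f1 f2 ca cb
    have t1 : tau f b.1 < tau f (cs i).2 + D.c0 + 2 := by
      by_contra hc
      exact h1 (tau_ssub OKg f1 f2 ca.cut.2 (sg_mono (ca.sub he) cb.1) cb.2 (by omega))
    have t2 : tau f (cs i).1 < tau f b.2 + D.c0 + 2 := by
      by_contra hc
      exact h2 (tau_ssub OKg f1 f2 ba.cut.2 (sg_mono (ba.sub he) bs.1) bs.2 (by omega))
    have m1 := tau_mono f (hsub γ k hk m (by omega)).1
    have m2 := tau_mono f (hsub γ k hk m (by omega)).2
    change tau f b.1 ≤ _ at m1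
    change _ ≤ tau f b.2 at m2
    rw [Finset.mem_Icc]
    simp only [Ψ, W0] at *
    constructor <;> omega
  have hcard : (s.image Ψ).card ≤ (I.card * (2 * W + 1)) ^ (Q.card * 5) := by
    refine (Finset.card_le_card (t := Fintype.piFinset (fun _ : Q × Fin 5 => P)) ?_).trans ?_
    · intro p hp
      obtain ⟨γ, hγ, rfl⟩ := Finset.mem_image.1 hp
      exact hΨ γ hγ
    · rw [Fintype.card_piFinset]
      simp only [Finset.prod_const, Finset.card_univ, Fintype.card_prod, Fintype.card_coe, Fintype.card_fin]
      exact Nat.pow_le_pow_left hP _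
  have hfib := Finset.card_le_mul_card_image (f := Ψ) s (D.Om Q).ncard (by
    intro p hp
    obtain ⟨γ', hγ', rfl⟩ := Finset.mem_image.1 hp
    rw [← Set.ncard_coe_finset]
    refine Set.ncard_le_ncard_of_injOn (fun γ => γ0⁻¹ * γ'⁻¹ * γ * γ0) ?_ ?_ hOm
    · intro γ hγ
      simp only [Finset.coe_filter, Set.mem_setOf_eq] at hγ
      refine fiber f1 f2 f3 Q h1Q hQG γ0 γ γ' (hsep γ hγ.1) (hsep γ' hγ') ?_
      intro k hk m hm
      have := congrFun hγ.2 (⟨k, hk⟩, ⟨m, by omega⟩)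
      exact this
    · intro a _ b _ hab
      simpa using hab)
  refine hfib.trans (Nat.mul_le_mul_left _ ?_)
  refine hcard.trans (le_of_eq ?_)
  rw [hW]; congr 2; ring

lemma core {e : Γ} (he : D.OK e) (Q : Finset Γ) (h1Q : 1 ∈ Q) (hQG : ∀ k ∈ Q, k ∈ D.G)
    (hQ : ∀ k ∈ Q, ∀ m ≤ 4, D.U ⊆ (k * D.gh ^ m) • D.U ∧ (k * D.gh ^ m) • D.U ⊆ e • D.U)
    (hOm : (D.Om Q).Finite)
    (x y : Γ) (a : Set E × Set E) (ha : D.Ann e a) (I : Finset ℕ) (cs : ℕ → Set E × Set E)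
    (hcs : ∀ i ∈ I, D.Ann e (cs i) ∧ D.Sep x y (cs i)) (s : Finset Γ)
    (hs1 : ∀ γ ∈ s, D.Sep x y (tr γ a))
    (hs2 : ∀ γ ∈ s, ∃ i ∈ I, ¬ Lt (cs i) (tr γ a) ∧ ¬ Lt (tr γ a) (cs i)) :
    s.card ≤ (D.Om Q).ncard * (I.card * (4 * (D.W0 e + D.c0 + 2) + 1)) ^ (Q.card * 5) := by
  obtain ⟨γ0, rfl | ha⟩ := ha
  · exact core_aux he Q h1Q hQG hQ hOm x y γ0 I cs hcs s hs1 hs2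
  · have ea : (γ0 • D.U, (γ0 * e) • D.U) = swp a := by rw [ha]; simp [swp]
    refine core_aux he Q h1Q hQG hQ hOm y x γ0 I (fun i => swp (cs i))
      (fun i hi => ⟨(hcs i hi).1.swp, (hcs i hi).2.swp⟩) s ?_ ?_
    · intro γ hγ
      rw [ea, tr_swp]
      exact (hs1 γ hγ).swp
    · intro γ hγ
      obtain ⟨i, hi, h1, h2⟩ := hs2 γ hγ
      refine ⟨i, hi, ?_, ?_⟩
      · intro h; rw [ea, tr_swp] at h
        have := h.swp; rw [swp_swp, swp_swp] at this
        exact h2 this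
      · intro h; rw [ea, tr_swp] at h
        have := h.swp; rw [swp_swp, swp_swp] at this
        exact h1 this

/-- geometric shadow estimate -/
lemma shadow {e : Γ} (he : D.OK e) {Y : Type*} [MetricSpace Y] {ρ : Γ →* (Y ≃ᵢ Y)} {ι : Γ → Y}
    {δ : ℝ} (hδ : GromovHyperbolic Y δ)
    (hι : ∀ x y, dist (ι x) (ι y) = D.dd e x y) (hρ : ∀ γ x, ρ γ (ι x) = ι (γ * x))
    {R : ℝ} {f1 f2 : Y} (hD : 1 + R + δ < dist f1 f2) {x y : Γ}
    (hxy : dist (ι x) f1 + dist f1 f2 + dist f2 (ι y) - 1 ≤ D.dd e x y)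
    {γ : Γ} (h1 : dist f1 (ρ γ f1) < R) (h2 : dist f2 (ρ γ f2) < R)
    {l : List (Set E × Set E)} (hl : D.Chain e l)
    (hs : ∀ a ∈ l, D.sg x a.1 ∧ ¬ D.sg (γ * x) a.2 ∧ ¬ D.sg y a.2) :
    (l.length : ℝ) ≤ dist (ι x) f1 + R + D.c0 + 5 + δ := by
  have key := NN_G he hl hs
  have key' : (D.NN e (γ * x) y : ℝ) + 2 * l.length ≤
      D.NN e (γ * x) x + D.NN e x y + 2 * D.c0 + 5 := by exact_mod_cast key
  have n1 := le_dd he (γ * x) x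
  have n2 := le_dd he x y
  have n3 := dd_le (D := D) e (γ * x) y
  rw [← hι] at n1 n2 n3 hxy
  rw [← hρ] at n1 n3
  have i1 : dist (ρ γ (ι x)) (ρ γ f1) = dist (ι x) f1 := (ρ γ).isometry.dist_eq _ _
  have i2 : dist (ρ γ (ι x)) (ρ γ f2) = dist (ι x) f2 := (ρ γ).isometry.dist_eq _ _
  have t1 := dist_triangle (ρ γ (ι x)) (ρ γ f1) f1
  have t2 := dist_triangle (ρ γ (ι x)) f1 (ι x)
  have t3 := dist_triangle (ι x) f1 (ι y)
  have t3' := dist_triangle (ι x) f2 (ι y)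
  have t4 := dist_triangle f1 f2 (ι y)
  have t5 := dist_triangle (ρ γ (ι x)) f2 (ρ γ f2)
  have c1 := dist_comm f1 (ρ γ f1)
  have c2 := dist_comm f1 (ι x)
  have c3 := dist_comm f2 (ι y)
  have c4 := dist_comm f1 (ι y)
  have h4 := hδ (ρ γ (ι x)) f2 f1 (ι y)
  rcases max_choice (dist (ρ γ (ι x)) f1 + dist f2 (ι y)) (dist (ρ γ (ι x)) (ι y) + dist f2 f1) with h | h
  · rw [h] at h4; linarith
  · rw [h, dist_comm f2 f1] at h4; linarith

lemma switch {P Q : ℕ → Prop} {lo hi : ℕ} (h : lo ≤ hi) (h1 : ¬ Q lo) (h2 : ¬ P hi)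
    (h3 : ∀ i, lo ≤ i → i < hi → P i → ¬ Q (i + 1)) : ∃ i, lo ≤ i ∧ i ≤ hi ∧ ¬ P i ∧ ¬ Q i := by
  by_contra hc
  push Not at hc
  have : ∀ k, lo + k ≤ hi → P (lo + k) := by
    intro k
    induction k with
    | zero => intro h'; by_contra hp; exact h1 (hc lo le_rfl h hp)
    | succ k ih =>
      intro h'
      by_contra hp
      exact h3 (lo + k) (by omega) (by omega) (ih (by omega)) (hc _ (by omega) h' hp)
  obtain ⟨k, rfl⟩ := Nat.exists_eq_add_of_le h
  exact h2 (this k le_rfl)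

lemma mem_take_lt {e : Γ} {l : List (Set E × Set E)} (hl : D.Chain e l) {j : ℕ} (hj : j < l.length)
    {a : Set E × Set E} (ha : a ∈ l.take j) : Lt a l[j] := by
  obtain ⟨i, hi, rfl⟩ := List.getElem_of_mem ha
  simp only [List.length_take] at hi
  rw [List.getElem_take]
  exact hl.getElem_lt (by omega) hj

lemma mem_drop_lt {e : Γ} {l : List (Set E × Set E)} (hl : D.Chain e l) {j : ℕ} (hj : j < l.length)
    {a : Set E × Set E} (ha : a ∈ l.drop (j + 1)) : Lt l[j] a := by
  obtain ⟨i, hi, rfl⟩ := List.getElem_of_mem ha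
  simp only [List.length_drop] at hi
  rw [List.getElem_drop]
  exact hl.getElem_lt (by omega) (by omega)

lemma Lt.trans' {e : Γ} (he : D.OK e) {a b c : Set E × Set E} (hb : D.Ann e b) (h1 : Lt a b)
    (h2 : Lt b c) : Lt a c := h1.trans_subset ((hb.sub he).trans h2.subset)

/-- gluing two chains at a comparison -/
lemma glue {e : Γ} (he : D.OK e) {l m : List (Set E × Set E)} (hl : D.Chain e l) (hm : D.Chain e m)
    {i j : ℕ} (hi : i < l.length) (hj : j < m.length) (hlt : Lt l[i] m[j]) :
    D.Chain e (l.take (i + 1) ++ m.drop j) := by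
  have c1 := hl.sublist (List.take_sublist (i + 1) l)
  have c2 := hm.sublist (List.drop_sublist j m)
  refine ⟨?_, ?_⟩
  · intro a ha
    rcases List.mem_append.1 ha with ha | ha
    · exact c1.1 a ha
    · exact c2.1 a ha
  · rw [List.pairwise_append]
    refine ⟨c1.2, c2.2, ?_⟩
    intro a ha b hb
    have s1 : a.2 ⊆ (l[i]).2 := by
      obtain ⟨k, hk, rfl⟩ := List.getElem_of_mem ha
      simp only [List.length_take] at hk
      rw [List.getElem_take]
      rcases Nat.lt_or_ge k i with h | h
      · exact (hl.getElem_lt h hi).subset.trans ((hl.1 _ (List.getElem_mem _)).sub he)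
      · have : k = i := by omega
        subst this; exact Set.Subset.refl _
    have s2 : (m[j]).1 ⊆ b.1 := by
      obtain ⟨k, hk, rfl⟩ := List.getElem_of_mem hb
      simp only [List.length_drop] at hk
      rw [List.getElem_drop]
      rcases Nat.eq_zero_or_pos k with h | h
      · subst h; exact Set.Subset.refl _
      · exact ((hm.1 _ (List.getElem_mem _)).sub he).trans
          (hm.getElem_lt (i := j) (j := j + k) (by omega) (by omega)).subset
    exact (s1.trans_ssubset hlt).trans_subset s2

/-- sep for glued chains -/
lemma glue_NN {e : Γ} (he : D.OK e) {l m : List (Set E × Set E)} (hl : D.Chain e l)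
    (hm : D.Chain e m) {x x' y y' : Γ} (hls : ∀ a ∈ l, D.Sep x y' a) (hms : ∀ a ∈ m, D.Sep x' y a)
    {i j : ℕ} (hi : i < l.length) (hj : j < m.length) (hlt : Lt l[i] m[j])
    (hx : D.sg x (m[j]).1) (hy : ¬ D.sg y (m[j]).2) :
    i + 1 + (m.length - j) ≤ D.NN e x y := by
  have := le_NN he (glue he hl hm hi hj hlt) (x := x) (y := y) (by
    intro a ha
    rcases List.mem_append.1 ha with ha | ha
    · refine ⟨(hls a (List.mem_of_mem_take ha)).1, fun h => hy ?_⟩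
      have s1 : a.2 ⊆ (l[i]).2 := by
        obtain ⟨k, hk, rfl⟩ := List.getElem_of_mem ha
        simp only [List.length_take] at hk
        rw [List.getElem_take]
        rcases Nat.lt_or_ge k i with h | h
        · exact (hl.getElem_lt h hi).subset.trans ((hl.1 _ (List.getElem_mem _)).sub he)
        · have : k = i := by omega
          subst this; exact Set.Subset.refl _
      exact sg_mono (s1.trans (hlt.subset.trans ((hm.1 _ (List.getElem_mem _)).sub he))) h
    · refine ⟨?_, (hms a (List.mem_of_mem_drop ha)).2⟩
      obtain ⟨k, hk, rfl⟩ := List.getElem_of_mem ha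
      simp only [List.length_drop] at hk
      rw [List.getElem_drop]
      rcases Nat.eq_zero_or_pos k with h | h
      · subst h; exact hx
      · exact sg_mono (((hm.1 _ (List.getElem_mem _)).sub he).trans
          (hm.getElem_lt (i := j) (j := j + k) (by omega) (by omega)).subset) hx)
  simp only [List.length_append, List.length_take, List.length_drop] at this
  omega

end CutData

end

section
universe w
open scoped Pointwise

namespace CutData

variable {Γ : Type u} [Group Γ] {E : Type w} [MulAction Γ E] {D : CutData Γ E}

lemma window {e : Γ} (he : D.OK e) {x y γ : Γ} {l : List (Set E × Set E)} (hl : D.Chain e l)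
    (hs : ∀ a ∈ l, D.Sep x y a) (hmax : l.length = D.NN e x y) {j0 R' : ℕ} (hlo : R' ≤ j0)
    (hhi : j0 + R' < l.length) (hsep : D.Sep x y (tr γ (l[j0]'(by omega))))
    (b1 : D.NN e x (γ * y) < l.length + R') (b2 : D.NN e (γ * x) y < l.length + R') :
    ∃ i, ∃ (hi : i < l.length), j0 - R' ≤ i ∧ i ≤ j0 + R' ∧
      ¬ Lt l[i] (tr γ (l[j0]'(by omega))) ∧ ¬ Lt (tr γ (l[j0]'(by omega))) l[i] := by
  have hj0 : j0 < l.length := by omega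
  set b := tr γ l[j0] with hb
  set m := l.map (tr γ) with hm
  have cm : D.Chain e m := hl.tr γ
  have sm : ∀ a ∈ m, D.Sep (γ * x) (γ * y) a := sep_tr γ hs
  have lm : m.length = l.length := by simp [hm]
  have mb : m[j0]'(by omega) = b := by simp [hm, hb]
  have bs := sm b (by rw [← mb]; exact List.getElem_mem _)
  have ba := cm.1 b (by rw [← mb]; exact List.getElem_mem _)
  have key := switch (P := fun i => ∃ h : i < l.length, Lt l[i] b)
    (Q := fun i => ∃ h : i < l.length, Lt b l[i]) (lo := j0 - R') (hi := j0 + R') (by omega)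
    (by
      rintro ⟨h, hlt⟩
      have := glue_NN he cm hl sm hs (x := γ * x) (y := y) (i := j0) (j := j0 - R') (by omega) h
        (by rw [mb]; exact hlt) (sg_mono ((ba.sub he).trans hlt.subset) bs.1)
        (hs _ (List.getElem_mem _)).2
      omega)
    (by
      rintro ⟨h, hlt⟩
      have := glue_NN he hl cm hs sm (x := x) (y := γ * y) (i := j0 + R') (j := j0) h (by omega)
        (by rw [mb]; exact hlt) (by rw [mb]; exact hsep.1) (by rw [mb]; exact bs.2)
      omega)
    (by
      rintro i h1 h2 ⟨h3, hl1⟩ ⟨h4, hl2⟩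
      have c1 := glue he hl (m := [b]) (i := i) (j := 0) ⟨by simpa using ba, by simp⟩ h3 (by simp)
        (by simpa using hl1)
      have e1 : l.take (i + 1) ++ [b].drop 0 = l.take (i + 1) ++ [b] := by simp
      rw [e1] at c1
      have len : (l.take (i + 1) ++ [b]).length = i + 2 := by simp; omega
      have gb : (l.take (i + 1) ++ [b])[i + 1]'(by omega) = b := by
        rw [List.getElem_append_right (by simp)]; simp
      have := glue_NN he c1 hl (x := x) (y := y) (x' := x) (y' := y) (i := i + 1) (j := i + 1) (by
          intro a ha
          rcases List.mem_append.1 ha with ha | ha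
          · exact hs a (List.mem_of_mem_take ha)
          · simp only [List.mem_singleton] at ha; rw [ha]; exact hsep) hs
          (by omega) h4 (by rw [gb]; exact hl2) (hs _ (List.getElem_mem _)).1
          (hs _ (List.getElem_mem _)).2
      omega)
  obtain ⟨i, h1, h2, h3, h4⟩ := key
  have hi : i < l.length := by omega
  exact ⟨i, hi, h1, h2, fun h => h3 ⟨hi, h⟩, fun h => h4 ⟨hi, h⟩⟩

lemma swp_mem {l : List (Set E × Set E)} {a} (ha : a ∈ l.reverse.map swp) : ∃ b ∈ l, a = swp b := by
  obtain ⟨b, hb, rfl⟩ := List.mem_map.1 ha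
  exact ⟨b, List.mem_reverse.1 hb, rfl⟩

lemma acyl {e : Γ} (he : D.OK e) (Q : Finset Γ) (h1Q : 1 ∈ Q) (hQG : ∀ k ∈ Q, k ∈ D.G)
    (hQ : ∀ k ∈ Q, ∀ m ≤ 4, D.U ⊆ (k * D.gh ^ m) • D.U ∧ (k * D.gh ^ m) • D.U ⊆ e • D.U)
    (hOm : (D.Om Q).Finite) {Y : Type*} [MetricSpace Y] {ρ : Γ →* (Y ≃ᵢ Y)} {ι : Γ → Y}
    {δ : ℝ} (hδ0 : 0 ≤ δ) (hδ : GromovHyperbolic Y δ)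
    (hι : ∀ x y, dist (ι x) (ι y) = D.dd e x y) (hρ : ∀ γ x, ρ γ (ι x) = ι (γ * x))
    (hdense : ∀ f g : Y, ∀ ε > 0, ∃ x y, dist (ι x) f + dist f g + dist g (ι y) - ε ≤ D.dd e x y) :
    IsAcylindrical ρ := by
  classical
  intro R hR
  obtain ⟨R', hR'⟩ := exists_nat_gt (R + 3)
  refine ⟨2 * R + 2 * (D.c0 + 5 + δ) + 2 * R' + 10, by positivity,
    (D.Om Q).ncard * ((2 * R' + 1) * (4 * (D.W0 e + D.c0 + 2) + 1)) ^ (Q.card * 5), ?_⟩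
  intro f1 f2 hL
  obtain ⟨x, y, hxy⟩ := hdense f1 f2 1 one_pos
  set S := {γ : Γ | dist f1 (ρ γ f1) < R ∧ dist f2 (ρ γ f2) < R} with hS
  have hinv : ∀ γ ∈ S, γ⁻¹ ∈ S := by
    have : ∀ (γ : Γ) (f : Y), dist f (ρ γ⁻¹ f) = dist f (ρ γ f) := by
      intro γ f
      rw [← (ρ γ).isometry.dist_eq f, ← IsometryEquiv.mul_apply, ← map_mul, mul_inv_cancel, map_one,
        dist_comm]
      rfl
    rintro γ ⟨h1, h2⟩
    exact ⟨by rw [this]; exact h1, by rw [this]; exact h2⟩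
  have hR'0 : (0:ℝ) ≤ R' := Nat.cast_nonneg _
  have hD : 1 + R + δ < dist f1 f2 := by
    have : (0:ℝ) ≤ D.c0 := Nat.cast_nonneg _
    linarith
  obtain ⟨l, l1, l2, l3⟩ := NN_spec he x y
  have hn : dist (ι x) f1 + dist f1 f2 + dist f2 (ι y) - 2 ≤ l.length := by
    have := dd_le (D := D) e x y
    rw [l3]; linarith
  have a0 : 0 ≤ dist (ι x) f1 := dist_nonneg
  have b0 : 0 ≤ dist f2 (ι y) := dist_nonneg
  obtain ⟨j0, hj0, hj0'⟩ : ∃ j0 : ℕ, dist (ι x) f1 + R + D.c0 + 5 + δ + R' < j0 ∧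
      (j0 : ℝ) ≤ dist (ι x) f1 + R + D.c0 + 5 + δ + R' + 1 := by
    refine ⟨⌊dist (ι x) f1 + R + D.c0 + 5 + δ + R'⌋₊ + 1, ?_, ?_⟩
    · push_cast; exact Nat.lt_floor_add_one _
    · push_cast
      have := Nat.floor_le (a := dist (ι x) f1 + R + D.c0 + 5 + δ + R') (by positivity)
      linarith
  have c0p : (0:ℝ) ≤ D.c0 := Nat.cast_nonneg _
  have j1 : R' ≤ j0 := by
    have : (R' : ℝ) ≤ j0 := by linarith
    exact_mod_cast this
  have j2 : dist f2 (ι y) + R + D.c0 + 5 + δ + R' + 1 < (l.length : ℝ) - j0 := by linarith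
  have j3 : j0 + R' < l.length := by
    have : (j0 : ℝ) + R' < l.length := by linarith
    exact_mod_cast this
  have hj : j0 < l.length := by omega
  -- first
  have A : ∀ γ ∈ S, D.sg (γ * x) (l[j0]).1 := by
    intro γ hγ
    by_contra hc
    have := shadow he hδ hι hρ hD hxy hγ.1 hγ.2 (l1.sublist (List.take_sublist j0 l)) (by
      intro a ha
      have hm := List.mem_of_mem_take ha
      refine ⟨(l2 a hm).1, fun h => hc (sg_mono (mem_take_lt l1 hj ha).subset h), (l2 a hm).2⟩)
    rw [List.length_take, min_eq_left hj.le] at this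
    linarith
  have B : ∀ γ ∈ S, ¬ D.sg (γ * y) (l[j0]).2 := by
    intro γ hγ hc
    have := shadow he hδ hι hρ (R := R) (f1 := f2) (f2 := f1) (x := y) (y := x)
      (by rw [dist_comm]; exact hD) (by
        rw [(dd_PM he).symm y x, dist_comm (ι y) f2, dist_comm f2 f1, dist_comm f1 (ι x)]; linarith) hγ.2 hγ.1
      (l1.sublist (List.drop_sublist (j0 + 1) l)).swp (by
      intro a ha
      obtain ⟨b, hb, rfl⟩ := swp_mem ha
      have hm := List.mem_of_mem_drop hb
      have s1 := (l2 b hm).swp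
      exact ⟨s1.1, fun h => sg_compl.1 h (sg_mono (mem_drop_lt l1 hj hb).subset hc), s1.2⟩)
    rw [List.length_map, List.length_reverse, List.length_drop, Nat.cast_sub (by omega),
      dist_comm _ f2] at this
    push_cast at this
    linarith
  have C : ∀ γ ∈ S, D.Sep x y (tr γ l[j0]) := by
    intro γ hγ
    have h1 := A _ (hinv γ hγ)
    have h2 := B _ (hinv γ hγ)
    rw [← sg_smul (γ := γ), mul_inv_cancel_left] at h1 h2
    exact ⟨h1, h2⟩
  have tri : ∀ γ ∈ S, D.NN e x (γ * y) < l.length + R' ∧ D.NN e (γ * x) y < l.length + R' := by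
    intro γ hγ
    have n1 := le_dd he x (γ * y)
    have n2 := le_dd he (γ * x) y
    rw [← hι, ← hρ] at n1 n2
    have i1 : dist (ρ γ f1) (ρ γ (ι x)) = dist f1 (ι x) := (ρ γ).isometry.dist_eq _ _
    have i2 : dist (ρ γ f2) (ρ γ (ι y)) = dist f2 (ι y) := (ρ γ).isometry.dist_eq _ _
    have t1 := dist_triangle4 (ι x) f1 f2 (ρ γ (ι y))
    have t2 := dist_triangle f2 (ρ γ f2) (ρ γ (ι y))
    have t3 := dist_triangle4 (ρ γ (ι x)) f1 f2 (ι y)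
    have t4 := dist_triangle f1 (ρ γ f1) (ρ γ (ι x))
    rw [dist_comm f1 (ρ γ (ι x)), dist_comm f1 (ι x)] at *
    have g1 := hγ.1
    have g2 := hγ.2
    constructor
    · have : (D.NN e x (γ * y) : ℝ) < l.length + R' := by linarith
      exact_mod_cast this
    · have : (D.NN e (γ * x) y : ℝ) < l.length + R' := by linarith
      exact_mod_cast this
  have bound : ∀ s : Finset Γ, (∀ γ ∈ s, γ ∈ S) → s.card ≤ (D.Om Q).ncard *
      ((2 * R' + 1) * (4 * (D.W0 e + D.c0 + 2) + 1)) ^ (Q.card * 5) := by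
    intro s hs
    have e1 : (Finset.Icc (j0 - R') (j0 + R')).card = 2 * R' + 1 := by
      rw [Nat.card_Icc]; omega
    have := core he Q h1Q hQG hQ hOm x y l[j0] (l1.1 _ (List.getElem_mem _))
      (Finset.Icc (j0 - R') (j0 + R')) (fun i => l.getD i (∅, ∅)) (by
        intro i hi
        rw [Finset.mem_Icc] at hi
        have hi' : i < l.length := by omega
        rw [List.getD_eq_getElem _ _ hi']
        exact ⟨l1.1 _ (List.getElem_mem _), l2 _ (List.getElem_mem _)⟩) s (fun γ hγ => C γ (hs γ hγ))
        (by
          intro γ hγ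
          obtain ⟨i, hi, h1, h2, h3, h4⟩ := window he l1 l2 l3 j1 j3 (C γ (hs γ hγ))
            (tri γ (hs γ hγ)).1 (tri γ (hs γ hγ)).2
          refine ⟨i, Finset.mem_Icc.2 ⟨h1, h2⟩, ?_⟩
          rw [List.getD_eq_getElem _ _ hi]
          exact ⟨h3, h4⟩)
    rwa [e1] at this
  have hfin : S.Finite := by
    by_contra hinf
    obtain ⟨t, ht, hc⟩ := Set.Infinite.exists_subset_card_eq hinf ((D.Om Q).ncard *
      ((2 * R' + 1) * (4 * (D.W0 e + D.c0 + 2) + 1)) ^ (Q.card * 5) + 1)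
    have := bound t (fun γ hγ => ht hγ)
    omega
  refine ⟨hfin.toFinset, bound _ (fun γ hγ => by simpa using hγ), ?_⟩
  intro γ h1 h2
  simp only [Set.Finite.mem_toFinset]
  exact ⟨h1, h2⟩

/-- Main abstract theorem -/
theorem main (D : CutData Γ E) (T : Finset Γ) (hT : ∀ t ∈ T, D.U ⊆ t • D.U)
    (hTG : Subgroup.closure (T : Set Γ) = D.G)
    (hZ : {z : Γ | ∀ h ∈ D.G, z * h = h * z}.Finite) :
    ∃ (Y : Type u) (_ : MetricSpace Y) (ρ : Γ →* (Y ≃ᵢ Y)),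
      HyperbolicGeodesicSpace Y ∧ IsAcylindrical ρ ∧
      ∃ y : Y, ¬ Bornology.IsBounded (Set.range fun g : Γ => ρ g y) := by
  obtain ⟨Q, e, he, h1Q, hQG, hQ, hQc⟩ := exists_e (D := D) D.gh gh_mem (sub_pow D.hgU.subset _) (by
    have := pow_le (D := D) D.hgU.subset (show 1 ≤ 2 * (2 * D.c0 + 4) by omega)
    rwa [pow_one] at this) T hT hTG
  have hOm := Om_fin Q hQc hZ
  obtain ⟨Y, _, ρ, ι, h1, h2, h3, h4, h5⟩ := TSpan.exists_span (D.dd e) (dd_PM he) (dd_inv he) _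
    (dd_four he)
  refine ⟨Y, _, ρ, ⟨h1, _, by positivity, h2⟩, acyl he Q h1Q hQG hQ hOm (by positivity) h2 h3 h4 h5,
    ι 1, ?_⟩
  intro hb
  obtain ⟨p, hp⟩ := D.hp
  obtain ⟨q, hq⟩ := D.hq
  obtain ⟨C, hC⟩ := Metric.isBounded_iff.1 hb
  obtain ⟨n, hn⟩ := exists_nat_gt C
  obtain ⟨l, l1, l2, l3⟩ := pow_chain (D := D) he 1 n
  have := le_NN he l1 (x := p) (y := 1 * e ^ (2 * n) * q) (by
    intro a ha
    refine ⟨sg_mono (l3 a ha).1 (by rw [one_smul]; exact hp), fun h => hq ?_⟩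
    have := sg_mono (l3 a ha).2 h
    rwa [sg_smul] at this)
  have h6 := hC (x := ι p) ⟨p, by simp only [h4, mul_one]⟩ (y := ι (1 * e ^ (2 * n) * q))
    ⟨1 * e ^ (2 * n) * q, by simp only [h4, mul_one]⟩
  rw [h3] at h6
  have h7 := le_dd he p (1 * e ^ (2 * n) * q)
  rw [l2] at this
  have h8 : (n : ℝ) ≤ D.NN e p (1 * e ^ (2 * n) * q) := by exact_mod_cast this
  linarith

end CutData

end

section
universe w
open scoped Pointwise

namespace EndsAI

variable {G : Type u} [Group G]

/-- connectedness in the Cayley graph -/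
def Conn (S A : Set G) : Prop := ∀ P : Set G, (A ∩ P).Nonempty →
  (∀ x ∈ A, x ∈ P → ∀ s ∈ S, x * s ∈ A → x * s ∈ P) → A ⊆ P

/-- vertex boundary -/
def bd (S V : Set G) : Set G := {x | ∃ s ∈ S, ¬ (x ∈ V ↔ x * s ∈ V)}

/-- almost invariant sets -/
def AI (V : Set G) : Prop := ∀ g : G, {x | ¬ (x ∈ V ↔ x * g ∈ V)}.Finite

lemma AI.compl {V : Set G} (h : AI V) : AI Vᶜ := by
  intro g
  refine (h g).subset ?_
  intro x hx
  simp only [Set.mem_setOf_eq, Set.mem_compl_iff] at *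
  tauto

lemma AI.inter {V W : Set G} (h : AI V) (h' : AI W) : AI (V ∩ W) := by
  intro g
  refine ((h g).union (h' g)).subset ?_
  intro x hx
  simp only [Set.mem_setOf_eq, Set.mem_inter_iff, Set.mem_union] at *
  tauto

lemma AI.diff {V W : Set G} (h : AI V) (h' : AI W) : AI (V \ W) := by
  rw [Set.diff_eq]; exact h.inter h'.compl

lemma AI.univ : AI (Set.univ : Set G) := by intro g; simp

lemma AI.smul {V : Set G} (h : AI V) (k : G) : AI (k • V) := by
  intro g
  refine ((h g).image (fun x => k * x)).subset ?_
  intro x hx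
  refine ⟨k⁻¹ * x, ?_, by simp⟩
  simpa only [Set.mem_setOf_eq, Set.mem_smul_set_iff_inv_smul_mem, smul_eq_mul, mul_assoc] using hx

lemma AI.map {V : Set G} (h : AI V) (f : G ≃* G) : AI (f '' V) := by
  intro g
  refine ((h (f.symm g)).image f).subset ?_
  intro x hx
  refine ⟨f.symm x, ?_, by simp⟩
  have key : ∀ y, y ∈ f '' V ↔ f.symm y ∈ V := by
    intro y
    constructor
    · rintro ⟨z, hz, rfl⟩; simpa using hz
    · intro hy; exact ⟨_, hy, by simp⟩
  simp only [Set.mem_setOf_eq, key, map_mul] at *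
  exact hx

lemma AI.of_bd {S : Set G} (hgen : Subgroup.closure S = ⊤) {V : Set G} (h : (bd S V).Finite) :
    AI V := by
  intro g
  have hg : g ∈ Subgroup.closure S := by rw [hgen]; trivial
  induction hg using Subgroup.closure_induction with
  | mem s hs => exact h.subset fun x hx => ⟨s, hs, hx⟩
  | one => simp
  | mul a b _ _ ha hb =>
    refine (ha.union (hb.preimage (mul_left_injective a).injOn)).subset ?_
    intro x hx
    simp only [Set.mem_setOf_eq, Set.mem_union, Set.mem_preimage, ← mul_assoc] at *
    tauto
  | inv a _ ha =>
    refine (ha.preimage (mul_left_injective a⁻¹).injOn).subset ?_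
    intro x hx
    simp only [Set.mem_setOf_eq, Set.mem_preimage, inv_mul_cancel_right] at *
    tauto

lemma AI.bd_fin {S : Set G} (hS : S.Finite) {V : Set G} (h : AI V) : (bd S V).Finite := by
  refine (hS.biUnion fun s _ => h s).subset ?_
  rintro x ⟨s, hs, hx⟩
  exact Set.mem_biUnion hs hx

lemma bd_compl {S V : Set G} : bd S Vᶜ = bd S V := by
  ext x
  simp only [bd, Set.mem_setOf_eq, Set.mem_compl_iff, not_iff_not]

lemma bd_smul {S V : Set G} (k : G) : bd S (k • V) = k • bd S V := by
  ext x
  simp only [bd, Set.mem_setOf_eq, Set.mem_smul_set_iff_inv_smul_mem, smul_eq_mul, mul_assoc]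

lemma Conn.smul {S A : Set G} (h : Conn S A) (k : G) : Conn S (k • A) := by
  intro P ⟨x, hx, hxP⟩ hcl
  have := h (k⁻¹ • P) ⟨k⁻¹ * x, by simpa [Set.mem_smul_set_iff_inv_smul_mem] using hx,
    by simpa [Set.mem_smul_set_iff_inv_smul_mem] using hxP⟩ (by
    intro y hy hyP s hs hys
    have := hcl (k * y) (by simpa [Set.mem_smul_set_iff_inv_smul_mem] using hy)
      (by simpa [Set.mem_smul_set_iff_inv_smul_mem] using hyP) s hs
      (by simpa [Set.mem_smul_set_iff_inv_smul_mem, mul_assoc] using hys)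
    simpa [Set.mem_smul_set_iff_inv_smul_mem, mul_assoc] using this)
  have := Set.smul_set_mono (a := k) this
  simpa using this

lemma Conn.union {S A B : Set G} (hA : Conn S A) (hB : Conn S B)
    (h : ∃ x ∈ A, ∃ s ∈ S, x * s ∈ B) (h' : ∃ x ∈ B, ∃ s ∈ S, x * s ∈ A) : Conn S (A ∪ B) := by
  intro P ⟨x, hx, hxP⟩ hcl
  have cA : (A ∩ P).Nonempty → A ⊆ P := fun hne => hA P hne
    fun x hx hxP s hs hxs => hcl x (Or.inl hx) hxP s hs (Or.inl hxs)
  have cB : (B ∩ P).Nonempty → B ⊆ P := fun hne => hB P hne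
    fun x hx hxP s hs hxs => hcl x (Or.inr hx) hxP s hs (Or.inr hxs)
  rcases hx with hx | hx
  · have a := cA ⟨x, hx, hxP⟩
    obtain ⟨y, hy, s, hs, hys⟩ := h
    have b := cB ⟨y * s, hys, hcl y (Or.inl hy) (a hy) s hs (Or.inr hys)⟩
    exact Set.union_subset a b
  · have b := cB ⟨x, hx, hxP⟩
    obtain ⟨y, hy, s, hs, hys⟩ := h'
    have a := cA ⟨y * s, hys, hcl y (Or.inr hy) (b hy) s hs (Or.inl hys)⟩
    exact Set.union_subset a b

lemma Conn.sub {S A V : Set G} (hA : Conn S A) (hV : Disjoint A (bd S V)) (h : (A ∩ V).Nonempty) :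
    A ⊆ V := by
  refine hA V h ?_
  intro x hx hxV s hs _
  by_contra hc
  exact Set.disjoint_left.1 hV hx ⟨s, hs, fun h => hc (h.1 hxV)⟩

lemma conn_univ {S : Set G} (hgen : Subgroup.closure S = ⊤) (hsymm : ∀ s ∈ S, s⁻¹ ∈ S) :
    Conn S Set.univ := by
  intro P ⟨x, _, hx⟩ hcl y _
  have key : ∀ g : G, ∀ z, (z ∈ P ↔ z * g ∈ P) := by
    intro g
    have hg : g ∈ Subgroup.closure S := by rw [hgen]; trivial
    induction hg using Subgroup.closure_induction with
    | mem s hs =>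
      intro z
      refine ⟨fun hz => hcl z trivial hz s hs trivial, fun hz => ?_⟩
      have := hcl _ trivial hz _ (hsymm s hs) trivial
      simpa using this
    | one => simp
    | mul a b _ _ ha hb => intro z; rw [ha z, hb, mul_assoc]
    | inv a _ ha => intro z; rw [ha (z * a⁻¹)]; simp
  have := (key (x⁻¹ * y) x).1 hx
  simpa using this

/-- every finite set is contained in a finite connected set -/
lemma exists_conn {S : Set G} (hS : S.Finite) (hgen : Subgroup.closure S = ⊤)
    (hsymm : ∀ s ∈ S, s⁻¹ ∈ S) {F : Set G} (hF : F.Finite) :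
    ∃ K : Set G, K.Finite ∧ Conn S K ∧ F ⊆ K ∧ 1 ∈ K := by
  have step : ∀ A : Set G, Conn S A → Conn S (A ∪ A * S) := by
    intro A hA P ⟨x, hx, hxP⟩ hcl
    have cA : (A ∩ P).Nonempty → A ⊆ P := fun hne => hA P hne
      fun x hx hxP s hs hxs => hcl x (Or.inl hx) hxP s hs (Or.inl hxs)
    have hAP : A ⊆ P := by
      rcases hx with hx | hx
      · exact cA ⟨x, hx, hxP⟩
      · obtain ⟨a, ha, s, hs, rfl⟩ := Set.mem_mul.1 hx
        refine cA ⟨a, ha, ?_⟩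
        have := hcl (a * s) (Or.inr hx) hxP s⁻¹ (hsymm s hs) (by left; simpa using ha)
        simpa using this
    intro y hy
    rcases hy with hy | hy
    · exact hAP hy
    · obtain ⟨a, ha, s, hs, rfl⟩ := Set.mem_mul.1 hy
      exact hcl a (Or.inl ha) (hAP ha) s hs (Or.inr hy)
  let b : ℕ → Set G := fun n => Nat.rec {1} (fun _ A => A ∪ A * S) n
  have b0 : b 0 = {1} := rfl
  have bs : ∀ n, b (n + 1) = b n ∪ b n * S := fun n => rfl
  have bfin : ∀ n, (b n).Finite := by
    intro n
    induction n with
    | zero => simp [b0]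
    | succ n ih => rw [bs]; exact ih.union (ih.mul hS)
  have bconn : ∀ n, Conn S (b n) := by
    intro n
    induction n with
    | zero =>
      rw [b0]
      intro P ⟨x, hx, hxP⟩ _ y hy
      rw [Set.mem_singleton_iff] at hx hy
      rw [hy, ← hx]; exact hxP
    | succ n ih => rw [bs]; exact step _ ih
  have bmono : Monotone b := monotone_nat_of_le_succ fun n => by rw [bs]; exact Set.subset_union_left
  have bex : ∀ x, ∃ n, x ∈ b n := by
    intro x
    have := conn_univ hgen hsymm {x | ∃ n, x ∈ b n} ⟨1, trivial, 0, by simp [b0]⟩ (by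
      rintro x - ⟨n, hn⟩ s hs -
      exact ⟨n + 1, by rw [bs]; right; exact Set.mul_mem_mul hn hs⟩)
    exact this (Set.mem_univ x)
  choose nn hnn using bex
  obtain ⟨N, hN⟩ := (hF.image nn).bddAbove
  refine ⟨b N, bfin N, bconn N, fun x hx => bmono (hN ⟨x, hx, rfl⟩) (hnn x), bmono (Nat.zero_le N) ?_⟩
  simp [b0]

/-- `A ⊆ V` from boundary conditions -/
lemma nest_sub {S : Set G} (hgen : Subgroup.closure S = ⊤) (hsymm : ∀ s ∈ S, s⁻¹ ∈ S) {A V : Set G}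
    (h1 : Disjoint (bd S V) A) (h2 : bd S A ⊆ V) (h3 : V.Nonempty ∨ A ≠ Set.univ) : A ⊆ V := by
  by_contra hc
  obtain ⟨x, hx, hxV⟩ := Set.not_subset.1 hc
  have := conn_univ hgen hsymm (A \ V) ⟨x, trivial, hx, hxV⟩ (by
    rintro y - ⟨hy, hyV⟩ s hs -
    constructor
    · by_contra h
      exact hyV (h2 ⟨s, hs, fun h' => h (h'.1 hy)⟩)
    · intro h
      exact Set.disjoint_left.1 h1 ⟨s, hs, fun h' => hyV (h'.2 h)⟩ hy)
  rcases h3 with ⟨v, hv⟩ | h3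
  · exact (this (Set.mem_univ v)).2 hv
  · exact h3 (Set.eq_univ_of_univ_subset fun z hz => (this hz).1)

end EndsAI

end

section
universe w
open scoped Pointwise

namespace EndsAI

variable {G : Type u} [Group G]

/-- A finite connected set with three infinite complementary components. -/
structure ED (G : Type u) [Group G] where
  S : Set G
  hS : S.Finite
  gen : Subgroup.closure S = ⊤
  symm : ∀ s ∈ S, s⁻¹ ∈ S
  B : Set G
  Bfin : B.Finite
  one : (1 : G) ∈ B
  Bconn : Conn S B
  C : Fin 3 → Set G
  Cinf : ∀ j, (C j).Infinite
  Cconn : ∀ j, Conn S (C j)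
  Cdisj : ∀ i j, i ≠ j → Disjoint (C i) (C j)
  BC : ∀ j, Disjoint B (C j)
  Cclosed : ∀ j, ∀ x ∈ C j, ∀ s ∈ S, x * s ∉ B → x * s ∈ C j

/-- nontrivial almost invariant set -/
def NT (V : Set G) : Prop := AI V ∧ V.Infinite ∧ Vᶜ.Infinite

lemma NT.compl {V : Set G} (h : NT V) : NT Vᶜ := ⟨h.1.compl, h.2.2, by rw [compl_compl]; exact h.2.1⟩

lemma infinite_smul {V : Set G} (h : V.Infinite) (k : G) : (k • V).Infinite := by
  rw [← Set.image_smul]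
  exact h.image (MulAction.injective k).injOn

lemma NT.smul {V : Set G} (h : NT V) (k : G) : NT (k • V) :=
  ⟨h.1.smul k, infinite_smul h.2.1 k, by rw [← Set.smul_set_compl]; exact infinite_smul h.2.2 k⟩

lemma disj_smul {K B : Set G} {x : G} (h : x ∉ K * B⁻¹) : Disjoint K (x • B) := by
  rw [Set.disjoint_left]
  rintro _ hk ⟨b, hb, rfl⟩
  apply h
  have := Set.mul_mem_mul hk (Set.inv_mem_inv.2 hb)
  simpa using this

lemma disjoint_smul_set' {A B : Set G} (k : G) (h : Disjoint A B) : Disjoint (k • A) (k • B) := by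
  rw [Set.disjoint_left] at *
  intro x hx hx'
  rw [Set.mem_smul_set_iff_inv_smul_mem] at hx hx'
  exact h hx hx'

namespace ED

lemma exK (T : ED G) {F : Set G} (hF : F.Finite) : ∃ K : Set G, K.Finite ∧ Conn T.S K ∧ F ⊆ K ∧ (1 : G) ∈ K :=
  exists_conn T.hS T.gen T.symm hF

lemma edge (T : ED G) (j : Fin 3) : ∃ x ∈ T.C j, ∃ s ∈ T.S, x * s ∈ T.B := by
  by_contra hc
  push Not at hc
  obtain ⟨x, hx⟩ := (T.Cinf j).nonempty
  have := conn_univ T.gen T.symm (T.C j) ⟨x, trivial, hx⟩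
    (fun y _ hy s hs _ => T.Cclosed j y hy s hs (hc y hy s hs))
  exact Set.disjoint_left.1 (T.BC j) T.one (this (Set.mem_univ 1))

lemma BCconn (T : ED G) (j : Fin 3) : Conn T.S (T.B ∪ T.C j) := by
  obtain ⟨x, hx, s, hs, hb⟩ := T.edge j
  exact T.Bconn.union (T.Cconn j) ⟨x * s, hb, s⁻¹, T.symm s hs, by simpa using hx⟩ ⟨x, hx, s, hs, hb⟩

lemma bdC (T : ED G) (j : Fin 3) : bd T.S (T.C j) ⊆ T.B ∪ T.B * T.S := by
  rintro x ⟨s, hs, hx⟩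
  by_cases h : x ∈ T.C j
  · right
    have hb : x * s ∈ T.B := by
      by_contra hb
      exact hx ⟨fun _ => T.Cclosed j x h s hs hb, fun _ => h⟩
    have := Set.mul_mem_mul hb (T.symm s hs)
    simpa using this
  · left
    by_contra hb
    have h2 : x * s ∈ T.C j := by
      by_contra h2; exact hx ⟨fun h' => absurd h' h, fun h' => absurd h' h2⟩
    have := T.Cclosed j _ h2 s⁻¹ (T.symm s hs) (by simpa using hb)
    exact h (by simpa using this)

lemma AIC (T : ED G) (j : Fin 3) : AI (T.C j) :=
  AI.of_bd T.gen ((T.Bfin.union (T.Bfin.mul T.hS)).subset (T.bdC j))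

lemma NTC (T : ED G) (j : Fin 3) : NT (T.C j) := by
  refine ⟨T.AIC j, T.Cinf j, ?_⟩
  obtain ⟨i, hi⟩ : ∃ i : Fin 3, i ≠ j := exists_ne j
  exact (T.Cinf i).mono (fun x hx hx' => Set.disjoint_left.1 (T.Cdisj i j hi) hx hx')

lemma sepK (T : ED G) {K : Set G} (hK : Conn T.S K) {x : G} (h : Disjoint K (x • T.B)) :
    ∃ j0, ∀ j, j ≠ j0 → Disjoint K (x • T.C j) := by
  have key : ∀ j, ¬ Disjoint K (x • T.C j) → K ⊆ x • T.C j := by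
    intro j hj
    rw [Set.not_disjoint_iff_nonempty_inter] at hj
    refine hK _ hj ?_
    intro y hy hyC s hs hys
    have hb : y * s ∉ x • T.B := Set.disjoint_left.1 h hys
    rw [Set.mem_smul_set_iff_inv_smul_mem, smul_eq_mul] at *
    rw [← mul_assoc] at *
    exact T.Cclosed j _ hyC s hs hb
  by_cases hc : ∃ j, ¬ Disjoint K (x • T.C j)
  · obtain ⟨j0, hj0⟩ := hc
    refine ⟨j0, fun j hj => ?_⟩
    have h1 := key j0 hj0
    exact Disjoint.mono_left h1 (disjoint_smul_set' x (T.Cdisj _ _ hj.symm))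
  · push Not at hc
    exact ⟨0, fun j _ => hc j⟩

/-- deep lemma -/
lemma deep (T : ED G) {V : Set G} (hV : AI V) :
    {x | x ∈ V ∧ ¬ ∃ j0, ∀ j, j ≠ j0 → x • T.C j ⊆ V}.Finite := by
  obtain ⟨K, Kf, Kc, Kb, -⟩ := T.exK (hV.bd_fin T.hS)
  refine (Kf.mul T.Bfin.inv).subset ?_
  rintro x ⟨hxV, hx⟩
  by_contra hc
  have hd := disj_smul hc
  obtain ⟨j0, hj0⟩ := T.sepK Kc hd
  refine hx ⟨j0, fun j hj => ?_⟩
  have h1 := (T.BCconn j).smul x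
  have h2 : x ∈ x • (T.B ∪ T.C j) := ⟨1, Or.inl T.one, by simp⟩
  have h3 : Disjoint (x • (T.B ∪ T.C j)) (bd T.S V) := by
    refine Disjoint.mono_right Kb ?_
    rw [Set.smul_set_union, Set.disjoint_union_left]
    exact ⟨hd.symm, (hj0 j hj).symm⟩
  exact (Set.smul_set_mono Set.subset_union_right).trans (h1.sub h3 ⟨x, h2, hxV⟩)

lemma exists_deep (T : ED G) {V : Set G} (hV : AI V) (hi : V.Infinite) {F : Set G} (hF : F.Finite) :
    ∃ x ∈ V, x ∉ F ∧ ∃ j0, ∀ j, j ≠ j0 → x • T.C j ⊆ V := by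
  obtain ⟨x, hx, hx'⟩ := (hi.diff ((T.deep hV).union hF)).nonempty
  simp only [Set.mem_union, not_or, Set.mem_setOf_eq, not_and, not_not] at hx'
  exact ⟨x, hx, hx'.2, hx'.1 hx⟩

lemma two (j0 : Fin 3) : ∃ i j : Fin 3, i ≠ j ∧ i ≠ j0 ∧ j ≠ j0 := by
  revert j0; decide

lemma pieces (T : ED G) {V : Set G} (hV : AI V) (hi : V.Infinite) : ∃ A1 A2 : Set G, NT A1 ∧ NT A2 ∧
    Disjoint A1 A2 ∧ A1 ⊆ V ∧ A2 ⊆ V := by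
  obtain ⟨x, -, -, j0, hj0⟩ := T.exists_deep hV hi Set.finite_empty
  obtain ⟨i, j, hij, h1, h2⟩ := two j0
  exact ⟨_, _, (T.NTC i).smul x, (T.NTC j).smul x, disjoint_smul_set' x (T.Cdisj i j hij),
    hj0 i h1, hj0 j h2⟩

lemma dich (T : ED G) {K V : Set G} (hK : Conn T.S K) (h : Disjoint K (bd T.S V)) : K ⊆ V ∨ K ⊆ Vᶜ := by
  by_cases hc : (K ∩ V).Nonempty
  · exact Or.inl (hK.sub h hc)
  · right
    intro x hx hxV
    exact hc ⟨x, hx, hxV⟩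

lemma nestK (T : ED G) {A V K K' : Set G} (hK' : Conn T.S K') (hA : bd T.S A ⊆ K)
    (hV : bd T.S V ⊆ K') (hd : Disjoint K K') (hKV : K ⊆ V) (hVn : V.Nonempty) :
    A ⊆ V ∨ Aᶜ ⊆ V := by
  rcases T.dich hK' (V := A) (Disjoint.mono_right hA hd.symm) with h | h
  · right
    refine nest_sub T.gen T.symm ?_ (by rw [bd_compl]; exact hA.trans hKV) (Or.inl hVn)
    exact Disjoint.mono_left (hV.trans h) disjoint_compl_right
  · left
    refine nest_sub T.gen T.symm ?_ (hA.trans hKV) (Or.inl hVn)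
    exact Disjoint.mono_left (hV.trans h) disjoint_compl_left

lemma nested (T : ED G) {A V : Set G} (hA : AI A) (hV : NT V) :
    {h : G | ¬ (h • A ⊆ V ∨ (h • A)ᶜ ⊆ V ∨ h • A ⊆ Vᶜ ∨ (h • A)ᶜ ⊆ Vᶜ)}.Finite := by
  obtain ⟨K, Kf, Kc, Kb, -⟩ := T.exK (hA.bd_fin T.hS)
  obtain ⟨K', Kf', Kc', Kb', -⟩ := T.exK (hV.1.bd_fin T.hS)
  refine (Kf'.mul Kf.inv).subset ?_
  intro h hh
  by_contra hc
  have hd := disj_smul hc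
  have hb : bd T.S (h • A) ⊆ h • K := by rw [bd_smul]; exact Set.smul_set_mono Kb
  apply hh
  rcases T.dich (Kc.smul h) (Disjoint.mono_right Kb' hd.symm) with h1 | h1
  · rcases T.nestK Kc' hb Kb' hd.symm h1 hV.2.1.nonempty with h2 | h2
    · exact Or.inl h2
    · exact Or.inr (Or.inl h2)
  · rcases T.nestK Kc' hb (by rw [bd_compl]; exact Kb') hd.symm h1 hV.2.2.nonempty with h2 | h2
    · exact Or.inr (Or.inr (Or.inl h2))
    · exact Or.inr (Or.inr (Or.inr h2))

lemma dive (T : ED G) {A V : Set G} (hA : AI A) (hV : AI V) (hi : V.Infinite) :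
    ∃ h : G, h • A ⊆ V ∨ (h • A)ᶜ ⊆ V := by
  obtain ⟨K, Kf, Kc, Kb, K1⟩ := T.exK (hA.bd_fin T.hS)
  obtain ⟨K', Kf', Kc', Kb', -⟩ := T.exK (hV.bd_fin T.hS)
  obtain ⟨h, hh, hc⟩ := (hi.diff (Kf'.mul Kf.inv)).nonempty
  have hd := disj_smul hc
  have hb : bd T.S (h • A) ⊆ h • K := by rw [bd_smul]; exact Set.smul_set_mono Kb
  refine ⟨h, T.nestK Kc' hb Kb' hd.symm ?_ ⟨h, hh⟩⟩
  exact (Kc.smul h).sub (Disjoint.mono_right Kb' hd.symm) ⟨h, ⟨1, K1, by simp⟩, hh⟩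

end ED

/-- separating translates -/
def MM (A : Set G) (p q : G) : Set G := {h | p ∉ h • A ∧ q ∈ h • A}

lemma MM_fin {A : Set G} (hA : AI A) (p q : G) : (MM A p q).Finite := by
  have := (hA (p⁻¹ * q)).preimage (f := fun h : G => h⁻¹ * p)
    ((mul_left_injective p).comp inv_injective).injOn
  refine this.subset ?_
  rintro h ⟨h1, h2⟩
  rw [Set.mem_smul_set_iff_inv_smul_mem, smul_eq_mul] at h1 h2
  intro h'
  have h' : h⁻¹ * p ∈ A ↔ h⁻¹ * p * (p⁻¹ * q) ∈ A := h'
  rw [← mul_assoc, mul_assoc h⁻¹, mul_inv_cancel, mul_one] at h'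
  exact h1 (h'.2 h2)

lemma MM_tri {A : Set G} (hA : AI A) (p q r : G) :
    (MM A p r).ncard ≤ (MM A p q).ncard + (MM A q r).ncard := by
  refine (Set.ncard_le_ncard (t := MM A p q ∪ MM A q r) ?_
    ((MM_fin hA p q).union (MM_fin hA q r))).trans (Set.ncard_union_le _ _)
  rintro h ⟨h1, h2⟩
  by_cases hq : q ∈ h • A
  · exact Or.inl ⟨h1, hq⟩
  · exact Or.inr ⟨hq, h2⟩

lemma MM_inv {A : Set G} (hA : AI A) (k p q : G) : (MM A (k * p) (k * q)).ncard ≤ (MM A p q).ncard := by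
  refine Set.ncard_le_ncard_of_injOn (fun h => k⁻¹ * h) ?_ (mul_right_injective _).injOn (MM_fin hA p q)
  rintro h ⟨h1, h2⟩
  simp only [Set.mem_smul_set_iff_inv_smul_mem, smul_eq_mul] at h1 h2
  simpa [MM, Set.mem_smul_set_iff_inv_smul_mem, mul_assoc] using And.intro h1 h2

lemma MM_mul {A : Set G} (hA : AI A) (p q : G) :
    (MM A 1 (p * q)).ncard ≤ (MM A 1 p).ncard + (MM A 1 q).ncard := by
  refine (MM_tri hA 1 p (p * q)).trans (Nat.add_le_add_left ?_ _)
  have := MM_inv hA p 1 q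
  rwa [mul_one] at this

lemma MM_pow {A : Set G} (hA : AI A) (p : G) (n : ℕ) :
    (MM A 1 (p ^ n)).ncard ≤ n * (MM A 1 p).ncard := by
  induction n with
  | zero =>
    have : MM A 1 (p ^ 0) = ∅ := by
      rw [pow_zero]; ext h; simp [MM]
    rw [this]; simp
  | succ n ih =>
    rw [pow_succ]
    have := MM_mul hA (p ^ n) p
    rw [add_mul, one_mul]; omega

namespace ED

lemma flip (T : ED G) {A : Set G} (hA : NT A) : ∃ t : G, t • Aᶜ ⊆ A := by
  classical
  by_contra hno
  push Not at hno
  obtain ⟨A1, A2, n1, n2, hd, s1, s2⟩ := T.pieces hA.1 hA.2.1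
  have get : ∀ A' : Set G, NT A' → A' ⊆ A → ∃ a : G, a • A ⊆ A' := by
    intro A' hA' hs
    obtain ⟨h, h1 | h1⟩ := T.dive hA.1 hA'.1 hA'.2.1
    · exact ⟨h, h1⟩
    · exact absurd (by rw [Set.smul_set_compl]; exact h1.trans hs) (hno h)
  obtain ⟨a, ha⟩ := get A1 n1 s1
  obtain ⟨b, hb⟩ := get A2 n2 s2
  obtain ⟨x0, hx0⟩ := hA.2.2.nonempty
  obtain ⟨y0, hy0⟩ := hA.2.1.nonempty
  have apow : ∀ n, a ^ n • A ⊆ A := by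
    intro n
    induction n with
    | zero => simp
    | succ n ih => rw [pow_succ, mul_smul]; exact (Set.smul_set_mono (ha.trans s1)).trans ih
  have apow1 : ∀ n, a ^ (n + 1) • A ⊆ A1 := by
    intro n
    rw [pow_succ', mul_smul]; exact (Set.smul_set_mono (apow n)).trans ha
  let W : ℕ × ℕ → G := fun p => a ^ p.1 * b * a ^ p.2
  have WA : ∀ p, W p • A ⊆ A := by
    intro p
    simp only [W, mul_smul]
    exact (Set.smul_set_mono ((Set.smul_set_mono (apow _)).trans (hb.trans s2))).trans (apow _)
  have contra : ∀ n (X Y : G), a ^ (n+1) * X = b * Y → X • A ⊆ A → Y • A ⊆ A → False := by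
    intro n X Y h hX hY
    have h1 : (a ^ (n+1) * X) • A ⊆ A1 := by
      rw [mul_smul]; exact (Set.smul_set_mono hX).trans (apow1 n)
    have h2 : (a ^ (n+1) * X) • A ⊆ A2 := by
      rw [h, mul_smul]; exact (Set.smul_set_mono hY).trans hb
    have h3 : (a ^ (n+1) * X) * y0 ∈ (a ^ (n+1) * X) • A := ⟨y0, hy0, rfl⟩
    exact Set.disjoint_left.1 hd (h1 h3) (h2 h3)
  have baA : ∀ j, (b * a ^ j) • A ⊆ A := by
    intro j; rw [mul_smul]; exact (Set.smul_set_mono (apow _)).trans (hb.trans s2)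
  have Winj1 : ∀ p q : ℕ × ℕ, W p = W q → ¬ p.1 < q.1 := by
    intro p q h hlt
    obtain ⟨n, hn⟩ := Nat.exists_eq_add_of_lt hlt
    have h' : a ^ p.1 * (b * a ^ p.2) = a ^ p.1 * (a ^ (n + 1) * (b * a ^ q.2)) := by
      simp only [W] at h
      rw [← mul_assoc, h, hn, show p.1 + n + 1 = p.1 + (n + 1) by ring, pow_add]
      simp only [mul_assoc]
    exact contra n (b * a ^ q.2) (a ^ p.2) (mul_left_cancel h').symm (baA _) (apow _)
  have Winj2 : ∀ i j : ℕ, a ^ i = a ^ j → ¬ i < j := by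
    intro i j h hlt
    obtain ⟨n, hn⟩ := Nat.exists_eq_add_of_lt hlt
    have : a ^ (n + 1) = 1 := by
      rw [hn, show i + n + 1 = i + (n + 1) by ring, pow_add] at h
      exact left_eq_mul.1 h
    refine contra n b 1 (by rw [this]; simp) (hb.trans s2) (by simp)
  have Winj : Function.Injective W := by
    intro p q h
    have e1 : p.1 = q.1 := le_antisymm (not_lt.1 (Winj1 q p h.symm)) (not_lt.1 (Winj1 p q h))
    have e2 : a ^ p.2 = a ^ q.2 := by
      simp only [W] at h; rw [e1] at h; exact mul_left_cancel h
    exact Prod.ext e1 (le_antisymm (not_lt.1 (Winj2 _ _ e2.symm)) (not_lt.1 (Winj2 _ _ e2)))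
  set F := {h : G | ¬ (h • A ⊆ A ∨ (h • A)ᶜ ⊆ A ∨ h • A ⊆ Aᶜ ∨ (h • A)ᶜ ⊆ Aᶜ)} with hF
  have Ff : F.Finite := T.nested hA.1 hA
  set ma := (MM A 1 a).ncard
  set X := F.ncard + 2 * ((MM A x0 1).ncard + (MM A 1 b).ncard + (MM A 1 y0).ncard) with hX
  set n := X + 4 * ma + 1 with hn
  have mb : ∀ p ∈ Finset.range n ×ˢ Finset.range n, (MM A x0 (W p * y0)).ncard ≤
      (MM A x0 1).ncard + (MM A 1 b).ncard + (MM A 1 y0).ncard + 2 * n * ma := by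
    intro p hp
    rw [Finset.mem_product, Finset.mem_range, Finset.mem_range] at hp
    have h1 := MM_tri hA.1 x0 1 (W p * y0)
    have h2 := MM_mul hA.1 (W p) y0
    have h3 : (MM A 1 (W p)).ncard ≤ _ := MM_mul hA.1 (a ^ p.1 * b) (a ^ p.2)
    have h4 := MM_mul hA.1 (a ^ p.1) b
    have h5 := (MM_pow hA.1 a p.1).trans (Nat.mul_le_mul_right ma hp.1.le)
    have h6 := (MM_pow hA.1 a p.2).trans (Nat.mul_le_mul_right ma hp.2.le)
    have : 2 * n * ma = n * ma + n * ma := by ring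
    omega
  set m := (MM A x0 1).ncard + (MM A 1 b).ncard + (MM A 1 y0).ncard + 2 * n * ma with hm
  set P := Finset.range n ×ˢ Finset.range n with hP
  have Pc : P.card = n * n := by simp [hP]
  let R1 := (P ×ˢ P).filter fun z => W z.2 * (W z.1)⁻¹ ∈ F ∨ W z.1 * (W z.2)⁻¹ ∈ MM A x0 (W z.1 * y0)
  let R2 := (P ×ˢ P).filter fun z => W z.2 * (W z.1)⁻¹ ∈ MM A x0 (W z.2 * y0)
  have cov : P ×ˢ P ⊆ R1 ∪ R2 := by
    rintro ⟨p, q⟩ hpq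
    by_cases hFm : W q * (W p)⁻¹ ∈ F
    · exact Finset.mem_union_left _ (Finset.mem_filter.2 ⟨hpq, Or.inl hFm⟩)
    simp only [hF, Set.mem_setOf_eq, not_not] at hFm
    have key : ∀ p q, (W q * (W p)⁻¹) • A ⊆ A → W q * (W p)⁻¹ ∈ MM A x0 (W q * y0) := by
      intro p q h
      refine ⟨fun hx => hx0 (h hx), ?_⟩
      have : W p * y0 ∈ A := WA p ⟨y0, hy0, rfl⟩
      exact ⟨W p * y0, this, by simp [mul_assoc]⟩
    rcases hFm with h | h | h | h
    · exact Finset.mem_union_right _ (Finset.mem_filter.2 ⟨hpq, key p q h⟩)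
    · exact absurd (by rw [Set.smul_set_compl]; exact h) (hno (W q * (W p)⁻¹))
    · exfalso
      have : W p * y0 ∈ A := WA p ⟨y0, hy0, rfl⟩
      refine h ⟨W p * y0, this, rfl⟩ ?_
      have : W q * y0 ∈ A := WA q ⟨y0, hy0, rfl⟩
      simpa [mul_assoc] using this
    · refine Finset.mem_union_left _ (Finset.mem_filter.2 ⟨hpq, Or.inr (key q p ?_)⟩)
      have := Set.smul_set_mono (a := W p * (W q)⁻¹) (Set.compl_subset_compl.1 h)
      rw [← mul_smul] at this
      simpa [mul_assoc] using this
  have c1 : R1.card ≤ (F.ncard + m) * P.card := by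
    refine Finset.card_le_mul_card_image_of_maps_to (f := Prod.fst) (fun z hz =>
      (Finset.mem_product.1 (Finset.mem_filter.1 hz).1).1) _ ?_
    intro p hp
    rw [← Set.ncard_coe_finset]
    refine (Set.ncard_le_ncard_of_injOn (t := F ∪ (fun h => h⁻¹) '' MM A x0 (W p * y0))
      (fun z => W z.2 * (W p)⁻¹) ?_ ?_ (Ff.union ((MM_fin hA.1 _ _).image _))).trans
      ((Set.ncard_union_le _ _).trans (Nat.add_le_add_left
        ((Set.ncard_image_le (MM_fin hA.1 _ _)).trans (mb p hp)) _))
    · intro z hz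
      simp only [Finset.coe_filter, Set.mem_setOf_eq, R1, Finset.mem_filter] at hz
      obtain ⟨⟨_, hz⟩, rfl⟩ := hz
      rcases hz with hz | hz
      · exact Or.inl hz
      · exact Or.inr ⟨_, hz, by simp⟩
    · intro z hz z' hz' hzz
      simp only [Finset.coe_filter, Set.mem_setOf_eq] at hz hz'
      exact Prod.ext (hz.2.trans hz'.2.symm) (Winj (mul_right_cancel hzz))
  have c2 : R2.card ≤ m * P.card := by
    refine Finset.card_le_mul_card_image_of_maps_to (f := Prod.snd) (fun z hz =>
      (Finset.mem_product.1 (Finset.mem_filter.1 hz).1).2) _ ?_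
    intro p hp
    rw [← Set.ncard_coe_finset]
    refine (Set.ncard_le_ncard_of_injOn (t := MM A x0 (W p * y0))
      (fun z => W p * (W z.1)⁻¹) ?_ ?_ (MM_fin hA.1 _ _)).trans (mb p hp)
    · intro z hz
      simp only [Finset.coe_filter, Set.mem_setOf_eq, R2, Finset.mem_filter] at hz
      obtain ⟨⟨_, hz⟩, rfl⟩ := hz
      exact hz
    · intro z hz z' hz' hzz
      simp only [Finset.coe_filter, Set.mem_setOf_eq] at hz hz'
      exact Prod.ext (Winj (inv_injective (mul_left_cancel hzz))) (hz.2.trans hz'.2.symm)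
  have := (Finset.card_le_card cov).trans (Finset.card_union_le _ _)
  rw [Finset.card_product, Pc] at this
  rw [Pc] at c1 c2
  have h1 : (n * n) * (n * n) ≤ (n * n) * (F.ncard + m + m) := by nlinarith
  have h2 : n * n ≤ F.ncard + m + m := Nat.le_of_mul_le_mul_left h1 (by positivity)
  have h3 : F.ncard + m + m = X + 4 * ma * n := by rw [hX, hm]; ring
  have h4 : n * n = (X + 4 * ma + 1) * n := by rw [← hn]
  have h5 : X ≤ X * n := Nat.le_mul_of_pos_right _ (by omega)
  have h6 : (X + 4 * ma + 1) * n = X * n + 4 * ma * n + n := by ring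
  omega

lemma TT (T : ED G) {U V : Set G} (hU : NT U) (hV : AI V) (hi : V.Infinite) :
    (∃ h : G, h • U ⊆ V) ∧ (∃ h : G, (h • U)ᶜ ⊆ V) := by
  obtain ⟨h, hh⟩ := T.dive hU.1 hV hi
  obtain ⟨t, ht⟩ := T.flip hU
  obtain ⟨t', ht'⟩ := T.flip hU.compl
  rw [compl_compl] at ht'
  rcases hh with hh | hh
  · refine ⟨⟨h, hh⟩, h * t, ?_⟩
    rw [mul_smul, ← Set.smul_set_compl, ← Set.smul_set_compl]
    exact (Set.smul_set_mono ht).trans hh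
  · refine ⟨⟨h * t', ?_⟩, h, hh⟩
    rw [mul_smul]
    rw [← Set.smul_set_compl] at hh
    exact (Set.smul_set_mono ht').trans hh

end ED
end EndsAI

end

section
universe w
open scoped Pointwise

namespace EndsAI

variable {G : Type u} [Group G]

namespace ED

/-- family of test pieces -/
def Fam (T : ED G) (C F : Set G) : Prop :=
  (C = Set.univ ∧ F = ∅) ∨ ∃ (h : G) (i : Fin 3), C = h • T.C i ∧ F = h • (T.B * T.B⁻¹)

lemma Fam.prop {T : ED G} {C F : Set G} (h : T.Fam C F) : Conn T.S C ∧ AI C ∧ F.Finite ∧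
    ∀ x ∈ C, x ∉ F → ∃ j0, ∀ j, j ≠ j0 → x • T.C j ⊆ C := by
  rcases h with ⟨rfl, rfl⟩ | ⟨h, i, rfl, rfl⟩
  · exact ⟨conn_univ T.gen T.symm, AI.univ, Set.finite_empty, fun x _ _ => ⟨0, fun j _ => Set.subset_univ _⟩⟩
  · refine ⟨(T.Cconn i).smul h, (T.AIC i).smul h, (T.Bfin.mul T.Bfin.inv).smul_set, ?_⟩
    intro x hx hxF
    have hd : Disjoint (h • T.B) (x • T.B) := by
      apply disj_smul
      rwa [smul_mul_assoc]
    obtain ⟨j0, hj0⟩ := T.sepK (T.Bconn.smul h) hd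
    refine ⟨j0, fun j hj => ?_⟩
    have h1 := (T.BCconn j).smul x
    have h2 : x ∈ x • (T.B ∪ T.C j) := ⟨1, Or.inl T.one, by simp⟩
    have h3 : Disjoint (h • T.B) (x • (T.B ∪ T.C j)) := by
      rw [Set.smul_set_union, Set.disjoint_union_right]
      exact ⟨hd, hj0 j hj⟩
    refine (Set.smul_set_mono Set.subset_union_right).trans (h1 (h • T.C i) ⟨x, h2, hx⟩ ?_)
    intro y hy hyC s hs hys
    have hb : y * s ∉ h • T.B := fun hb => Set.disjoint_left.1 h3 hb hys
    rw [Set.mem_smul_set_iff_inv_smul_mem, smul_eq_mul] at hyC hb ⊢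
    rw [← mul_assoc] at *
    exact T.Cclosed i _ hyC s hs hb

lemma star (T : ED G) : ∃ Φ : Set G, Φ.Finite ∧ ∀ V : Set G, NT V → ∃ x : G, ∃ f ∈ Φ, ∃ f' ∈ Φ,
    ∃ i j : Fin 3, ((x * f) • T.C i \ V).Finite ∧ ((x * f') • T.C j ∩ V).Finite := by
  refine ⟨({1} ∪ T.S) ∪ (T.B * T.B⁻¹) * T.S, ((Set.finite_singleton 1).union T.hS).union
    ((T.Bfin.mul T.Bfin.inv).mul T.hS), ?_⟩
  intro V hV
  have bdf := hV.1.bd_fin T.hS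
  let Mx : Set G → Prop := fun C => (C ∩ V).Infinite ∧ (C \ V).Infinite
  have ex : ∃ n, ∃ C F, T.Fam C F ∧ Mx C ∧ (bd T.S V ∩ C).ncard = n :=
    ⟨_, Set.univ, ∅, Or.inl ⟨rfl, rfl⟩, ⟨by simpa using hV.2.1,
      by rw [← Set.compl_eq_univ_diff]; exact hV.2.2⟩, rfl⟩
  classical
  obtain ⟨C, F, hCF, hMx, hn⟩ := Nat.find_spec ex
  have hmin : ∀ C' F', T.Fam C' F' → Mx C' → (bd T.S V ∩ C).ncard ≤ (bd T.S V ∩ C').ncard := by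
    intro C' F' h1 h2
    rw [hn]; exact Nat.find_min' ex ⟨C', F', h1, h2, rfl⟩
  obtain ⟨Cc, CA, Ff, Cd⟩ := hCF.prop
  have pure : ∀ x ∈ C, x ∉ F → ∃ j, (x • T.C j \ V).Finite ∨ (x • T.C j ∩ V).Finite := by
    intro x hx hxF
    obtain ⟨j0, hj0⟩ := Cd x hx hxF
    obtain ⟨i, j, hij, h1, h2⟩ := two j0
    by_contra hc
    push Not at hc
    have key : ∀ k, k ≠ j0 → bd T.S V ∩ x • T.C k = bd T.S V ∩ C := fun k hk =>
      Set.eq_of_subset_of_ncard_le (Set.inter_subset_inter_right _ (hj0 k hk))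
        (hmin _ _ (Or.inr ⟨x, k, rfl, rfl⟩) ⟨(hc k).2, (hc k).1⟩) (bdf.inter_of_left _)
    have hd : Disjoint C (bd T.S V) := by
      rw [Set.disjoint_left]
      intro y hy hyb
      have a : y ∈ bd T.S V ∩ x • T.C i := by rw [key i h1]; exact ⟨hyb, hy⟩
      have b : y ∈ bd T.S V ∩ x • T.C j := by rw [key j h2]; exact ⟨hyb, hy⟩
      exact Set.disjoint_left.1 (disjoint_smul_set' x (T.Cdisj i j hij)) a.2 b.2
    have := Cc.sub hd hMx.1.nonempty
    exact hMx.2.nonempty.ne_empty (Set.diff_eq_empty.2 this)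
  let Wp : Set G := {x | (x ∈ C ∧ x ∉ F) ∧ ∃ j, (x • T.C j \ V).Finite}
  let Wm : Set G := {x | (x ∈ C ∧ x ∉ F) ∧ ∃ j, (x • T.C j ∩ V).Finite}
  have Wpn : Wp.Nonempty := by
    obtain ⟨x, hx, hxF, j0, hj0⟩ := T.exists_deep (CA.inter hV.1) hMx.1 Ff
    obtain ⟨j, hj⟩ := exists_ne j0
    refine ⟨x, ⟨hx.1, hxF⟩, j, ?_⟩
    rw [Set.diff_eq_empty.2 ((hj0 j hj).trans Set.inter_subset_right)]; exact Set.finite_empty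
  have Wmn : Wm.Nonempty := by
    obtain ⟨x, hx, hxF, j0, hj0⟩ := T.exists_deep (CA.diff hV.1) hMx.2 Ff
    obtain ⟨j, hj⟩ := exists_ne j0
    refine ⟨x, ⟨hx.1, hxF⟩, j, ?_⟩
    rw [Set.disjoint_iff_inter_eq_empty.1 (Set.disjoint_left.2 fun y hy => (hj0 j hj hy).2)]
    exact Set.finite_empty
  by_cases hadj : ∃ x ∈ Wp, ∃ s, (s = 1 ∨ s ∈ T.S) ∧ x * s ∈ Wm
  · obtain ⟨x, ⟨-, i, hi⟩, s, hs, -, j, hj⟩ := hadj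
    exact ⟨x, 1, Or.inl (Or.inl rfl), s, Or.inl hs, i, j, by simpa using hi, hj⟩
  push Not at hadj
  have hp : ∃ x ∈ Wp, ∃ s ∈ T.S, x * s ∈ F := by
    by_contra hc
    push Not at hc
    have := Cc Wp (Wpn.imp fun x hx => ⟨hx.1.1, hx⟩) (by
      intro x hx hxW s hs hxs
      obtain ⟨j, hj | hj⟩ := pure (x * s) hxs (hc x hxW s hs)
      · exact ⟨⟨hxs, hc x hxW s hs⟩, j, hj⟩
      · exact absurd ⟨⟨hxs, hc x hxW s hs⟩, j, hj⟩ (hadj x hxW s (Or.inr hs)))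
    obtain ⟨y, hy⟩ := Wmn
    exact hadj y (this hy.1.1) 1 (Or.inl rfl) (by simpa using hy)
  have hm : ∃ x ∈ Wm, ∃ s ∈ T.S, x * s ∈ F := by
    by_contra hc
    push Not at hc
    have := Cc Wm (Wmn.imp fun x hx => ⟨hx.1.1, hx⟩) (by
      intro x hx hxW s hs hxs
      obtain ⟨j, hj | hj⟩ := pure (x * s) hxs (hc x hxW s hs)
      · exact absurd hxW (by
          have := hadj (x * s) ⟨⟨hxs, hc x hxW s hs⟩, j, hj⟩ s⁻¹ (Or.inr (T.symm s hs))
          simpa using this)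
      · exact ⟨⟨hxs, hc x hxW s hs⟩, j, hj⟩)
    obtain ⟨y, hy⟩ := Wpn
    exact hadj y hy 1 (Or.inl rfl) (by simpa using this hy.1.1)
  obtain ⟨x, ⟨-, i, hi⟩, s, hs, hxF⟩ := hp
  obtain ⟨y, ⟨-, j, hj⟩, s', hs', hyF⟩ := hm
  rcases hCF with ⟨-, rfl⟩ | ⟨h, k, -, rfl⟩
  · exact absurd hxF (Set.notMem_empty _)
  · obtain ⟨b, hb, hbx⟩ := hxF
    obtain ⟨b', hb', hby⟩ := hyF
    simp only [smul_eq_mul] at hbx hby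
    refine ⟨h, b * s⁻¹, Or.inr (Set.mul_mem_mul hb (T.symm s hs)), b' * s'⁻¹,
      Or.inr (Set.mul_mem_mul hb' (T.symm s' hs')), i, j, ?_, ?_⟩
    · rw [← mul_assoc, hbx]; simpa using hi
    · rw [← mul_assoc, hby]; simpa using hj

end ED
end EndsAI

end

section
universe w
open scoped Pointwise

namespace EndsAI

variable {G : Type u} [Group G]

/-- almost inclusion -/
def AS {X : Type*} (A B : Set X) : Prop := (A \ B).Finite

lemma AS.of_sub {X : Type*} {A B : Set X} (h : A ⊆ B) : AS A B := by
  rw [AS, Set.diff_eq_empty.2 h]; exact Set.finite_empty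

lemma AS.trans {X : Type*} {A B C : Set X} (h : AS A B) (h' : AS B C) : AS A C := by
  refine (h.union h').subset ?_
  rintro x ⟨hx, hc⟩
  by_cases hb : x ∈ B
  · exact Or.inr ⟨hb, hc⟩
  · exact Or.inl ⟨hx, hb⟩

lemma AS.smul {A B : Set G} (h : AS A B) (k : G) : AS (k • A) (k • B) := by
  rw [AS, ← Set.smul_set_sdiff]; exact Set.Finite.smul_set h

lemma AS.of_smul {A B : Set G} {k : G} (h : AS (k • A) (k • B)) : AS A B := by
  have := h.smul k⁻¹
  rwa [inv_smul_smul, inv_smul_smul] at this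

lemma list_prod {U : Set G} (L : List G) (hL : ∀ t ∈ L, AS U (t • U)) : ∃ g : G, AS U (g • U) ∧
    ∀ t ∈ L, ∃ k : G, AS U (k • U) ∧ AS ((k * t) • U) (g • U) := by
  induction L with
  | nil => exact ⟨1, by rw [one_smul]; exact AS.of_sub subset_rfl, by simp⟩
  | cons t L ih =>
    obtain ⟨g, hg, h⟩ := ih fun t ht => hL t (List.mem_cons_of_mem _ ht)
    have ht := hL t List.mem_cons_self
    refine ⟨t * g, ?_, ?_⟩
    · rw [mul_smul]; exact ht.trans (hg.smul t)
    · intro t' ht'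
      rcases List.mem_cons.1 ht' with rfl | ht'
      · refine ⟨1, by rw [one_smul]; exact AS.of_sub subset_rfl, ?_⟩
        rw [one_mul, mul_smul]; exact hg.smul _
      · obtain ⟨k, hk1, hk2⟩ := h t' ht'
        refine ⟨t * k, ?_, ?_⟩
        · rw [mul_smul]; exact ht.trans (hk1.smul t)
        · rw [mul_assoc, mul_smul, mul_smul t]; exact hk2.smul t

namespace ED

lemma univ_elt (T : ED G) {U : Set G} (hU : NT U) : ∃ g : G, AS U (g • U) ∧ ¬ AS (g • U) U ∧
    ∀ V, NT V → ∃ h : G, AS (h • U) V ∧ AS V ((h * g) • U) := by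
  classical
  obtain ⟨Φ, Φf, hΦ⟩ := T.star
  have hp : ∀ (f : G) (i : Fin 3), ∃ p : G, p • U ⊆ f • T.C i := fun f i =>
    (T.TT hU ((T.NTC i).smul f).1 ((T.NTC i).smul f).2.1).1
  have hq : ∀ (f : G) (i : Fin 3), ∃ q : G, (q • U)ᶜ ⊆ f • T.C i := fun f i =>
    (T.TT hU ((T.NTC i).smul f).1 ((T.NTC i).smul f).2.1).2
  choose p hp using hp
  choose q hq using hq
  obtain ⟨A1, A2, n1, n2, hd, s1, s2⟩ := T.pieces hU.1 hU.2.1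
  obtain ⟨h0, hh0⟩ := (T.TT hU n1.1 n1.2.1).1
  have t1 : AS U (h0⁻¹ • U) := by
    apply AS.of_sub
    have := Set.smul_set_mono (a := h0⁻¹) (hh0.trans s1)
    rwa [inv_smul_smul] at this
  have t2 : ¬ AS (h0⁻¹ • U) U := by
    intro h
    have := h.smul h0
    rw [smul_inv_smul] at this
    refine n2.2.1 (Set.Finite.subset this ?_)
    exact fun x hx => ⟨s2 hx, fun hx' => Set.disjoint_left.1 hd (hh0 hx') hx⟩
  let I := (Φ ×ˢ Φ) ×ˢ (Set.univ : Set (Fin 3 × Fin 3))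
  let F : (G × G) × (Fin 3 × Fin 3) → G := fun z => (p z.1.1 z.2.1)⁻¹ * q z.1.2 z.2.2
  have If : I.Finite := (Φf.prod Φf).prod Set.finite_univ
  have Tf : (insert h0⁻¹ {t ∈ F '' I | AS U (t • U)}).Finite :=
    ((If.image F).subset (Set.sep_subset _ _)).insert _
  obtain ⟨g, hg, hgt⟩ := list_prod (U := U) Tf.toFinset.toList (by
    intro t ht
    simp only [Finset.mem_toList, Set.Finite.mem_toFinset] at ht
    rcases ht with rfl | ht
    · exact t1
    · exact ht.2)
  simp only [Finset.mem_toList, Set.Finite.mem_toFinset] at hgt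
  refine ⟨g, hg, ?_, ?_⟩
  · intro h
    obtain ⟨k, hk1, hk2⟩ := hgt _ (Set.mem_insert _ _)
    have := (hk2.trans h).trans hk1
    rw [mul_smul] at this
    exact t2 this.of_smul
  · intro V hV
    obtain ⟨x, f, hf, f', hf', i, j, h1, h2⟩ := hΦ V hV
    have a1 : AS ((x * p f i) • U) V := by
      refine AS.trans (AS.of_sub ?_) h1
      rw [mul_smul, mul_smul]; exact Set.smul_set_mono (hp f i)
    have a2 : AS V ((x * q f' j) • U) := by
      refine Set.Finite.subset h2 ?_
      rintro y ⟨hy, hyq⟩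
      refine ⟨?_, hy⟩
      rw [mul_smul] at hyq ⊢
      have := Set.smul_set_mono (a := x) (hq f' j)
      rw [Set.smul_set_compl] at this
      exact this hyq
    have e : x * q f' j = x * p f i * ((p f i)⁻¹ * q f' j) := by group
    have a3 : AS U (((p f i)⁻¹ * q f' j) • U) := by
      have := a1.trans a2
      rw [e, mul_smul (x * p f i)] at this
      exact this.of_smul
    obtain ⟨k, hk1, hk2⟩ := hgt ((p f i)⁻¹ * q f' j)
      (Set.mem_insert_of_mem _ ⟨⟨((f, f'), (i, j)), ⟨⟨hf, hf'⟩, trivial⟩, rfl⟩, a3⟩)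
    refine ⟨x * p f i * k⁻¹, ?_, ?_⟩
    · refine AS.trans ?_ a1
      rw [mul_smul]
      refine AS.smul ?_ _
      have := hk1.smul k⁻¹
      rwa [inv_smul_smul] at this
    · refine a2.trans ?_
      rw [e, mul_smul (x * p f i), mul_assoc, mul_smul (x * p f i)]
      refine AS.smul ?_ _
      have := hk2.smul k⁻¹
      rw [mul_smul, inv_smul_smul, ← mul_smul] at this
      exact this

lemma ori (T : ED G) {D : Fin 3 → Set G} {K K' V : Set G} (hD : ∀ i j, i ≠ j → Disjoint (D i) (D j))
    (hDK : ∀ i, bd T.S (D i) ⊆ K') (hK : Conn T.S K) (hV : bd T.S V ⊆ K) (hd : Disjoint K K')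
    (hKV : K' ⊆ V) (hVn : V.Nonempty) : ∃ i j, i ≠ j ∧ D i ⊆ V ∧ D j ⊆ V := by
  have h1 : ∃ j0, ∀ j, j ≠ j0 → Disjoint K (D j) := by
    by_cases hc : ∃ j, (K ∩ D j).Nonempty
    · obtain ⟨j0, hj0⟩ := hc
      have := hK.sub (hd.mono_right (hDK j0)) hj0
      exact ⟨j0, fun j hj => Disjoint.mono_left this (hD _ _ hj.symm)⟩
    · push Not at hc
      exact ⟨0, fun j _ => Set.disjoint_iff_inter_eq_empty.2 (hc j)⟩
  obtain ⟨j0, hj0⟩ := h1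
  obtain ⟨i, j, hij, hi, hj⟩ := two j0
  have key : ∀ i, i ≠ j0 → D i ⊆ V := fun i hi =>
    nest_sub T.gen T.symm (Disjoint.mono_left hV (hj0 i hi)) ((hDK i).trans hKV) (Or.inl hVn)
  exact ⟨i, j, hij, key i hi, key j hj⟩

/-- the monoid of expanding elements generates -/
lemma gen_exp (T : ED G) {U : Set G} (hU : NT U) : Subgroup.closure {t : G | U ⊆ t • U} = ⊤ := by
  rw [eq_top_iff]
  have m : ∀ t : G, t • U ⊆ U → t ∈ Subgroup.closure {t : G | U ⊆ t • U} := by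
    intro t ht
    rw [← Subgroup.inv_mem_iff]
    apply Subgroup.subset_closure
    have := Set.smul_set_mono (a := t⁻¹) ht
    rwa [inv_smul_smul] at this
  have c1 : ∀ s : G, (U ∩ s • U).Infinite → s ∈ Subgroup.closure {t : G | U ⊆ t • U} := by
    intro s hs
    obtain ⟨t, ht⟩ := (T.TT hU (hU.1.inter (hU.1.smul s)) hs).1
    have h1 := m t (ht.trans Set.inter_subset_left)
    have h2 := m (s⁻¹ * t) (by
      have := Set.smul_set_mono (a := s⁻¹) (ht.trans Set.inter_subset_right)
      rwa [inv_smul_smul, ← mul_smul] at this)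
    have := Subgroup.mul_mem _ h1 (Subgroup.inv_mem _ h2)
    simpa using this
  rintro s -
  obtain ⟨A1, A2, n1, n2, hd, s1, s2⟩ := T.pieces hU.1 hU.2.1
  obtain ⟨r, hr⟩ := (T.TT hU n1.1 n1.2.1).2
  by_cases hs : (U ∩ s • U).Infinite
  · exact c1 s hs
  have hr' : A2 ⊆ r • U := by
    intro x hx
    by_contra hc
    exact Set.disjoint_left.1 hd (hr hc) hx
  have e1 := c1 r (n2.2.1.mono fun x hx => ⟨s2 hx, hr' hx⟩)
  have e2 := c1 (r⁻¹ * s) (by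
    have : (r • U ∩ s • U).Infinite := by
      intro hf
      have hs' := Set.not_infinite.1 hs
      refine (hU.smul s).2.1 ((hf.union hs').subset ?_)
      intro x hx
      by_cases hxr : x ∈ r • U
      · exact Or.inl ⟨hxr, hx⟩
      · exact Or.inr ⟨s1 (hr hxr), hx⟩
    have := infinite_smul this r⁻¹
    rwa [Set.smul_set_inter, inv_smul_smul, ← mul_smul] at this)
  have := Subgroup.mul_mem _ e1 e2
  simpa using this

end ED

lemma fin_gen (hfg : Group.FG G) {M : Set G} (hM : Subgroup.closure M = ⊤) :
    ∃ T : Finset G, (T : Set G) ⊆ M ∧ Subgroup.closure (T : Set G) = ⊤ := by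
  classical
  obtain ⟨S, hS⟩ := Group.fg_def.1 hfg
  have key : ∀ g : G, ∃ T : Finset G, (T : Set G) ⊆ M ∧ g ∈ Subgroup.closure (T : Set G) := by
    intro g
    have hg : g ∈ Subgroup.closure M := by rw [hM]; trivial
    induction hg using Subgroup.closure_induction with
    | mem s hs => exact ⟨{s}, by simpa using hs, Subgroup.subset_closure (by simp)⟩
    | one => exact ⟨∅, by simp, Subgroup.one_mem _⟩
    | mul a b _ _ ha hb =>
      obtain ⟨A, hA, hA'⟩ := ha
      obtain ⟨B, hB, hB'⟩ := hb
      refine ⟨A ∪ B, by rw [Finset.coe_union]; exact Set.union_subset hA hB, Subgroup.mul_mem _ ?_ ?_⟩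
      · exact Subgroup.closure_mono (by simp) hA'
      · exact Subgroup.closure_mono (by simp) hB'
    | inv a _ ha =>
      obtain ⟨A, hA, hA'⟩ := ha
      exact ⟨A, hA, Subgroup.inv_mem _ hA'⟩
  choose f hf1 hf2 using key
  refine ⟨S.biUnion f, by simpa using fun i _ => hf1 i, ?_⟩
  rw [eq_top_iff, ← hS, Subgroup.closure_le]
  intro s hs
  refine Subgroup.closure_mono ?_ (hf2 s)
  exact_mod_cast Finset.subset_biUnion_of_mem f hs

/-- free ultrafilters -/
def EE (X : Type u) : Type u := {ξ : Ultrafilter X // (ξ : Filter X) ≤ Filter.cofinite}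

section EE
variable {Γ : Type w} [Group Γ] {X : Type u} [MulAction Γ X]

instance : MulAction Γ (EE X) where
  smul γ ξ := ⟨ξ.1.map (γ • ·), by
    rw [Ultrafilter.coe_map]
    exact (Filter.map_mono ξ.2).trans (MulAction.injective γ).tendsto_cofinite⟩
  one_smul ξ := by
    apply Subtype.ext
    change ξ.1.map ((1 : Γ) • ·) = ξ.1
    simp
  mul_smul a b ξ := by
    apply Subtype.ext
    change ξ.1.map ((a * b) • ·) = (ξ.1.map (b • ·)).map (a • ·)
    rw [Ultrafilter.map_map]
    congr 1
    funext x
    simp [mul_smul]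

/-- clopen set of free ultrafilters -/
def hat (A : Set X) : Set (EE X) := {ξ | A ∈ ξ.1}

lemma hat_compl (A : Set X) : (hat A)ᶜ = hat Aᶜ := by
  ext ξ
  exact (Ultrafilter.compl_mem_iff_notMem (f := ξ.1)).symm

lemma smul_mem_hat (γ : Γ) (ξ : EE X) (A : Set X) : γ • ξ ∈ hat A ↔ ξ ∈ hat (γ⁻¹ • A) := by
  change A ∈ ξ.1.map (γ • ·) ↔ γ⁻¹ • A ∈ ξ.1
  rw [Ultrafilter.mem_map, Set.preimage_smul]

lemma smul_hat (γ : Γ) (A : Set X) : γ • hat A = hat (γ • A) := by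
  ext ξ
  rw [Set.mem_smul_set_iff_inv_smul_mem, smul_mem_hat, inv_inv]

lemma hat_nonempty {A : Set X} (h : A.Infinite) : (hat A).Nonempty := by
  have : (Filter.cofinite ⊓ Filter.principal A).NeBot := by
    rw [Filter.inf_principal_neBot_iff]
    intro U hU
    by_contra hc
    rw [Set.not_nonempty_iff_eq_empty] at hc
    refine h (Set.Finite.subset hU ?_)
    intro x hx hxU
    exact (Set.eq_empty_iff_forall_notMem.1 hc) x ⟨hxU, hx⟩
  obtain ⟨ξ, hξ⟩ := Ultrafilter.exists_le (Filter.cofinite ⊓ Filter.principal A)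
  exact ⟨⟨ξ, hξ.trans inf_le_left⟩, Filter.le_principal_iff.1 (hξ.trans inf_le_right)⟩

lemma hat_sub {A B : Set X} : hat A ⊆ hat B ↔ AS A B := by
  constructor
  · intro h
    by_contra hc
    obtain ⟨ξ, hξ⟩ := hat_nonempty hc
    have h1 : ξ ∈ hat A := Filter.mem_of_superset hξ Set.diff_subset
    have h2 : ξ ∈ (hat B)ᶜ := by
      rw [hat_compl]; exact Filter.mem_of_superset hξ fun x hx => hx.2
    exact h2 (h h1)
  · intro h ξ hξ
    have h1 : (A \ B)ᶜ ∈ (ξ.1 : Filter X) := ξ.2 (by rw [Filter.mem_cofinite, compl_compl]; exact h)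
    refine Filter.mem_of_superset (Filter.inter_mem hξ h1) ?_
    rintro x ⟨hx, hx'⟩
    by_contra hb
    exact hx' ⟨hx, hb⟩

end EE

end EndsAI

end

section
universe w
open scoped Pointwise

namespace EndsAI

variable {G : Type u} [Group G] {H : Type v} [Group H] {φ : H →* MulAut G}

instance semiAct : MulAction (G ⋊[φ] H) G where
  smul γ x := γ.left * φ γ.right x
  one_smul x := by change (1 : G ⋊[φ] H).left * φ (1 : G ⋊[φ] H).right x = x; simp
  mul_smul a b x := by
    change (a * b).left * φ (a * b).right x = a.left * φ a.right (b.left * φ b.right x)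
    simp [mul_assoc]

lemma semi_smul (γ : G ⋊[φ] H) (x : G) : γ • x = γ.left * φ γ.right x := rfl

lemma inl_smul (g x : G) : (SemidirectProduct.inl g : G ⋊[φ] H) • x = g * x := by
  rw [semi_smul]; simp

lemma inl_smul_set (g : G) (A : Set G) : (SemidirectProduct.inl g : G ⋊[φ] H) • A = g • A := by
  rw [← Set.image_smul, ← Set.image_smul]
  simp only [inl_smul, smul_eq_mul]

lemma smul_AI (γ : G ⋊[φ] H) {A : Set G} (hA : AI A) : AI (γ • A) := by
  have : γ • A = γ.left • (φ γ.right '' A) := by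
    rw [← Set.image_smul, ← Set.image_smul, Set.image_image]; rfl
  rw [this]
  exact (hA.map (φ γ.right)).smul _

lemma smul_NT (γ : G ⋊[φ] H) {A : Set G} (hA : NT A) : NT (γ • A) := by
  have inf : ∀ {B : Set G}, B.Infinite → (γ • B).Infinite := by
    intro B h
    rw [← Set.image_smul]
    exact h.image (MulAction.injective γ).injOn
  exact ⟨smul_AI γ hA.1, inf hA.2.1, by rw [← Set.smul_set_compl]; exact inf hA.2.2⟩

/-- majority -/
def majo (ξ : Fin 3 → EE G) (A : Set (EE G)) : Prop := ∃ i j, i ≠ j ∧ ξ i ∈ A ∧ ξ j ∈ A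

lemma majo_compl (ξ : Fin 3 → EE G) (A : Set (EE G)) : majo ξ Aᶜ ↔ ¬ majo ξ A := by
  simp only [majo, Fin.exists_fin_succ, Set.mem_compl_iff]
  by_cases h0 : ξ 0 ∈ A <;> by_cases h1 : ξ 1 ∈ A <;> by_cases h2 : ξ 2 ∈ A <;>
    simp [h0, h1, h2]

namespace ED

lemma maj_fin (T : ED G) {U : Set G} (hU : NT U) {ξ : Fin 3 → EE G} (hξ : ∀ i, ξ i ∈ hat (T.C i))
    (x y : G ⋊[φ] H) : {h : G | majo ξ (x⁻¹ • (SemidirectProduct.inl h : G ⋊[φ] H) • hat U) ∧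
      ¬ majo ξ (y⁻¹ • (SemidirectProduct.inl h : G ⋊[φ] H) • hat U)}.Finite := by
  have bf : ∀ (z : G ⋊[φ] H) (i : Fin 3), (bd T.S (z • T.C i)).Finite := fun z i =>
    (smul_AI z (T.AIC i)).bd_fin T.hS
  obtain ⟨K', Kf', Kc', Kb', -⟩ := T.exK ((Set.finite_iUnion (bf x)).union (Set.finite_iUnion (bf y)))
  obtain ⟨K, Kf, Kc, Kb, -⟩ := T.exK (hU.1.bd_fin T.hS)
  have key : ∀ (z : G ⋊[φ] H), (∀ i, bd T.S (z • T.C i) ⊆ K') → ∀ h : G, Disjoint K' (h • K) →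
      ∀ V : Set G, bd T.S V ⊆ h • K → V.Nonempty → K' ⊆ V → majo ξ (z⁻¹ • hat V) := by
    intro z hz h hd V hV hVn hK
    have hD : ∀ i j, i ≠ j → Disjoint (z • T.C i) (z • T.C j) := by
      intro i j hij
      rw [Set.disjoint_left]
      intro y hy hy'
      rw [Set.mem_smul_set_iff_inv_smul_mem] at hy hy'
      exact Set.disjoint_left.1 (T.Cdisj i j hij) hy hy'
    obtain ⟨i, j, hij, h1, h2⟩ := T.ori hD hz (Kc.smul h) hV hd.symm hK hVn
    have key2 : ∀ i, z • T.C i ⊆ V → ξ i ∈ z⁻¹ • hat V := by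
      intro i hi
      have : hat (T.C i) ⊆ hat (z⁻¹ • V) := hat_sub.2 (AS.of_sub (by
        have := Set.smul_set_mono (a := z⁻¹) hi
        rwa [inv_smul_smul] at this))
      rw [smul_hat]
      exact this (hξ i)
    exact ⟨i, j, hij, key2 i h1, key2 j h2⟩
  refine (Kf'.mul Kf.inv).subset ?_
  rintro h ⟨h1, h2⟩
  by_contra hc
  have hd := disj_smul hc
  have hb : bd T.S (h • U) ⊆ h • K := by rw [bd_smul]; exact Set.smul_set_mono Kb
  rw [smul_hat, inl_smul_set] at h1 h2
  rcases T.dich Kc' (V := h • U) (Disjoint.mono_right hb hd) with h3 | h3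
  · exact h2 (key y (fun i => (Set.subset_iUnion (fun i => bd T.S (y • T.C i)) i).trans
      (Set.subset_union_right.trans Kb')) h hd _ hb (hU.smul h).2.1.nonempty h3)
  · have := key x (fun i => (Set.subset_iUnion (fun i => bd T.S (x • T.C i)) i).trans
      (Set.subset_union_left.trans Kb')) h hd _ (by rw [bd_compl]; exact hb) (hU.smul h).2.2.nonempty h3
    rw [← hat_compl, Set.smul_set_compl, majo_compl] at this
    exact this h1

lemma centre_fin (T : ED G) {U : Set G} (hU : NT U) {ξ : Fin 3 → EE G}
    (hξ : ∀ i, ξ i ∈ hat (T.C i)) (p q : G)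
    (hp : majo ξ ((SemidirectProduct.inl p : G ⋊[φ] H)⁻¹ • hat U))
    (hq : ¬ majo ξ ((SemidirectProduct.inl q : G ⋊[φ] H)⁻¹ • hat U)) :
    {z : G | ∀ x, z * x = x * z}.Finite := by
  refine (T.maj_fin hU hξ (SemidirectProduct.inl p : G ⋊[φ] H) (SemidirectProduct.inl q)).subset ?_
  intro z hz
  have hz : ∀ x, z * x = x * z := hz
  have e : hat (z • U) = hat U := by
    have mz : ∀ x, x ∈ z • U ↔ x * z⁻¹ ∈ U := by
      intro x
      rw [Set.mem_smul_set_iff_inv_smul_mem, smul_eq_mul]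
      have : z⁻¹ * x = x * z⁻¹ := by
        rw [inv_mul_eq_iff_eq_mul, ← mul_assoc, hz, mul_assoc, mul_inv_cancel, mul_one]
      rw [this]
    apply subset_antisymm <;> rw [hat_sub] <;> refine (hU.1 z⁻¹).subset ?_ <;> rintro x ⟨h1, h2⟩ h3
    · exact h2 (h3.2 ((mz x).1 h1))
    · exact h2 ((mz x).2 (h3.1 h1))
  simp only [Set.mem_setOf_eq]
  rw [smul_hat (SemidirectProduct.inl z : G ⋊[φ] H), inl_smul_set, e]
  exact ⟨hp, hq⟩

lemma exists_xi (T : ED G) : ∃ ξ : Fin 3 → EE G, ∀ i, ξ i ∈ hat (T.C i) := by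
  choose ξ hξ using fun i => hat_nonempty (T.Cinf i)
  exact ⟨ξ, hξ⟩

lemma exists_p (T : ED G) {U : Set G} (hU : NT U) {ξ : Fin 3 → EE G} (hξ : ∀ i, ξ i ∈ hat (T.C i)) :
    ∃ p : G, majo ξ ((SemidirectProduct.inl p : G ⋊[φ] H)⁻¹ • hat U) := by
  obtain ⟨x, -, -, j0, hj0⟩ := T.exists_deep hU.1 hU.2.1 Set.finite_empty
  obtain ⟨i, j, hij, h1, h2⟩ := two j0
  have key : ∀ i, i ≠ j0 → ξ i ∈ (SemidirectProduct.inl x : G ⋊[φ] H)⁻¹ • hat U := by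
    intro i hi
    rw [← map_inv, smul_hat, inl_smul_set]
    refine (hat_sub.2 (AS.of_sub ?_)) (hξ i)
    have := Set.smul_set_mono (a := x⁻¹) (hj0 i hi)
    rwa [inv_smul_smul] at this
  exact ⟨x, i, j, hij, key i h1, key j h2⟩

lemma exists_q (T : ED G) {U : Set G} (hU : NT U) {ξ : Fin 3 → EE G} (hξ : ∀ i, ξ i ∈ hat (T.C i)) :
    ∃ p : G, ¬ majo ξ ((SemidirectProduct.inl p : G ⋊[φ] H)⁻¹ • hat U) := by
  obtain ⟨p, hp⟩ := T.exists_p (φ := φ) hU.compl hξ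
  refine ⟨p, ?_⟩
  rwa [← majo_compl, ← Set.smul_set_compl, hat_compl]

lemma centralizer_fin (T : ED G) (hK : ((MulAut.conj.range).comap φ : Set H).Finite) :
    {z : G ⋊[φ] H | ∀ h ∈ (SemidirectProduct.inl : G →* G ⋊[φ] H).range, z * h = h * z}.Finite := by
  have hU := T.NTC 0
  obtain ⟨ξ, hξ⟩ := T.exists_xi
  obtain ⟨p, hp⟩ := T.exists_p (φ := φ) hU hξ
  obtain ⟨q, hq⟩ := T.exists_q (φ := φ) hU hξ
  have hc := T.centre_fin hU hξ p q hp hq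
  refine Set.Finite.of_finite_fibers (fun z : G ⋊[φ] H => z.right) (hK.subset ?_) ?_
  · rintro _ ⟨z, hz, rfl⟩
    refine ⟨z.left⁻¹, ?_⟩
    ext x
    have := congrArg SemidirectProduct.left (hz (SemidirectProduct.inl x) ⟨x, rfl⟩)
    simp only [SemidirectProduct.mul_left, SemidirectProduct.left_inl, SemidirectProduct.right_inl,
      map_one, MulAut.one_apply] at this
    rw [MulAut.conj_apply, inv_inv, mul_assoc, ← this, inv_mul_cancel_left]
  · rintro _ ⟨z, hz, rfl⟩
    refine (hc.image fun c => SemidirectProduct.inl c * z).subset ?_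
    rintro z' ⟨hz', hzz⟩
    have hzz : z'.right = z.right := hzz
    have hm : z' * z⁻¹ = SemidirectProduct.inl (z' * z⁻¹).left := by
      ext
      · simp
      · simp [hzz]
    refine ⟨(z' * z⁻¹).left, ?_, ?_⟩
    · intro x
      have c1 := hz (SemidirectProduct.inl x) ⟨x, rfl⟩
      have c2 := hz' (SemidirectProduct.inl x) ⟨x, rfl⟩
      apply SemidirectProduct.inl_injective (φ := φ)
      rw [map_mul, map_mul, ← hm]
      have c1' : z⁻¹ * SemidirectProduct.inl x = SemidirectProduct.inl x * z⁻¹ := by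
        rw [inv_mul_eq_iff_eq_mul, ← mul_assoc, c1, mul_assoc, mul_inv_cancel, mul_one]
      rw [mul_assoc, c1', ← mul_assoc, c2, mul_assoc]
    · simp only
      rw [← hm]; simp

lemma exists_cutData (T : ED G) : ∃ D : CutData (G ⋊[φ] H) (EE G),
    D.G = (SemidirectProduct.inl : G →* G ⋊[φ] H).range ∧ D.U = hat (T.C 0) := by
  have hU := T.NTC 0
  set U := T.C 0
  obtain ⟨ξ, hξ⟩ := T.exists_xi
  obtain ⟨p, hp⟩ := T.exists_p (φ := φ) hU hξ
  obtain ⟨q, hq⟩ := T.exists_q (φ := φ) hU hξ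
  obtain ⟨g, hg1, hg2, hg3⟩ := T.univ_elt hU
  refine ⟨{ G := (SemidirectProduct.inl : G →* G ⋊[φ] H).range
            nrm := ?_
            U := hat U
            g := SemidirectProduct.inl g
            hgG := ⟨g, rfl⟩
            maj := majo ξ
            maj_mono := ?_
            maj_compl := majo_compl ξ
            cross_fin := ?_
            hgU := ?_
            univ := ?_
            hfin := ?_
            hp := ⟨_, hp⟩
            hq := ⟨_, hq⟩ }, rfl, rfl⟩
  · rw [SemidirectProduct.range_inl_eq_ker_rightHom]; infer_instance
  · rintro A B hAB ⟨i, j, hij, h1, h2⟩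
    exact ⟨i, j, hij, hAB h1, hAB h2⟩
  · refine ((T.nested hU.1 hU).image SemidirectProduct.inl).subset ?_
    rintro _ ⟨⟨h, rfl⟩, hc⟩
    refine ⟨h, ?_, rfl⟩
    intro hn
    rw [smul_hat, inl_smul_set] at hc
    obtain ⟨⟨a, a1, a2⟩, ⟨b, b1, b2⟩, ⟨c, c1, c2⟩, ⟨d, d1⟩⟩ := hc
    rw [Set.mem_compl_iff, Set.mem_union, not_or] at d1
    have hs : ∀ {A B : Set G}, A ⊆ B → hat A ⊆ hat B := fun h => hat_sub.2 (AS.of_sub h)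
    rcases hn with hn | hn | hn | hn
    · exact b2 (hs hn b1)
    · have := hs hn; rw [← hat_compl] at this; exact d1.2 (this d1.1)
    · have := hs hn; rw [← hat_compl] at this; exact this a1 a2
    · have := hs hn; rw [← hat_compl, ← hat_compl] at this; exact this c2 c1
  · rw [smul_hat, inl_smul_set]
    exact ⟨hat_sub.2 hg1, fun h => hg2 (hat_sub.1 h)⟩
  · intro V hV
    have : ∃ V0, NT V0 ∧ V = hat V0 := by
      obtain ⟨γ, rfl | rfl⟩ := hV
      · exact ⟨_, smul_NT γ hU, smul_hat γ U⟩
      · exact ⟨_, (smul_NT γ hU).compl, by rw [smul_hat, hat_compl]⟩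
    obtain ⟨V0, n0, rfl⟩ := this
    obtain ⟨h, h1, h2⟩ := hg3 V0 n0
    refine ⟨SemidirectProduct.inl h, ⟨h, rfl⟩, ?_, ?_⟩
    · rw [smul_hat, inl_smul_set]; exact hat_sub.2 h1
    · rw [← map_mul, smul_hat, inl_smul_set]; exact hat_sub.2 h2
  · intro x y
    refine ((T.maj_fin hU hξ x y).image SemidirectProduct.inl).subset ?_
    rintro _ ⟨⟨h, rfl⟩, h1, h2⟩
    exact ⟨h, ⟨h1, h2⟩, rfl⟩

lemma not_vc (T : ED G) : ¬ VirtuallyCyclic (G ⋊[φ] H) := by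
  rintro ⟨A, hA, hcyc⟩
  have hU := T.NTC 0
  set U := T.C 0
  obtain ⟨A1, A2, n1, n2, hd, s1, s2⟩ := T.pieces hU.1 hU.2.1
  obtain ⟨a, ha⟩ := (T.TT hU n1.1 n1.2.1).1
  obtain ⟨b, hb⟩ := (T.TT hU n2.1 n2.2.1).1
  obtain ⟨k, hk, -, hak⟩ := Subgroup.exists_pow_mem_of_index_ne_zero hA.index_ne_zero
    (SemidirectProduct.inl a : G ⋊[φ] H)
  obtain ⟨l, hl, -, hbl⟩ := Subgroup.exists_pow_mem_of_index_ne_zero hA.index_ne_zero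
    (SemidirectProduct.inl b : G ⋊[φ] H)
  have pw : ∀ (a : G) (A1 : Set G), A1 ⊆ U → a • U ⊆ A1 → ∀ n, 0 < n → a ^ n • U ⊆ A1 := by
    intro a A1 hs ha n hn
    obtain ⟨n, rfl⟩ := Nat.exists_eq_succ_of_ne_zero hn.ne'
    have h0 : ∀ n, a ^ n • U ⊆ U := by
      intro n
      induction n with
      | zero => simp
      | succ n ih => rw [pow_succ, mul_smul]; exact (Set.smul_set_mono (ha.trans hs)).trans ih
    rw [Nat.succ_eq_add_one, pow_succ', mul_smul]
    exact (Set.smul_set_mono (h0 n)).trans ha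
  have hcomm : a ^ k * b ^ l = b ^ l * a ^ k := by
    letI := hcyc.commGroup
    have := congrArg Subtype.val (mul_comm (⟨_, hak⟩ : A) ⟨_, hbl⟩)
    apply SemidirectProduct.inl_injective (φ := φ)
    simpa using this
  have e1 : (a ^ k * b ^ l) • U ⊆ A1 := by
    rw [mul_smul]
    exact (Set.smul_set_mono ((pw b A2 s2 hb l hl).trans s2)).trans (pw a A1 s1 ha k hk)
  have e2 : (a ^ k * b ^ l) • U ⊆ A2 := by
    rw [hcomm, mul_smul]
    exact (Set.smul_set_mono ((pw a A1 s1 ha k hk).trans s1)).trans (pw b A2 s2 hb l hl)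
  obtain ⟨y, hy⟩ := (hU.smul (a ^ k * b ^ l)).2.1.nonempty
  exact Set.disjoint_left.1 hd (e1 hy) (e2 hy)

theorem reverse (T : ED G) (hfg : Group.FG G) (hK : ((MulAut.conj.range).comap φ : Set H).Finite) :
    AcylindricallyHyperbolic (G ⋊[φ] H) := by
  classical
  refine ⟨T.not_vc, ?_⟩
  obtain ⟨D, hDG, hDU⟩ := T.exists_cutData (φ := φ)
  obtain ⟨M, hM, hMc⟩ := fin_gen hfg (T.gen_exp (T.NTC 0))
  refine D.main (M.image SemidirectProduct.inl) ?_ ?_ ?_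
  · intro t ht
    obtain ⟨m, hm, rfl⟩ := Finset.mem_image.1 ht
    rw [hDU, smul_hat, inl_smul_set]
    exact hat_sub.2 (AS.of_sub (hM hm))
  · rw [Finset.coe_image, ← MonoidHom.map_closure, hMc, hDG, MonoidHom.range_eq_map]
  · rw [hDG]; exact T.centralizer_fin hK

end ED

end EndsAI

end

section
universe w
open scoped Pointwise

namespace EndsAI

variable {G : Type u} [Group G]

lemma cay_adj {S : Set G} {x y : G} : (cayleyGraph S).Adj x y ↔ x ≠ y ∧ (x⁻¹ * y ∈ S ∨ y⁻¹ * x ∈ S) :=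
  SimpleGraph.fromRel_adj _ _ _

lemma cc_conn {S : Set G} {B : Set G} (C : (cayleyGraph S).ComponentCompl B) :
    Conn (S ∪ S⁻¹) (C : Set G) := by
  rintro P ⟨x, ⟨hxB, hxC⟩, hxP⟩ hcl y ⟨hyB, hyC⟩
  have hr : ((cayleyGraph S).induce Bᶜ).Reachable ⟨x, hxB⟩ ⟨y, hyB⟩ :=
    SimpleGraph.ConnectedComponent.eq.1 (hxC.trans hyC.symm)
  rw [SimpleGraph.reachable_iff_reflTransGen] at hr
  have key : ∀ z, Relation.ReflTransGen ((cayleyGraph S).induce Bᶜ).Adj ⟨x, hxB⟩ z →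
      z.1 ∈ C ∧ z.1 ∈ P := by
    intro z hz
    induction hz with
    | refl => exact ⟨⟨hxB, hxC⟩, hxP⟩
    | tail _ hadj ih =>
      rename_i b c _
      have ha : (cayleyGraph S).Adj b.1 c.1 := hadj
      have hc : c.1 ∈ C := SimpleGraph.ComponentCompl.mem_of_adj _ _ ih.1 c.2 ha
      refine ⟨hc, ?_⟩
      have := hcl b.1 ih.1 ih.2 (b.1⁻¹ * c.1) (by
        rcases (cay_adj.1 ha).2 with h | h
        · exact Or.inl h
        · right; rw [Set.mem_inv]; simpa using h) (by simpa using hc)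
      simpa using this
  exact (key _ hr).2

theorem exists_ED (hfg : Group.FG G) (hends : InfinitelyManyEnds G) : Nonempty (ED G) := by
  classical
  obtain ⟨S, hS⟩ := Group.fg_def.1 hfg
  have hinf := hends S hS
  have hgen : Subgroup.closure ((S : Set G) ∪ (S : Set G)⁻¹) = ⊤ := by
    rw [eq_top_iff, ← hS]; exact Subgroup.closure_mono Set.subset_union_left
  have hsymm : ∀ s ∈ (S : Set G) ∪ (S : Set G)⁻¹, s⁻¹ ∈ (S : Set G) ∪ (S : Set G)⁻¹ := by
    rintro s (hs | hs)
    · right; simpa using hs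
    · left; simpa using hs
  have hfin : ((S : Set G) ∪ (S : Set G)⁻¹).Finite := S.finite_toSet.union S.finite_toSet.inv
  let e : Fin 3 → (cayleyGraph (S : Set G)).end := fun i => hinf.natEmbedding _ i.1
  have einj : Function.Injective e := fun i j h => Fin.ext ((hinf.natEmbedding _).injective h)
  have hK : ∀ i j : Fin 3, ∃ K : Finset G, i ≠ j → (e i).1 (Opposite.op K) ≠ (e j).1 (Opposite.op K) := by
    intro i j
    by_cases hij : i = j
    · exact ⟨∅, fun h => absurd hij h⟩
    by_contra hc
    push Not at hc
    refine hij (einj (Subtype.ext (funext fun K => ?_)))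
    exact (hc K.unop).2
  choose K hK using hK
  obtain ⟨B, Bf, Bc, Bs, B1⟩ := exists_conn hfin hgen hsymm
    (Set.finite_iUnion fun i => Set.finite_iUnion fun j => (K i j).finite_toSet)
  have BB : ((Bf.toFinset : Finset G) : Set G) = B := Bf.coe_toFinset
  let C : Fin 3 → (cayleyGraph (S : Set G)).ComponentCompl (Bf.toFinset : Set G) :=
    fun i => (e i).1 (Opposite.op Bf.toFinset)
  have Cne : ∀ i j, i ≠ j → C i ≠ C j := by
    intro i j hij h
    have hsub : K i j ⊆ Bf.toFinset := by
      intro x hx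
      rw [Set.Finite.mem_toFinset]
      exact Bs (Set.mem_iUnion.2 ⟨i, Set.mem_iUnion.2 ⟨j, hx⟩⟩)
    apply hK i j hij
    have h1 := (e i).2 (CategoryTheory.opHomOfLE hsub)
    have h2 := (e j).2 (CategoryTheory.opHomOfLE hsub)
    rw [← h1, ← h2]
    exact congrArg _ h
  refine ⟨{ S := (S : Set G) ∪ (S : Set G)⁻¹
            hS := hfin
            gen := hgen
            symm := hsymm
            B := B
            Bfin := Bf
            one := B1
            Bconn := Bc
            C := fun i => (C i : Set G)
            Cinf := ?_
            Cconn := fun j => cc_conn (C j)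
            Cdisj := fun i j hij => SimpleGraph.ComponentCompl.pairwise_disjoint (Cne i j hij)
            BC := ?_
            Cclosed := ?_ }⟩
  · intro i
    refine (C i).infinite_iff_in_all_ranges.mpr (fun L h => ?_)
    exact ⟨(e i).1 (Opposite.op L), ((e i).2 (CategoryTheory.opHomOfLE h))⟩
  · intro j
    have := (C j).disjoint_right
    exact Disjoint.mono_left BB.ge this
  · intro j x hx s hs hB
    by_cases h1 : s = 1
    · simpa [h1] using hx
    refine SimpleGraph.ComponentCompl.mem_of_adj x (x * s) hx (by rw [BB]; exact hB) (cay_adj.2 ⟨?_, ?_⟩)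
    · simpa using h1
    · rcases hs with hs | hs
      · left; simpa using hs
      · right; simpa using hs

end EndsAI

end

section
universe w
open scoped Pointwise

namespace EndsAI

section count
variable {Y : Type w} [MetricSpace Y] {Γ : Type u} [Group Γ]

lemma fellow {δ : ℝ} (hδ : 0 ≤ δ) (hyp : GromovHyperbolic Y δ) {x y X Z p q : Y} {R t1 t2 D : ℝ}
    (hD : dist x y = D) (hXZ : dist X Z = D) (hxX : dist x X ≤ R) (hyZ : dist y Z ≤ R)
    (hXp : dist X p = t1) (hpZ : dist p Z = D - t1) (hXq : dist X q = t2) (hpq : dist p q = t2 - t1)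
    (h1 : R + 2 * δ < t1) (h2 : R + 2 * δ < D - t1) :
    dist x p + dist p y ≤ D + 4 * δ ∧ dist x p + (t2 - t1) ≤ dist x q + 2 * δ := by
  have e1 := hyp x p X Z
  have e2 := hyp p y x Z
  have e3 := hyp x p X q
  have a1 := dist_triangle X x p
  have a2 := dist_triangle p y Z
  rw [dist_comm X x] at a1
  rw [dist_comm p x] at e2
  rw [dist_comm p X] at e1 e3
  constructor
  · have e1' : dist x p + D - t1 ≤ dist x Z + 2 * δ := by
      rcases max_cases (dist x X + dist p Z) (dist x Z + dist X p) with ⟨h, _⟩ | ⟨h, _⟩ <;>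
        rw [h] at e1 <;> linarith
    rcases max_cases (dist x p + dist y Z) (dist p Z + dist y x) with ⟨h, _⟩ | ⟨h, _⟩ <;>
      rw [h] at e2
    · linarith
    · rw [dist_comm y x] at e2; linarith
  · rcases max_cases (dist x X + dist p q) (dist x q + dist X p) with ⟨h, _⟩ | ⟨h, _⟩ <;>
      rw [h] at e3 <;> linarith

lemma close {δ : ℝ} (hyp : GromovHyperbolic Y δ) {x y p p' : Y} {D c : ℝ} (hD : dist x y = D)
    (h1 : dist x p + dist p y ≤ D + 4 * δ) (h2 : dist x p' + dist p' y ≤ D + 4 * δ)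
    (h3 : |dist x p - dist x p'| ≤ c) : dist p p' ≤ 6 * δ + c := by
  have e := hyp p p' x y
  rw [abs_le] at h3
  rw [dist_comm p x, dist_comm p' x] at e
  rcases max_cases (dist x p + dist p' y) (dist p y + dist x p') with ⟨h, _⟩ | ⟨h, _⟩ <;>
    rw [h] at e <;> linarith

lemma linear_count (hY : HyperbolicGeodesicSpace Y) (ρ : Γ →* (Y ≃ᵢ Y)) (hac : IsAcylindrical ρ) :
    ∃ N : ℕ, ∀ (x : Y) (C : Set Γ), (∀ D : ℝ, ∃ c ∈ C, D < dist x (ρ c x)) →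
      ∀ (R : ℕ) (F : Finset Γ), (∀ g ∈ F, dist x (ρ g x) ≤ R) → (∀ g ∈ F, ∀ c ∈ C, g * c = c * g) →
        F.card ≤ N * (2 * R + 1) := by
  classical
  obtain ⟨hgeo, δ, hδ, hyp⟩ := hY
  obtain ⟨L, hL, N, hN⟩ := hac (8 * δ + 2) (by linarith)
  refine ⟨N, ?_⟩
  intro x C hC R F hF hcomm
  obtain ⟨c, hc, hcD⟩ := hC (2 * (R + 2 * δ + 1) + (L + 1))
  set y := ρ c x with hy
  set D := dist x y with hD
  obtain ⟨f, f0, fD, hf⟩ := hgeo x y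
  rw [← hD] at fD hf
  set t1 : ℝ := R + 2 * δ + 1 with ht1
  set t2 : ℝ := t1 + L + 1 with ht2
  have R0 : (0 : ℝ) ≤ R := Nat.cast_nonneg R
  have m0 : (0 : ℝ) ∈ Set.Icc 0 D := ⟨le_rfl, by linarith⟩
  have mD : D ∈ Set.Icc 0 D := ⟨by linarith, le_rfl⟩
  have m1 : t1 ∈ Set.Icc 0 D := ⟨by linarith, by linarith⟩
  have m2 : t2 ∈ Set.Icc 0 D := ⟨by linarith, by linarith⟩
  have d01 : dist x (f t1) = t1 := by
    rw [← f0, hf 0 m0 t1 m1, zero_sub, abs_neg, abs_of_nonneg m1.1]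
  have d02 : dist x (f t2) = t2 := by
    rw [← f0, hf 0 m0 t2 m2, zero_sub, abs_neg, abs_of_nonneg m2.1]
  have d12 : dist (f t1) (f t2) = t2 - t1 := by
    rw [hf t1 m1 t2 m2, abs_sub_comm, abs_of_nonneg (by linarith)]
  have d1D : dist (f t1) y = D - t1 := by
    rw [← fD, hf t1 m1 D mD, abs_sub_comm, abs_of_nonneg (by linarith)]
  have d2D : dist (f t2) y = D - t2 := by
    rw [← fD, hf t2 m2 D mD, abs_sub_comm, abs_of_nonneg (by linarith)]
  have info : ∀ g ∈ F, (dist x (ρ g (f t1)) + dist (ρ g (f t1)) y ≤ D + 4 * δ ∧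
      dist x (ρ g (f t1)) + (t2 - t1) ≤ dist x (ρ g (f t2)) + 2 * δ) ∧
      dist x (ρ g (f t2)) + dist (ρ g (f t2)) y ≤ D + 4 * δ ∧
      dist x (ρ g (f t2)) ≤ dist x (ρ g (f t1)) + (t2 - t1) ∧
      |dist x (ρ g (f t1)) - t1| ≤ R := by
    intro g hg
    have b1 : dist x (ρ g x) ≤ R := hF g hg
    have b2 : dist y (ρ g y) ≤ R := by
      have : ρ g y = ρ c (ρ g x) := by
        rw [hy, ← IsometryEquiv.mul_apply, ← map_mul, hcomm g hg c hc, map_mul, IsometryEquiv.mul_apply]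
      rw [this, hy, (ρ c).dist_eq]; exact b1
    have e12 : dist (ρ g (f t1)) (ρ g (f t2)) = t2 - t1 := by rw [(ρ g).dist_eq, d12]
    have t := dist_triangle x (ρ g (f t1)) (ρ g (f t2))
    have t' := dist_triangle x (ρ g x) (ρ g (f t1))
    have t'' := dist_triangle (ρ g x) x (ρ g (f t1))
    rw [dist_comm (ρ g x) x] at t''
    have ex : dist (ρ g x) (ρ g (f t1)) = t1 := by rw [(ρ g).dist_eq, d01]
    refine ⟨fellow hδ hyp hD.symm (X := ρ g x) (Z := ρ g y) (by rw [(ρ g).dist_eq]) b1 b2 ex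
      (by rw [(ρ g).dist_eq, d1D]) (by rw [(ρ g).dist_eq, d02]) e12 (by linarith) (by linarith),
      (fellow hδ hyp hD.symm (X := ρ g x) (Z := ρ g y) (q := ρ g (f t2)) (t2 := t2)
      (by rw [(ρ g).dist_eq]) b1 b2 (by rw [(ρ g).dist_eq, d02])
      (by rw [(ρ g).dist_eq, d2D]) (by rw [(ρ g).dist_eq, d02]) (by simp) (by linarith)
      (by linarith)).1, by linarith, ?_⟩
    rw [abs_le]; constructor <;> linarith
  let bin : Γ → ℤ := fun g => ⌊dist x (ρ g (f t1)) - t1⌋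
  have hmaps : ∀ g ∈ F, bin g ∈ Finset.Icc (-(R : ℤ)) R := by
    intro g hg
    have := abs_le.1 (info g hg).2.2.2
    rw [Finset.mem_Icc]
    constructor
    · apply Int.le_floor.2; push_cast; exact this.1
    · have h1 : bin g ≤ ⌊(R : ℝ)⌋ := Int.floor_le_floor this.2
      simpa using h1
  have hcard : (Finset.Icc (-(R : ℤ)) R).card = 2 * R + 1 := by
    rw [Int.card_Icc]; omega
  rw [← hcard]
  refine Finset.card_le_mul_card_image_of_maps_to hmaps N ?_
  intro b _
  rcases (F.filter fun g => bin g = b).eq_empty_or_nonempty with he | ⟨g, hg⟩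
  · rw [he]; simp
  obtain ⟨s, hs, hs'⟩ := hN (f t1) (f t2) (by rw [d12]; linarith)
  refine le_trans (Finset.card_le_card_of_injOn (fun g' => g⁻¹ * g') ?_
    (mul_right_injective _).injOn) hs
  intro g' hg'
  rw [Finset.mem_filter] at hg
  rw [Finset.mem_coe, Finset.mem_filter] at hg'
  obtain ⟨⟨i1, i2⟩, i3, i4, -⟩ := info g hg.1
  obtain ⟨⟨j1, j2⟩, j3, j4, -⟩ := info g' hg'.1
  have hbin : |dist x (ρ g (f t1)) - dist x (ρ g' (f t1))| ≤ 1 := by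
    have e : bin g = bin g' := hg.2.trans hg'.2.symm
    have := Int.abs_sub_lt_one_of_floor_eq_floor e
    rw [sub_sub_sub_cancel_right] at this
    exact this.le
  have hbin2 : |dist x (ρ g (f t2)) - dist x (ρ g' (f t2))| ≤ 1 + 2 * δ := by
    rw [abs_le] at *; constructor <;> linarith
  have c1 := close hyp hD.symm i1 j1 hbin
  have c2 := close hyp hD.symm i3 j3 hbin2
  have tr : ∀ z, dist z (ρ (g⁻¹ * g') z) = dist (ρ g z) (ρ g' z) := by
    intro z
    rw [← (ρ g).dist_eq, ← IsometryEquiv.mul_apply, ← map_mul, mul_inv_cancel_left]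
  apply hs'
  · rw [tr]; linarith
  · rw [tr]; linarith

lemma unbdd_normal (ρ : Γ →* (Y ≃ᵢ Y)) (hac : IsAcylindrical ρ) (x : Y)
    (hx : ¬ Bornology.IsBounded (Set.range fun g => ρ g x)) {C : Set Γ} (hC : C.Infinite)
    (hn : ∀ c ∈ C, ∀ γ : Γ, γ⁻¹ * c * γ ∈ C) : ∀ D : ℝ, ∃ c ∈ C, D < dist x (ρ c x) := by
  intro D
  by_contra hcon
  push Not at hcon
  obtain ⟨L, hL, N, hN⟩ := hac (|D| + 1) (by positivity)
  have : ∃ γ, L < dist x (ρ γ x) := by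
    by_contra hc
    push Not at hc
    apply hx
    refine (Metric.isBounded_closedBall (x := x) (r := L)).subset ?_
    rintro _ ⟨γ, rfl⟩
    rw [Metric.mem_closedBall, dist_comm]; exact hc γ
  obtain ⟨γ, hγ⟩ := this
  obtain ⟨s, -, hs⟩ := hN _ _ hγ
  refine hC (s.finite_toSet.subset fun c hc => hs c ?_ ?_)
  · linarith [hcon c hc, le_abs_self D]
  · have e : dist (ρ γ x) (ρ c (ρ γ x)) = dist x (ρ (γ⁻¹ * c * γ) x) := by
      rw [← (ρ γ).dist_eq x, ← IsometryEquiv.mul_apply, ← map_mul, ← IsometryEquiv.mul_apply, ← map_mul]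
      congr 3
      group
    rw [e]
    linarith [hcon _ (hn c hc γ), le_abs_self D]

end count

variable {G : Type u} [Group G] {H : Type v} [Group H] {φ : H →* MulAut G}

lemma quad_inj {A A1 A2 : Set G} (hne : A.Nonempty) {a b : G} (ha : a • A ⊆ A1) (hb : b • A ⊆ A2)
    (s1 : A1 ⊆ A) (s2 : A2 ⊆ A) (hd : Disjoint A1 A2) :
    Function.Injective fun p : ℕ × ℕ => a ^ p.1 * b * a ^ p.2 := by
  obtain ⟨y0, hy0⟩ := hne
  have apow : ∀ n, a ^ n • A ⊆ A := by
    intro n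
    induction n with
    | zero => simp
    | succ n ih => rw [pow_succ, mul_smul]; exact (Set.smul_set_mono (ha.trans s1)).trans ih
  have apow1 : ∀ n, a ^ (n + 1) • A ⊆ A1 := by
    intro n
    rw [pow_succ', mul_smul]; exact (Set.smul_set_mono (apow n)).trans ha
  have contra : ∀ n (X Y : G), a ^ (n+1) * X = b * Y → X • A ⊆ A → Y • A ⊆ A → False := by
    intro n X Y h hX hY
    have h1 : (a ^ (n+1) * X) • A ⊆ A1 := by
      rw [mul_smul]; exact (Set.smul_set_mono hX).trans (apow1 n)
    have h2 : (a ^ (n+1) * X) • A ⊆ A2 := by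
      rw [h, mul_smul]; exact (Set.smul_set_mono hY).trans hb
    have h3 : (a ^ (n+1) * X) * y0 ∈ (a ^ (n+1) * X) • A := ⟨y0, hy0, rfl⟩
    exact Set.disjoint_left.1 hd (h1 h3) (h2 h3)
  have baA : ∀ j, (b * a ^ j) • A ⊆ A := by
    intro j; rw [mul_smul]; exact (Set.smul_set_mono (apow _)).trans (hb.trans s2)
  have Winj1 : ∀ p q : ℕ × ℕ, a ^ p.1 * b * a ^ p.2 = a ^ q.1 * b * a ^ q.2 → ¬ p.1 < q.1 := by
    intro p q h hlt
    obtain ⟨n, hn⟩ := Nat.exists_eq_add_of_lt hlt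
    have h' : a ^ p.1 * (b * a ^ p.2) = a ^ p.1 * (a ^ (n + 1) * (b * a ^ q.2)) := by
      rw [← mul_assoc, h, hn, show p.1 + n + 1 = p.1 + (n + 1) by ring, pow_add]
      simp only [mul_assoc]
    exact contra n (b * a ^ q.2) (a ^ p.2) (mul_left_cancel h').symm (baA _) (apow _)
  have Winj2 : ∀ i j : ℕ, a ^ i = a ^ j → ¬ i < j := by
    intro i j h hlt
    obtain ⟨n, hn⟩ := Nat.exists_eq_add_of_lt hlt
    have : a ^ (n + 1) = 1 := by
      rw [hn, show i + n + 1 = i + (n + 1) by ring, pow_add] at h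
      exact left_eq_mul.1 h
    refine contra n b 1 (by rw [this]; simp) (hb.trans s2) (by simp)
  intro p q h
  have h : a ^ p.1 * b * a ^ p.2 = a ^ q.1 * b * a ^ q.2 := h
  have e1 : p.1 = q.1 := le_antisymm (not_lt.1 (Winj1 q p h.symm)) (not_lt.1 (Winj1 p q h))
  have e2 : a ^ p.2 = a ^ q.2 := by
    rw [e1] at h; exact mul_left_cancel h
  exact Prod.ext e1 (le_antisymm (not_lt.1 (Winj2 _ _ e2.symm)) (not_lt.1 (Winj2 _ _ e2)))

theorem ED.forward (T : ED G) (h : AcylindricallyHyperbolic (G ⋊[φ] H)) :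
    ((MulAut.conj.range).comap φ : Set H).Finite := by
  classical
  obtain ⟨-, Y, _, ρ, hY, hac, x, hx⟩ := h
  let C : Set (G ⋊[φ] H) := {z | ∀ g : G, SemidirectProduct.inl g * z = z * SemidirectProduct.inl g}
  have toK : C.Finite → ((MulAut.conj.range).comap φ : Set H).Finite := by
    intro hC
    refine (hC.image fun z => z.right).subset ?_
    rintro k ⟨g, hg⟩
    refine ⟨⟨g⁻¹, k⟩, ?_, rfl⟩
    intro y
    ext
    · simp [← hg, mul_assoc]
    · simp
  by_contra hcon
  have hC : C.Infinite := fun h => hcon (toK h)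
  have hn : ∀ c ∈ C, ∀ γ : G ⋊[φ] H, γ⁻¹ * c * γ ∈ C := by
    intro c hc γ g
    have hm : γ * SemidirectProduct.inl g * γ⁻¹ ∈ (SemidirectProduct.inl : G →* G ⋊[φ] H).range := by
      have : ((SemidirectProduct.inl : G →* G ⋊[φ] H).range).Normal := by
        rw [SemidirectProduct.range_inl_eq_ker_rightHom]; infer_instance
      exact this.conj_mem _ ⟨g, rfl⟩ γ
    obtain ⟨g', hg'⟩ := hm
    have e := hc g'
    rw [hg'] at e
    have : γ * (SemidirectProduct.inl g * (γ⁻¹ * c * γ)) = γ * (γ⁻¹ * c * γ * SemidirectProduct.inl g) := by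
      calc γ * (SemidirectProduct.inl g * (γ⁻¹ * c * γ)) = (γ * SemidirectProduct.inl g * γ⁻¹ * c) * γ := by group
        _ = (c * (γ * SemidirectProduct.inl g * γ⁻¹)) * γ := by rw [e]
        _ = _ := by group
    exact mul_left_cancel this
  have hun := unbdd_normal ρ hac x hx hC hn
  obtain ⟨N, hN⟩ := linear_count hY ρ hac
  have hU := T.NTC 0
  obtain ⟨A1, A2, n1, n2, hd, s1, s2⟩ := T.pieces hU.1 hU.2.1
  obtain ⟨a, ha⟩ := (T.TT hU n1.1 n1.2.1).1
  obtain ⟨b, hb⟩ := (T.TT hU n2.1 n2.2.1).1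
  have hinj := quad_inj hU.2.1.nonempty ha hb s1 s2 hd
  let σ : G → ℝ := fun g => dist x (ρ (SemidirectProduct.inl g) x)
  have σmul : ∀ g g', σ (g * g') ≤ σ g + σ g' := by
    intro g g'
    have := dist_triangle x (ρ (SemidirectProduct.inl g) x) (ρ (SemidirectProduct.inl (g * g')) x)
    refine this.trans (add_le_add le_rfl (le_of_eq ?_))
    rw [map_mul, map_mul, IsometryEquiv.mul_apply, (ρ _).dist_eq]
  obtain ⟨M, hM⟩ := exists_nat_ge (max (σ a) (σ b))
  have hMa := (le_max_left _ _).trans hM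
  have hMb := (le_max_right _ _).trans hM
  have σpow : ∀ n : ℕ, σ (a ^ n) ≤ n * M := by
    intro n
    induction n with
    | zero => simp [σ]
    | succ n ih =>
      rw [pow_succ]
      have := σmul (a ^ n) a
      push_cast
      linarith
  let n := N * (4 * M + 1) + 1
  let F : Finset (G ⋊[φ] H) := (Finset.range n ×ˢ Finset.range n).image
    fun p => SemidirectProduct.inl (a ^ p.1 * b * a ^ p.2)
  have hFc : F.card = n * n := by
    refine (Finset.card_image_of_injective _
      ((SemidirectProduct.inl_injective (φ := φ)).comp hinj)).trans ?_
    simp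
  have := hN x C hun (2 * n * M) F ?_ ?_
  · rw [hFc] at this
    have h1 : N * (2 * (2 * n * M) + 1) ≤ N * (4 * M + 1) * n := by
      have : 2 * (2 * n * M) + 1 ≤ (4 * M + 1) * n := by
        have : 1 ≤ n := by omega
        nlinarith
      calc _ ≤ N * ((4 * M + 1) * n) := Nat.mul_le_mul_left _ this
        _ = _ := by ring
    have h2 : N * (4 * M + 1) * n < n * n := Nat.mul_lt_mul_of_pos_right (by omega) (by omega)
    omega
  · intro g hg
    obtain ⟨p, hp, rfl⟩ := Finset.mem_image.1 hg
    rw [Finset.mem_product, Finset.mem_range, Finset.mem_range] at hp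
    have b1 := σmul (a ^ p.1 * b) (a ^ p.2)
    have b2 := σmul (a ^ p.1) b
    have b3 := σpow p.1
    have b4 := σpow p.2
    have q1 : (p.1 : ℝ) + 1 ≤ n := by exact_mod_cast hp.1
    have q2 : (p.2 : ℝ) + 1 ≤ n := by exact_mod_cast hp.2
    have M0 : (0 : ℝ) ≤ M := Nat.cast_nonneg M
    change σ (a ^ p.1 * b * a ^ p.2) ≤ _
    push_cast
    nlinarith
  · intro g hg c hc
    obtain ⟨p, -, rfl⟩ := Finset.mem_image.1 hg
    exact hc _

end EndsAI

end

/-- For a finitely generated group `G` with infinitely many ends, a group `H` and a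
homomorphism `φ : H → Aut(G)`, the semidirect product `G ⋊_φ H` is acylindrically
hyperbolic if and only if the kernel of the composition `H → Aut(G) → Out(G)`,
i.e. the preimage under `φ` of the inner automorphisms, is a finite subgroup of `H`. -/
theorem semidirectProduct_acylindricallyHyperbolic_iff (G : Type u) [Group G]
    (hfg : Group.FG G) (hends : InfinitelyManyEnds G)
    (H : Type v) [Group H] (φ : H →* MulAut G) :
    AcylindricallyHyperbolic (G ⋊[φ] H) ↔
      Finite ↥(((MulAut.conj : G →* MulAut G).range).comap φ) := by
  obtain ⟨T⟩ := EndsAI.exists_ED hfg hends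
  constructor
  · intro h
    exact (T.forward h).to_subtype
  · intro h
    exact T.reverse hfg (Set.toFinite _)
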